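/- Let d ≥ 3 and let B be a collision kernel satisfying the standing assumptions (1.1) and the Lipschitz assumption (1.2). For all ε ∈ (0,1] and all τ, T ∈ (0,∞) with τ ≤ T, there is a constant C = C(B,d,ε,τ,T) < ∞ such that, for all N, N′ ∈ ℕ with N ≤ N′ and any Kac processes (μ_t^N)_{t≥0} in 𝒮_N and (μ_t^{N′})_{t≥0} in 𝒮_{N′} with respect to a common filtration, with probability exceeding 1 − ε one has W(μ_t^N, μ_t^{N′}) ≤ C (W(μ_τ^N, μ_τ^{N′}) + N^{−1/d}) for all t ∈ [τ, T]. -/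

import Mathlib

open MeasureTheory ProbabilityTheory Filter
open scoped ENNReal NNReal RealInnerProductSpace

noncomputable section

abbrev Vd (d : ℕ) := EuclideanSpace ℝ (Fin d)

namespace KacModel

variable {d : ℕ}

/-- Post-collision velocity `v' = (v+v*)/2 + |v-v*|σ/2`. -/
def postV (v vs σ : Vd d) : Vd d := (2:ℝ)⁻¹ • (v + vs) + ((2:ℝ)⁻¹ * ‖v - vs‖) • σ

/-- Post-collision velocity `v'_* = (v+v*)/2 - |v-v*|σ/2`. -/
def postVs (v vs σ : Vd d) : Vd d := (2:ℝ)⁻¹ • (v + vs) - ((2:ℝ)⁻¹ * ‖v - vs‖) • σ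

/-- The unit sphere `S^{d-1}` regarded as a subset of `ℝ^d`. -/
def unitSphere (d : ℕ) : Set (Vd d) := {σ | ‖σ‖ = 1}

/-- Standing assumptions (1.1) on a collision kernel, regarded as a family of
measures on `ℝ^d` carried by the unit sphere. -/
structure IsCollisionKernel (B : Vd d → Measure (Vd d)) : Prop where
  measurable : ∀ s : Set (Vd d), MeasurableSet s → Measurable fun v => B v s
  prob : ∀ u : Vd d, ‖u‖ = 1 → IsProbabilityMeasure (B u)
  support : ∀ u : Vd d, ‖u‖ = 1 → B u ((unitSphere d \ {u, -u})ᶜ) = 0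
  scaling : ∀ (c : ℝ), 0 ≤ c → ∀ u : Vd d, ‖u‖ = 1 →
    B (c • u) = ENNReal.ofReal c • B u
  symm : ∀ (R : Vd d ≃ₗᵢ[ℝ] Vd d) (u : Vd d), ‖u‖ = 1 → B (R u) = (B u).map R

/-- Total variation distance between two finite measures (dual formulation). -/
def tvDist {E : Type*} [MeasurableSpace E] (μ ν : Measure E) : ℝ :=
  ⨆ f : {f : E → ℝ // Measurable f ∧ ∀ x, |f x| ≤ 1},
    ((∫ x, f.1 x ∂μ) - ∫ x, f.1 x ∂ν)

/-- The Lipschitz assumption (1.2). -/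
def IsLipschitzKernel (B : Vd d → Measure (Vd d)) (κ : ℝ) : Prop :=
  1 ≤ κ ∧ ∀ v v' : Vd d, tvDist (B v) (B v') ≤ κ * ‖v - v'‖

/-- The Boltzmann sphere 𝒮. -/
def boltzmannSphere (d : ℕ) : Set (Measure (Vd d)) :=
  {μ | IsProbabilityMeasure μ ∧ (∫ v, v ∂μ) = 0 ∧ (∫ v, ‖v‖ ^ 2 ∂μ) = 1}

/-- 𝒮_N : normalized empirical measures in the Boltzmann sphere. -/
def empiricalSphere (d N : ℕ) : Set (Measure (Vd d)) :=
  {μ | μ ∈ boltzmannSphere d ∧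
    ∃ x : Fin N → Vd d, μ = (N : ℝ≥0∞)⁻¹ • ∑ i, Measure.dirac (x i)}

/-- The class ℱ of test functions. -/
def testF (d : ℕ) : Set (Vd d → ℝ) :=
  {f | (∀ v, |f v / (1 + ‖v‖ ^ 2)| ≤ 1) ∧
    ∀ v v', |f v / (1 + ‖v‖ ^ 2) - f v' / (1 + ‖v'‖ ^ 2)| ≤ ‖v - v'‖}

/-- The weighted Wasserstein distance W. -/
def Wdist (μ ν : Measure (Vd d)) : ℝ :=
  ⨆ f : testF d, ((∫ v, (f : Vd d → ℝ) v ∂μ) - ∫ v, (f : Vd d → ℝ) v ∂ν)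

/-- The p-th moment `∫ |v|^p dμ`, as a lower integral. -/
def momentL (p : ℝ) (μ : Measure (Vd d)) : ℝ≥0∞ :=
  ∫⁻ v, (‖v‖₊ : ℝ≥0∞) ^ p ∂μ

/-- Total variation measure |μ - ν| of the difference of two finite measures. -/
def tvMeasure {E : Type*} [MeasurableSpace E] (μ ν : Measure E) : Measure E :=
  (μ - ν) + (ν - μ)

/-- The post-collision update `μ^{v,v_*,σ}` of an empirical measure. -/
def collUpdate (N : ℕ) (μ : Measure (Vd d)) (v vs σ : Vd d) : Measure (Vd d) :=
  μ + (N : ℝ≥0∞)⁻¹ • (Measure.dirac (postV v vs σ) + Measure.dirac (postVs v vs σ))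
    - (N : ℝ≥0∞)⁻¹ • (Measure.dirac v + Measure.dirac vs)

/-- The generator 𝒢 of the Kac process. -/
def kacGen (B : Vd d → Measure (Vd d)) (N : ℕ) (F : Measure (Vd d) → ℝ)
    (μ : Measure (Vd d)) : ℝ :=
  N * ∫ v, (∫ vs, (∫ σ, (F (collUpdate N μ v vs σ) - F μ) ∂(B (v - vs))) ∂μ) ∂μ

/-- A Kac process with collision kernel `B` and particle number `N`:
a càdlàg adapted 𝒮_N-valued process solving the martingale problem for 𝒢. -/
structure IsKacProcess {Ω : Type*} [m : MeasurableSpace Ω]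
    (B : Vd d → Measure (Vd d)) (N : ℕ) (P : Measure Ω)
    (𝓕 : Filtration ℝ m) (μp : ℝ → Ω → Measure (Vd d)) : Prop where
  mem : ∀ t ω, μp t ω ∈ empiricalSphere d N
  adapted : ∀ f ∈ testF d, Adapted 𝓕 fun t ω => ∫ v, f v ∂(μp t ω)
  rightCont : ∀ ω, ∀ f ∈ testF d, ∀ t : ℝ,
    ContinuousWithinAt (fun s => ∫ v, f v ∂(μp s ω)) (Set.Ici t) t
  leftLim : ∀ ω, ∀ f ∈ testF d, ∀ t : ℝ, 0 < t →
    ∃ L : ℝ, Tendsto (fun s => ∫ v, f v ∂(μp s ω)) (nhdsWithin t (Set.Iio t)) (nhds L)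
  martingale : ∀ G : Measure (Vd d) → ℝ, Measurable G → (∃ M : ℝ, ∀ ν, |G ν| ≤ M) →
    Martingale (fun t ω => G (μp t ω) - ∫ s in Set.Ioc (0:ℝ) t, kacGen B N G (μp s ω)) 𝓕 P

/-- `⟨f, Q(μ,ν)⟩`, the Boltzmann collision integral. -/
def QInt (B : Vd d → Measure (Vd d)) (f : Vd d → ℝ) (μ ν : Measure (Vd d)) : ℝ :=
  ∫ v, (∫ vs, (∫ σ, (f (postV v vs σ) + f (postVs v vs σ) - f v - f vs) ∂(B (v - vs))) ∂ν) ∂μ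

/-- Measure solution of the spatially homogeneous Boltzmann equation, started at time τ. -/
def IsBoltzmannSolutionFrom (B : Vd d → Measure (Vd d)) (τ : ℝ)
    (μt : ℝ → Measure (Vd d)) : Prop :=
  (∀ t, τ ≤ t → μt t ∈ boltzmannSphere d) ∧
  ∀ f : Vd d → ℝ, Measurable f → (∃ M, ∀ v, |f v| ≤ M) → HasCompactSupport f →
    ∀ t, τ ≤ t →
      (∫ v, f v ∂(μt t)) = (∫ v, f v ∂(μt τ)) + ∫ s in Set.Ioc τ t, QInt B f (μt s) (μt s)

/-- Measure solution of the spatially homogeneous Boltzmann equation (start time 0). -/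
def IsBoltzmannSolution (B : Vd d → Measure (Vd d)) (μt : ℝ → Measure (Vd d)) : Prop :=
  IsBoltzmannSolutionFrom B 0 μt

/-- Local boundedness in 𝒮(p) from time τ on. -/
def LocBddMomentFrom (p τ : ℝ) (μt : ℝ → Measure (Vd d)) : Prop :=
  ∀ T, τ ≤ T → ∃ M : ℝ≥0∞, M ≠ ⊤ ∧ ∀ t ∈ Set.Icc τ T, momentL p (μt t) ≤ M

/-- Sample mean. -/
def sampleMean {Ω : Type*} {N : ℕ} (Vs : Fin N → Ω → Vd d) (ω : Ω) : Vd d :=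
  (N : ℝ)⁻¹ • ∑ i, Vs i ω

/-- Sample mean square. -/
def sampleQ {Ω : Type*} {N : ℕ} (Vs : Fin N → Ω → Vd d) (ω : Ω) : ℝ :=
  (N : ℝ)⁻¹ * ∑ i, ‖Vs i ω‖ ^ 2

/-- Sample variance. -/
def sampleS {Ω : Type*} {N : ℕ} (Vs : Fin N → Ω → Vd d) (ω : Ω) : ℝ :=
  sampleQ Vs ω - ‖sampleMean Vs ω‖ ^ 2

/-- The rescaled empirical distribution μ̃^N. -/
def rescaledEmpirical {Ω : Type*} {N : ℕ} (Vs : Fin N → Ω → Vd d)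
    (μdef : Measure (Vd d)) (ω : Ω) : Measure (Vd d) :=
  if 0 < sampleS Vs ω then
    (N : ℝ≥0∞)⁻¹ • ∑ i, Measure.dirac
      ((Real.sqrt (sampleS Vs ω))⁻¹ • (Vs i ω - sampleMean Vs ω))
  else μdef

/-- The N-sample empirical distribution. -/
def empMeasure {Ω : Type*} {N : ℕ} (Vs : Fin N → Ω → Vd d) (ω : Ω) : Measure (Vd d) :=
  (N : ℝ≥0∞)⁻¹ • ∑ i, Measure.dirac (Vs i ω)

end KacModel

open KacModel

namespace KacPf

section partA

variable {d : ℕ}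

abbrev Tri (d : ℕ) := (Vd d × Vd d) × Vd d

def wt (v : Vd d) : ℝ := 1 + ‖v‖ ^ 2

def Del (f : Vd d → ℝ) (p : Tri d) : ℝ :=
  f (postV p.1.1 p.1.2 p.2) + f (postVs p.1.1 p.1.2 p.2) - f p.1.1 - f p.1.2

def rt (p : Tri d) : ℝ := ‖p.1.1 - p.1.2‖

structure Good (B : Vd d → Measure (Vd d)) (b : Kernel (Vd d × Vd d) (Vd d)) (κ δ : ℝ) : Prop where
  markov : IsMarkovKernel b
  κ1 : 1 ≤ κ
  δ0 : 0 < δ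
  δ1 : δ ≤ 1
  eqB : ∀ v vs, B (v - vs) = ENNReal.ofReal ‖v - vs‖ • b (v, vs)
  sph : ∀ p, ∀ᵐ σ ∂(b p), ‖σ‖ = 1
  symm : ∀ f : Vd d → ℝ, Measurable f → ∀ v vs, v ≠ vs →
    ∫ σ, Del f ((v, vs), σ) ∂(b (v, vs)) = ∫ σ, Del f ((vs, v), σ) ∂(b (vs, v))
  lip : ∀ (x y vs : Vd d) (g : Vd d → ℝ) (S : ℝ), Measurable g → (∀ σ, ‖σ‖ = 1 → |g σ| ≤ S) →
    |‖x - vs‖ * ∫ σ, g σ ∂(b (x, vs)) - ‖y - vs‖ * ∫ σ, g σ ∂(b (y, vs))| ≤ κ * ‖x - y‖ * S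
  pov : ∀ v vs y, v ≠ vs → ∫ σ, (inner ℝ y σ) ^ 2 ∂(b (v, vs)) ≤ (1 - 2 * δ) * ‖y‖ ^ 2

lemma wt_pos (v : Vd d) : 0 < wt v := by unfold wt; positivity
lemma one_le_wt (v : Vd d) : 1 ≤ wt v := by unfold wt; nlinarith [sq_nonneg ‖v‖]
lemma cont_wt : Continuous (wt : Vd d → ℝ) := by unfold wt; fun_prop

lemma cont_postV : Continuous (fun p : Tri d => postV p.1.1 p.1.2 p.2) := by
  unfold postV; fun_prop
lemma cont_postVs : Continuous (fun p : Tri d => postVs p.1.1 p.1.2 p.2) := by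
  unfold postVs; fun_prop
lemma meas_Del {f : Vd d → ℝ} (hf : Measurable f) : Measurable (Del f) := by
  unfold Del
  have h1 := hf.comp (cont_postV (d := d)).measurable
  have h2 := hf.comp (cont_postVs (d := d)).measurable
  have h3 : Measurable fun p : Tri d => f p.1.1 := hf.comp (by fun_prop)
  have h4 : Measurable fun p : Tri d => f p.1.2 := hf.comp (by fun_prop)
  exact ((h1.add h2).sub h3).sub h4

lemma post_sq (v vs σ : Vd d) (hσ : ‖σ‖ = 1) :
    ‖postV v vs σ‖ ^ 2 = (‖v‖ ^ 2 + ‖vs‖ ^ 2) / 2 + ‖v - vs‖ * inner ℝ (v + vs) σ / 2 ∧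
    ‖postVs v vs σ‖ ^ 2 = (‖v‖ ^ 2 + ‖vs‖ ^ 2) / 2 - ‖v - vs‖ * inner ℝ (v + vs) σ / 2 := by
  unfold postV postVs
  rw [norm_add_sq_real, norm_sub_sq_real, norm_smul, norm_smul, inner_smul_left, inner_smul_right,
    hσ]
  have h1 := norm_add_sq_real v vs
  have h2 := norm_sub_sq_real v vs
  have e1 : ‖(2:ℝ)⁻¹‖ = 1/2 := by norm_num
  have e2 : ‖(2:ℝ)⁻¹ * ‖v - vs‖‖ = 1/2 * ‖v - vs‖ := by
    rw [Real.norm_eq_abs, abs_of_nonneg (by positivity)]; norm_num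
  rw [e1, e2]
  simp only [conj_trivial]
  constructor <;> nlinarith

lemma post_energy (v vs σ : Vd d) (hσ : ‖σ‖ = 1) :
    ‖postV v vs σ‖ ^ 2 + ‖postVs v vs σ‖ ^ 2 = ‖v‖ ^ 2 + ‖vs‖ ^ 2 := by
  obtain ⟨h1, h2⟩ := post_sq v vs σ hσ
  rw [h1, h2]; ring

lemma post_wt (v vs σ : Vd d) (hσ : ‖σ‖ = 1) :
    wt (postV v vs σ) + wt (postVs v vs σ) = wt v + wt vs := by
  have := post_energy v vs σ hσ
  unfold wt; linarith

lemma norm_post_le {R : ℝ} {v vs σ : Vd d} (hσ : ‖σ‖ = 1) (hv : ‖v‖ ≤ R) (hvs : ‖vs‖ ≤ R) :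
    ‖postV v vs σ‖ ≤ 2 * R ∧ ‖postVs v vs σ‖ ≤ 2 * R := by
  have := post_energy v vs σ hσ
  have h0 := norm_nonneg v
  have h1 : ‖v‖ ^ 2 ≤ R ^ 2 := by gcongr
  have h2 : ‖vs‖ ^ 2 ≤ R ^ 2 := by gcongr
  constructor <;> refine abs_le_of_sq_le_sq' ?_ (by linarith) |>.2 <;>
    nlinarith [sq_nonneg ‖postV v vs σ‖, sq_nonneg ‖postVs v vs σ‖]

lemma post_lip (x y vs σ : Vd d) (hσ : ‖σ‖ = 1) :
    ‖postV x vs σ - postV y vs σ‖ ≤ ‖x - y‖ ∧ ‖postVs x vs σ - postVs y vs σ‖ ≤ ‖x - y‖ := by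
  have h1 : |‖x - vs‖ - ‖y - vs‖| ≤ ‖x - y‖ := by
    have := abs_norm_sub_norm_le (x - vs) (y - vs); simpa using this
  have h2 : ‖(((2:ℝ)⁻¹ * (‖x - vs‖ - ‖y - vs‖)) • σ)‖ ≤ 2⁻¹ * ‖x - y‖ := by
    rw [norm_smul, hσ, mul_one, norm_mul, Real.norm_eq_abs (_ - _)]; norm_num; linarith
  have h3 : ‖(2:ℝ)⁻¹ • (x - y)‖ = 2⁻¹ * ‖x - y‖ := by rw [norm_smul]; norm_num
  have e1 : postV x vs σ - postV y vs σ
      = (2:ℝ)⁻¹ • (x - y) + ((2:ℝ)⁻¹ * (‖x - vs‖ - ‖y - vs‖)) • σ := by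
    unfold postV; module
  have e2 : postVs x vs σ - postVs y vs σ
      = (2:ℝ)⁻¹ • (x - y) - ((2:ℝ)⁻¹ * (‖x - vs‖ - ‖y - vs‖)) • σ := by
    unfold postVs; module
  rw [e1, e2]
  exact ⟨(norm_add_le _ _).trans (by linarith), (norm_sub_le _ _).trans (by linarith)⟩

lemma rt_le (v vs : Vd d) : ‖v - vs‖ ≤ wt v * wt vs := by
  have h := norm_sub_le v vs
  have h1 : ‖v‖ ≤ wt v / 2 := by unfold wt; nlinarith [sq_nonneg (‖v‖ - 1)]
  have h2 : ‖vs‖ ≤ wt vs / 2 := by unfold wt; nlinarith [sq_nonneg (‖vs‖ - 1)]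
  nlinarith [one_le_wt v, one_le_wt vs]

lemma wt_add_le (v vs : Vd d) : wt v + wt vs ≤ 2 * (wt v * wt vs) := by
  nlinarith [one_le_wt v, one_le_wt vs]

lemma wt_post_le (v vs σ : Vd d) (hσ : ‖σ‖ = 1) :
    wt (postV v vs σ) ≤ 2 * (wt v * wt vs) ∧ wt (postVs v vs σ) ≤ 2 * (wt v * wt vs) := by
  have h := post_wt v vs σ hσ
  have h1 := wt_add_le v vs
  have := wt_pos (postV v vs σ)
  have := wt_pos (postVs v vs σ)
  constructor <;> linarith

lemma post_symm (v vs σ : Vd d) : postV vs v σ = postV v vs σ ∧ postVs vs v σ = postVs v vs σ := by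
  unfold postV postVs; rw [add_comm vs v, norm_sub_rev vs v]; exact ⟨rfl, rfl⟩

lemma post_neg (v vs σ : Vd d) : postV v vs (-σ) = postVs v vs σ ∧ postVs v vs (-σ) = postV v vs σ := by
  unfold postV postVs; constructor <;> module

end partA


section partB

variable {d : ℕ}

def e0 (d : ℕ) : Vd d := if h : 0 < d then EuclideanSpace.single ⟨0, h⟩ (1:ℝ) else 0

lemma norm_e0 (hd : 3 ≤ d) : ‖e0 d‖ = 1 := by
  unfold e0; rw [dif_pos (by omega)]; simp

def bm (B : Vd d → Measure (Vd d)) (v : Vd d) : Measure (Vd d) :=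
  if v = 0 then B (e0 d) else B (‖v‖⁻¹ • v)

lemma norm_unit {v : Vd d} (hv : v ≠ 0) : ‖(‖v‖⁻¹ • v)‖ = 1 := by
  rw [norm_smul, norm_inv, norm_norm, inv_mul_cancel₀ (by simpa using hv)]

lemma bm_prop (hd : 3 ≤ d) {B : Vd d → Measure (Vd d)} (v : Vd d) :
    ∃ u : Vd d, ‖u‖ = 1 ∧ bm B v = B u := by
  by_cases h : v = 0
  · exact ⟨e0 d, norm_e0 hd, by simp [bm, h]⟩
  · exact ⟨‖v‖⁻¹ • v, norm_unit h, by simp [bm, h]⟩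

lemma B_eq (hd : 3 ≤ d) {B : Vd d → Measure (Vd d)} (hB : IsCollisionKernel B) (v : Vd d) :
    B v = ENNReal.ofReal ‖v‖ • bm B v := by
  by_cases h : v = 0
  · have := hB.scaling 0 le_rfl (e0 d) (norm_e0 hd)
    subst h; simpa using this
  · have := hB.scaling ‖v‖ (norm_nonneg _) (‖v‖⁻¹ • v) (norm_unit h)
    rw [smul_smul, mul_inv_cancel₀ (by simpa using h), one_smul] at this
    simpa [bm, h] using this

lemma meas_bm {B : Vd d → Measure (Vd d)} (hB : IsCollisionKernel B) : Measurable (bm B) := by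
  refine Measure.measurable_of_measurable_coe _ fun s hs => ?_
  have : (fun v => bm B v s) = fun v => if v = 0 then B (e0 d) s else B (‖v‖⁻¹ • v) s := by
    ext v; unfold bm; split_ifs <;> rfl
  rw [this]
  refine Measurable.ite (measurableSet_singleton 0) measurable_const ?_
  exact (hB.measurable s hs).comp (by fun_prop)

def bK {B : Vd d → Measure (Vd d)} (hB : IsCollisionKernel B) : Kernel (Vd d × Vd d) (Vd d) where
  toFun p := bm B (p.1 - p.2)
  measurable' := (meas_bm hB).comp (by fun_prop)

lemma B_sphere {B : Vd d → Measure (Vd d)} (hB : IsCollisionKernel B) {u : Vd d} (hu : ‖u‖ = 1) :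
    ∀ᵐ σ ∂(B u), ‖σ‖ = 1 ∧ σ ≠ u ∧ σ ≠ -u := by
  have := hB.support u hu
  rw [ae_iff]
  refine measure_mono_null ?_ this
  intro σ hσ hc
  simp only [unitSphere, Set.mem_diff, Set.mem_setOf_eq, Set.mem_insert_iff,
    Set.mem_singleton_iff, not_or] at hc
  exact hσ hc

lemma exists_iso {u v : Vd d} (h : ‖u‖ = ‖v‖) : ∃ R : Vd d ≃ₗᵢ[ℝ] Vd d, R u = v :=
  ⟨_, Submodule.reflection_sub h⟩

lemma not_conc (hd : 3 ≤ d) {B : Vd d → Measure (Vd d)} (hB : IsCollisionKernel B)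
    {u n : Vd d} (hu : ‖u‖ = 1) (hn : ‖n‖ = 1) (h : ∀ᵐ σ ∂(B u), σ = n ∨ σ = -n) : False := by
  have := hB.prob u hu
  have hne : ∀ p : Vd d → Prop, (∀ᵐ σ ∂(B u), p σ) → ∃ σ, p σ := fun p hp => hp.exists
  by_cases h1 : n = u ∨ n = -u
  · obtain ⟨σ, hσ, -, h3, h4⟩ := hne _ (h.and (B_sphere hB hu))
    rcases h1 with rfl | rfl
    · tauto
    · simp only [neg_neg] at hσ; tauto
  push Not at h1
  -- a vector orthogonal to u and n
  obtain ⟨w3, hw3, hw30⟩ : ∃ w ∈ (Submodule.span ℝ ({u, n} : Set (Vd d)))ᗮ, w ≠ 0 := by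
    apply Submodule.exists_mem_ne_zero_of_ne_bot
    intro hbot
    have h2 : Submodule.span ℝ ({u, n} : Set (Vd d)) = ⊤ := by
      simpa using (Submodule.orthogonal_eq_bot_iff).1 hbot
    have h3 : Module.finrank ℝ (Submodule.span ℝ ({u, n} : Set (Vd d))) ≤ 2 := by
      classical
      have := finrank_span_le_card (R := ℝ) ({u, n} : Set (Vd d))
      refine this.trans ?_
      rw [Set.toFinset_insert, Set.toFinset_singleton]
      exact Finset.card_le_two
    rw [h2, finrank_top, finrank_euclideanSpace_fin] at h3
    omega
  rw [Submodule.mem_orthogonal] at hw3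
  have hu3 : inner ℝ u w3 = 0 := hw3 u (Submodule.subset_span (by simp))
  have hn3 : inner ℝ n w3 = 0 := hw3 n (Submodule.subset_span (by simp))
  have h3u : inner ℝ w3 u = 0 := by rw [real_inner_comm]; exact hu3
  have h3n : inner ℝ w3 n = 0 := by rw [real_inner_comm]; exact hn3
  set c := inner ℝ n u with hc
  have hcu : inner ℝ u n = c := real_inner_comm _ _
  have hc1 : c ^ 2 < 1 := by
    have h4 : |c| < 1 := by
      rw [abs_lt]
      have e1 := norm_add_sq_real n u
      have e2 := norm_sub_sq_real n u
      have e3 : 0 < ‖n + u‖ := norm_pos_iff.2 fun h => h1.2 (eq_neg_of_add_eq_zero_left h)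
      have e4 : 0 < ‖n - u‖ := norm_pos_iff.2 (sub_ne_zero.2 h1.1)
      rw [hu, hn, ← hc] at e1 e2
      constructor <;> nlinarith
    rw [sq_lt_one_iff_abs_lt_one]; exact h4
  set w1 := n - c • u with hw1
  have huu : inner ℝ u u = (1:ℝ) := by rw [real_inner_self_eq_norm_sq, hu]; norm_num
  have hnn : inner ℝ n n = (1:ℝ) := by rw [real_inner_self_eq_norm_sq, hn]; norm_num
  have h33 : 0 < inner ℝ w3 w3 := by
    rw [real_inner_self_eq_norm_sq]; have := norm_pos_iff.2 hw30; positivity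
  set w := w1 + w3 with hw
  set x := (inner ℝ w3 w3 : ℝ) • w1 - (1 - c ^ 2) • w3 with hx
  have hwu : inner ℝ w u = 0 := by
    simp only [hw, hw1, inner_add_left, inner_sub_left, inner_smul_left, conj_trivial, huu, h3u, ← hc]; ring
  have hwn : inner ℝ w n = 1 - c ^ 2 := by
    simp only [hw, hw1, inner_add_left, inner_sub_left, inner_smul_left, conj_trivial, hnn, h3n, hcu]; ring
  have hwx : inner ℝ w x = 0 := by
    simp only [hw, hw1, hx, inner_add_left, inner_sub_left, inner_smul_left, inner_sub_right,
      inner_smul_right, conj_trivial, hnn, huu, hcu, h3n, h3u, hn3, hu3, ← hc]; ring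
  have hnx : inner ℝ n x = inner ℝ w3 w3 * (1 - c ^ 2) := by
    simp only [hw1, hx, inner_sub_right,
      inner_smul_right, hnn, hn3, ← hc]; ring
  let R : Vd d ≃ₗᵢ[ℝ] Vd d := (Submodule.span ℝ {w})ᗮ.reflection
  have hRw : R w = -w := Submodule.reflection_orthogonalComplement_singleton_eq_neg w
  have hRfix : ∀ y, inner ℝ w y = 0 → R y = y := fun y hy => by
    apply Submodule.reflection_mem_subspace_eq_self
    exact Submodule.mem_orthogonal_singleton_iff_inner_right.2 hy
  have hRu := hRfix u hwu
  have hRx := hRfix x hwx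
  have hmap := hB.symm R u hu
  rw [hRu] at hmap
  have h' : ∀ᵐ σ ∂(B u), R σ = n ∨ R σ = -n := by
    rw [hmap] at h
    exact ae_of_ae_map R.continuous.measurable.aemeasurable h
  have key : R n = n ∨ R n = -n := by
    obtain ⟨σ, hs1, hs2⟩ := hne _ (h.and h')
    rcases hs1 with rfl | rfl
    · exact hs2
    · rw [map_neg] at hs2
      rcases hs2 with h | h
      · right; exact neg_eq_iff_eq_neg.1 h
      · left; exact neg_injective h
  rcases key with hk | hk
  · have : inner ℝ (R w) (R n) = inner ℝ w n := R.inner_map_map w n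
    rw [hRw, hk, inner_neg_left, hwn] at this
    linarith
  · have : inner ℝ (R n) (R x) = inner ℝ n x := R.inner_map_map n x
    rw [hk, hRx, inner_neg_left, hnx] at this
    have : 0 < inner ℝ w3 w3 * (1 - c ^ 2) := mul_pos h33 (by linarith)
    linarith

lemma exists_pov (hd : 3 ≤ d) {B : Vd d → Measure (Vd d)} (hB : IsCollisionKernel B) :
    ∃ δ : ℝ, 0 < δ ∧ δ ≤ 1 ∧ ∀ u y : Vd d, ‖u‖ = 1 →
      ∫ σ, (inner ℝ y σ) ^ 2 ∂(B u) ≤ (1 - 2 * δ) * ‖y‖ ^ 2 := by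
  set u := e0 d
  have hu : ‖u‖ = 1 := norm_e0 hd
  have := hB.prob u hu
  let I : Vd d → ℝ := fun n => ∫ σ, (inner ℝ n σ) ^ 2 ∂(B u)
  have hbd : ∀ n : Vd d, ∀ᵐ σ ∂(B u), (inner ℝ n σ) ^ 2 ≤ ‖n‖ ^ 2 := fun n => by
    filter_upwards [B_sphere hB hu] with σ hσ
    have := abs_real_inner_le_norm n σ
    rw [hσ.1, mul_one] at this
    rw [← sq_abs]; gcongr
  have hint : ∀ n : Vd d, Integrable (fun σ => (inner ℝ n σ) ^ 2) (B u) := fun n => by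
    refine Integrable.of_bound (C := ‖n‖ ^ 2) (by fun_prop) ?_
    filter_upwards [hbd n] with σ hσ
    rw [Real.norm_eq_abs, abs_of_nonneg (sq_nonneg _)]; exact hσ
  have hcont : ContinuousOn I (Metric.sphere (0 : Vd d) 1) := by
    refine continuousOn_of_dominated (bound := fun _ => 1) ?_ ?_ (integrable_const _) ?_
    · intro n _; fun_prop
    · intro n hn
      filter_upwards [hbd n] with σ hσ
      rw [Real.norm_eq_abs, abs_of_nonneg (sq_nonneg _)]
      have : ‖n‖ = 1 := by simpa using hn
      rw [this] at hσ; simpa using hσ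
    · exact ae_of_all _ fun σ => by fun_prop
  obtain ⟨n, hn, hmax⟩ := (isCompact_sphere (0 : Vd d) 1).exists_isMaxOn ⟨u, by simpa using hu⟩ hcont
  have hn1 : ‖n‖ = 1 := by simpa using hn
  have hI0 : 0 ≤ I n := integral_nonneg fun _ => sq_nonneg _
  have hI1 : I n < 1 := by
    by_contra hcon
    push Not at hcon
    have h0 : 0 ≤ᵐ[B u] fun σ => 1 - (inner ℝ n σ) ^ 2 := by
      filter_upwards [hbd n] with σ hσ
      rw [hn1] at hσ; simp only [Pi.zero_apply]; linarith
    have h1 : ∫ σ, (1 - (inner ℝ n σ) ^ 2) ∂(B u) = 0 := by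
      apply le_antisymm _ (integral_nonneg_of_ae h0)
      rw [integral_sub (integrable_const _) (hint n)]
      simp only [integral_const, probReal_univ, smul_eq_mul, one_mul]
      have : I n = ∫ σ, (inner ℝ n σ) ^ 2 ∂(B u) := rfl
      linarith
    rw [integral_eq_zero_iff_of_nonneg_ae h0 ((integrable_const _).sub (hint n))] at h1
    refine not_conc hd hB hu hn1 ?_
    filter_upwards [h1, B_sphere hB hu] with σ h2 h3
    simp only [Pi.zero_apply] at h2
    have h4 : (inner ℝ n σ - 1) * (inner ℝ n σ + 1) = (0:ℝ) := by linarith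
    rcases mul_eq_zero.1 h4 with h5 | h5
    · left
      exact ((inner_eq_one_iff_of_norm_eq_one (𝕜 := ℝ) hn1 h3.1).1 (sub_eq_zero.1 h5)).symm
    · right
      have : inner ℝ n (-σ) = (1:ℝ) := by rw [inner_neg_right]; linarith
      rw [(inner_eq_one_iff_of_norm_eq_one hn1 (by rw [norm_neg]; exact h3.1)).1 this, neg_neg]
  have hmain : ∀ y : Vd d, I y ≤ I n * ‖y‖ ^ 2 := by
    intro y
    by_cases hy : y = 0
    · simp [I, hy]
    have h1 : I (‖y‖⁻¹ • y) ≤ I n := hmax (by simpa using norm_unit hy)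
    have h2 : I y = ‖y‖ ^ 2 * I (‖y‖⁻¹ • y) := by
      simp only [I]
      rw [← integral_const_mul]
      congr 1; ext σ
      have : ‖y‖ ≠ 0 := by simpa using hy
      rw [inner_smul_left]; simp only [conj_trivial]; field_simp
    rw [h2, mul_comm]; gcongr
  refine ⟨(1 - I n) / 2, by linarith, by linarith, fun u' y hu' => ?_⟩
  obtain ⟨R, hR⟩ := exists_iso (d := d) (u := u) (v := u') (by rw [hu, hu'])
  rw [← hR, hB.symm R u hu, integral_map R.continuous.measurable.aemeasurable (by fun_prop)]
  have h3 : ∀ σ, inner ℝ y (R σ) = inner ℝ (R.symm y) σ := fun σ => by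
    have := R.inner_map_map (R.symm y) σ
    rw [← this, R.apply_symm_apply]
  simp_rw [h3]
  have := hmain (R.symm y)
  rw [R.symm.norm_map] at this
  calc _ ≤ _ := this
    _ = _ := by ring

lemma tv_bound (hd : 3 ≤ d) {B : Vd d → Measure (Vd d)} {κ : ℝ} (hB : IsCollisionKernel B)
    (hL : IsLipschitzKernel B κ) (v v' : Vd d) (g : Vd d → ℝ) (S : ℝ) (hg : Measurable g)
    (hS : ∀ σ, ‖σ‖ = 1 → |g σ| ≤ S) :
    ∫ σ, g σ ∂(B v) - ∫ σ, g σ ∂(B v') ≤ κ * ‖v - v'‖ * S := by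
  have hfin : ∀ v, IsFiniteMeasure (B v) := fun v => by
    rw [B_eq hd hB v]
    obtain ⟨u, hu, h⟩ := bm_prop hd (B := B) v
    rw [h]; haveI := hB.prob u hu
    exact ⟨by simp⟩
  have hsph : ∀ v, ∀ᵐ σ ∂(B v), ‖σ‖ = 1 := fun v => by
    rw [B_eq hd hB v]
    obtain ⟨u, hu, h⟩ := bm_prop hd (B := B) v
    rw [h]
    exact Measure.ae_smul_measure ((B_sphere hB hu).mono fun σ h => h.1) _
  have := hfin v; haveI := hfin v'
  have hS0 : 0 ≤ S := (abs_nonneg _).trans (hS _ (norm_e0 hd))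
  rcases hS0.eq_or_lt with rfl | hS1
  · have : ∀ v, ∫ σ, g σ ∂(B v) = 0 := fun v => by
      apply integral_eq_zero_of_ae
      filter_upwards [hsph v] with σ hσ
      have := hS σ hσ
      simpa using this
    simp [this]
  let f : Vd d → ℝ := fun σ => max (-1) (min 1 (g σ / S))
  have hfm : Measurable f := by fun_prop
  have hf1 : ∀ σ, |f σ| ≤ 1 := fun σ => by
    rw [abs_le]; exact ⟨le_max_left _ _, max_le (by norm_num) (min_le_left _ _)⟩
  have hfe : ∀ v, ∫ σ, f σ ∂(B v) = S⁻¹ * ∫ σ, g σ ∂(B v) := fun v => by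
    rw [← integral_const_mul]
    apply integral_congr_ae
    filter_upwards [hsph v] with σ hσ
    have := abs_le.1 (hS σ hσ)
    have h1 : g σ / S ≤ 1 := by rw [div_le_one hS1]; exact this.2
    have h2 : -1 ≤ g σ / S := by rw [le_div_iff₀ hS1]; linarith
    simp only [f]
    rw [min_eq_right h1, max_eq_right h2]; field_simp
  have hb : BddAbove (Set.range fun f : {f : Vd d → ℝ // Measurable f ∧ ∀ x, |f x| ≤ 1} =>
      ((∫ x, f.1 x ∂(B v)) - ∫ x, f.1 x ∂(B v'))) := by
    refine ⟨1 * (B v).real Set.univ + 1 * (B v').real Set.univ, ?_⟩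
    rintro _ ⟨f, rfl⟩
    have h1 := norm_integral_le_of_norm_le_const (μ := B v) (f := f.1) (C := 1) (ae_of_all _ fun x => by simpa using f.2.2 x)
    have h2 := norm_integral_le_of_norm_le_const (μ := B v') (f := f.1) (C := 1) (ae_of_all _ fun x => by simpa using f.2.2 x)
    rw [Real.norm_eq_abs, abs_le] at h1 h2
    simp only
    linarith [h1.2, h2.1]
  have h3 := (le_ciSup hb ⟨f, hfm, hf1⟩).trans (hL.2 v v')
  simp only [hfe] at h3
  rw [← mul_sub, inv_mul_le_iff₀ hS1] at h3
  linarith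

lemma exists_good (hd : 3 ≤ d) {B : Vd d → Measure (Vd d)} {κ : ℝ} (hB : IsCollisionKernel B)
    (hL : IsLipschitzKernel B κ) : ∃ b δ, Good B b κ δ := by
  obtain ⟨δ, h0, h1, hδ⟩ := exists_pov hd hB
  have hbe : ∀ p : Vd d × Vd d, bK hB p = bm B (p.1 - p.2) := fun _ => rfl
  have heq : ∀ v vs, B (v - vs) = ENNReal.ofReal ‖v - vs‖ • bK hB (v, vs) :=
    fun v vs => B_eq hd hB _
  have hint : ∀ (v vs : Vd d) (g : Vd d → ℝ),
      ‖v - vs‖ * ∫ σ, g σ ∂(bK hB (v, vs)) = ∫ σ, g σ ∂(B (v - vs)) := fun v vs g => by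
    rw [heq, integral_smul_measure, ENNReal.toReal_ofReal (norm_nonneg _), smul_eq_mul]
  refine ⟨bK hB, δ, ⟨⟨fun p => ?_⟩, hL.1, h0, h1, heq, fun p => ?_, ?_, ?_, ?_⟩⟩
  · obtain ⟨u, hu, h⟩ := bm_prop hd (B := B) (p.1 - p.2)
    rw [hbe, h]; exact hB.prob u hu
  · obtain ⟨u, hu, h⟩ := bm_prop hd (B := B) (p.1 - p.2)
    rw [hbe, h]; exact (B_sphere hB hu).mono fun σ h => h.1
  · intro f hf v vs hv
    rw [hbe, hbe]
    have hne : v - vs ≠ 0 := sub_ne_zero.2 hv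
    have hne' : vs - v ≠ 0 := sub_ne_zero.2 hv.symm
    have h2 : ‖vs - v‖⁻¹ • (vs - v) = LinearIsometryEquiv.neg ℝ (‖v - vs‖⁻¹ • (v - vs)) := by
      rw [norm_sub_rev vs v]; simp only [LinearIsometryEquiv.coe_neg]; module
    simp only [bm, hne, hne', if_false]
    rw [h2, hB.symm _ _ (norm_unit hne), integral_map (by fun_prop)]
    · congr 1; ext σ
      simp only [Del, LinearIsometryEquiv.coe_neg, (post_symm _ _ _).1, (post_symm _ _ _).2,
        (post_neg _ _ _).1, (post_neg _ _ _).2]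
      ring
    · have := (meas_Del hf).comp (measurable_prodMk_left (x := (vs, v)))
      exact this.aestronglyMeasurable
  · intro x y vs g S hg hS
    rw [hint, hint, abs_le]
    have a1 := tv_bound hd hB hL (x - vs) (y - vs) g S hg hS
    have a2 := tv_bound hd hB hL (y - vs) (x - vs) g S hg hS
    rw [sub_sub_sub_cancel_right] at a1 a2
    rw [norm_sub_rev y x] at a2
    constructor <;> linarith
  · intro v vs y hv
    obtain ⟨u, hu, h⟩ := bm_prop hd (B := B) (v - vs)
    rw [hbe, h]; exact hδ u y hu

end partB


section partC

variable {d : ℕ}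

def Ab (b : Kernel (Vd d × Vd d) (Vd d)) (h : Tri d → ℝ) (v vs : Vd d) : ℝ :=
  ‖v - vs‖ * ∫ σ, h ((v, vs), σ) ∂(b (v, vs))

def Qf (b : Kernel (Vd d × Vd d) (Vd d)) (h : Tri d → ℝ) (μ : Measure (Vd d)) : ℝ :=
  ∫ v, ∫ vs, Ab b h v vs ∂μ ∂μ

structure Emp (R : ℝ) (μ : Measure (Vd d)) : Prop where
  prob : IsProbabilityMeasure μ
  int : ∀ g : Vd d → ℝ, Integrable g μ
  ball : ∀ᵐ v ∂μ, ‖v‖ ≤ R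

lemma int_emp {n : ℕ} {s : Finset (Fin n)} (c : ℝ≥0∞) (hc : c ≠ ⊤) (x : Fin n → Vd d) (g : Vd d → ℝ) :
    Integrable g (c • ∑ i ∈ s, Measure.dirac (x i)) := by
  refine Integrable.smul_measure ?_ hc
  refine (integrable_finsetSum_measure).2 fun i _ => ?_
  exact integrable_dirac (by simp)

lemma integral_emp {n : ℕ} {s : Finset (Fin n)} (c : ℝ≥0∞) (x : Fin n → Vd d) (g : Vd d → ℝ) :
    ∫ v, g v ∂(c • ∑ i ∈ s, Measure.dirac (x i)) = c.toReal * ∑ i ∈ s, g (x i) := by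
  rw [integral_smul_measure, integral_finsetSum_measure (fun i _ => integrable_dirac (by simp))]
  simp

lemma ae_emp {n : ℕ} {s : Finset (Fin n)} (c : ℝ≥0∞) (x : Fin n → Vd d) (p : Vd d → Prop)
    (h : ∀ i ∈ s, p (x i)) : ∀ᵐ v ∂(c • ∑ i ∈ s, Measure.dirac (x i)), p v := by
  refine Measure.ae_smul_measure ?_ c
  rw [ae_iff, Measure.finset_sum_apply]
  refine Finset.sum_eq_zero fun i hi => ?_
  rw [Measure.dirac_apply]
  simp [h i hi]

lemma emp_data {N : ℕ} {μ : Measure (Vd d)} (h : μ ∈ empiricalSphere d N) :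
    0 < N ∧ ∃ x : Fin N → Vd d, μ = (N : ℝ≥0∞)⁻¹ • ∑ i, Measure.dirac (x i) ∧
      ∀ i, ‖x i‖ ≤ √N := by
  obtain ⟨⟨hp, h0, h1⟩, x, hx⟩ := h
  have hN : 0 < N := by
    rcases Nat.eq_zero_or_pos N with rfl | h
    · exfalso
      have h2 := hp.measure_univ
      rw [hx] at h2
      simp at h2
    · exact h
  refine ⟨hN, x, hx, fun i => ?_⟩
  rw [hx, integral_emp] at h1
  have hN' : (0:ℝ) < N := by exact_mod_cast hN
  simp only [ENNReal.toReal_inv, ENNReal.toReal_natCast] at h1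
  rw [inv_mul_eq_iff_eq_mul₀ hN'.ne', mul_one] at h1
  refine Real.le_sqrt_of_sq_le ?_
  rw [← h1]
  exact Finset.single_le_sum (f := fun i => ‖x i‖ ^ 2) (fun i _ => by positivity) (Finset.mem_univ i)

lemma emp_of_mem {N : ℕ} {μ : Measure (Vd d)} (h : μ ∈ empiricalSphere d N) : Emp (√N) μ := by
  obtain ⟨hN, x, hx, hb⟩ := emp_data h
  refine ⟨h.1.1, fun g => ?_, ?_⟩
  · rw [hx]; exact int_emp _ (by simp [hN.ne']) x g
  · rw [hx]; exact ae_emp _ _ _ fun i _ => hb i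

lemma coll_prop {N : ℕ} {μ : Measure (Vd d)} (h : μ ∈ empiricalSphere d N) :
    ∀ᵐ v ∂μ, ∀ᵐ vs ∂μ, v ≠ vs → ∀ σ, ‖σ‖ = 1 → Emp (2 * √N) (collUpdate N μ v vs σ) ∧
      ∀ g : Vd d → ℝ, ∫ w, g w ∂(collUpdate N μ v vs σ) = ∫ w, g w ∂μ + (N:ℝ)⁻¹ * Del g ((v, vs), σ) := by
  obtain ⟨hN, x, hx, hb⟩ := emp_data h
  have hc : (N : ℝ≥0∞)⁻¹ ≠ ⊤ := by simp [hN.ne']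
  have key : ∀ i j, x i ≠ x j → ∀ σ, ‖σ‖ = 1 → Emp (2 * √N) (collUpdate N μ (x i) (x j) σ) ∧
      ∀ g : Vd d → ℝ, ∫ w, g w ∂(collUpdate N μ (x i) (x j) σ)
        = ∫ w, g w ∂μ + (N:ℝ)⁻¹ * Del g ((x i, x j), σ) := by
    intro i j hij σ hσ
    have hij' : i ≠ j := fun h => hij (by rw [h])
    set y : Fin N → Vd d := fun k => if k = i then postV (x i) (x j) σ else
      if k = j then postVs (x i) (x j) σ else x k with hy
    have hyi : y i = postV (x i) (x j) σ := by simp [hy]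
    have hyj : y j = postVs (x i) (x j) σ := by simp [hy, hij'.symm]
    have hyk : ∀ k, k ≠ i → k ≠ j → y k = x k := fun k h1 h2 => by simp [hy, h1, h2]
    have hsum : ∀ {E : Type} [AddCommMonoid E] (G : Fin N → E), ∑ k, G k = G i + (G j +
        ∑ k ∈ (Finset.univ.erase i).erase j, G k) := by
      intro E _ G
      rw [← Finset.add_sum_erase _ _ (Finset.mem_univ i), ← Finset.add_sum_erase _ _
        (Finset.mem_erase.2 ⟨hij'.symm, Finset.mem_univ j⟩)]
    have hrest : ∀ {E : Type} [AddCommMonoid E] (G : Vd d → E),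
        ∑ k ∈ (Finset.univ.erase i).erase j, G (y k) = ∑ k ∈ (Finset.univ.erase i).erase j, G (x k) := by
      intro E _ G
      refine Finset.sum_congr rfl fun k hk => ?_
      simp only [Finset.mem_erase, Finset.mem_univ, and_true] at hk
      rw [hyk k hk.2 hk.1]
    have hcu : collUpdate N μ (x i) (x j) σ = (N : ℝ≥0∞)⁻¹ • ∑ k, Measure.dirac (y k) := by
      unfold collUpdate
      rw [hx, hsum (fun k => Measure.dirac (x k)), hsum (fun k => Measure.dirac (y k)),
        hrest (fun v => Measure.dirac v), hyi, hyj]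
      set r := ∑ k ∈ (Finset.univ.erase i).erase j, Measure.dirac (x k)
      have e : (N : ℝ≥0∞)⁻¹ • (Measure.dirac (x i) + (Measure.dirac (x j) + r)) +
          (N : ℝ≥0∞)⁻¹ • (Measure.dirac (postV (x i) (x j) σ) + Measure.dirac (postVs (x i) (x j) σ))
          = (N : ℝ≥0∞)⁻¹ • (Measure.dirac (postV (x i) (x j) σ) +
            (Measure.dirac (postVs (x i) (x j) σ) + r)) +
          (N : ℝ≥0∞)⁻¹ • (Measure.dirac (x i) + Measure.dirac (x j)) := by
        simp only [← smul_add]; congr 1; abel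
      rw [e]
      have : IsFiniteMeasure ((N : ℝ≥0∞)⁻¹ • (Measure.dirac (x i) + Measure.dirac (x j))) :=
        Measure.smul_finite _ hc
      exact Measure.add_sub_cancel
    have hyb : ∀ k, ‖y k‖ ≤ 2 * √N := by
      intro k
      have h2 := norm_post_le hσ (hb i) (hb j)
      simp only [hy]
      split_ifs
      · exact h2.1
      · exact h2.2
      · linarith [hb k, Real.sqrt_nonneg (N:ℝ)]
    refine ⟨⟨⟨?_⟩, fun g => ?_, ?_⟩, fun g => ?_⟩
    · have h2 := h.1.1.measure_univ
      rw [hx] at h2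
      rw [hcu]
      simpa using h2
    · rw [hcu]; exact int_emp _ hc y g
    · rw [hcu]; exact ae_emp _ _ _ fun k _ => hyb k
    · rw [hcu, hx, integral_emp, integral_emp, hsum (fun k => g (x k)), hsum (fun k => g (y k)),
        hrest g, hyi, hyj]
      simp only [Del, ENNReal.toReal_inv, ENNReal.toReal_natCast]
      ring
  rw [hx]
  refine ae_emp _ _ _ fun i _ => ae_emp _ _ _ fun j _ => ?_
  rw [← hx]
  exact key i j

variable {B : Vd d → Measure (Vd d)} {b : Kernel (Vd d × Vd d) (Vd d)} {κ δ : ℝ}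

lemma kacGen_eq (hG : Good B b κ δ) {N : ℕ} {μ : Measure (Vd d)} (h : μ ∈ empiricalSphere d N)
    (F : Measure (Vd d) → ℝ) (c : Tri d → ℝ)
    (hF : ∀ v vs σ, ‖σ‖ = 1 → Emp (2 * √N) (collUpdate N μ v vs σ) →
      (∀ g : Vd d → ℝ, ∫ w, g w ∂(collUpdate N μ v vs σ) = ∫ w, g w ∂μ + (N:ℝ)⁻¹ * Del g ((v, vs), σ)) →
      F (collUpdate N μ v vs σ) - F μ = c ((v, vs), σ)) :
    kacGen B N F μ = N * Qf b c μ := by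
  unfold kacGen Qf
  congr 1
  refine integral_congr_ae ?_
  filter_upwards [coll_prop h] with v hv
  refine integral_congr_ae ?_
  filter_upwards [hv] with vs hvs
  rw [hG.eqB, integral_smul_measure, ENNReal.toReal_ofReal (norm_nonneg _), smul_eq_mul, Ab]
  by_cases hne : v = vs
  · simp [hne]
  congr 1
  refine integral_congr_ae ?_
  filter_upwards [hG.sph (v, vs)] with σ hσ
  obtain ⟨h1, h2⟩ := hvs hne σ hσ
  exact hF v vs σ hσ h1 h2

structure LB (g : Vd d → ℝ) : Prop where
  meas : Measurable g
  bdd : ∀ D : ℝ, ∃ K : ℝ, 0 ≤ K ∧ ∀ v, ‖v‖ ≤ D → |g v| ≤ K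

def Gf (g : Vd d → ℝ) (K : ℝ) (μ : Measure (Vd d)) : ℝ :=
  max (-K) (min K ((∫⁻ v, ENNReal.ofReal (g v) ∂μ).toReal - (∫⁻ v, ENNReal.ofReal (-g v) ∂μ).toReal))

lemma Gf_meas {g : Vd d → ℝ} (hg : Measurable g) (K : ℝ) : Measurable (Gf g K) := by
  unfold Gf
  have h1 : Measurable fun μ : Measure (Vd d) => ∫⁻ v, ENNReal.ofReal (g v) ∂μ :=
    Measure.measurable_lintegral (by fun_prop)
  have h2 : Measurable fun μ : Measure (Vd d) => ∫⁻ v, ENNReal.ofReal (-g v) ∂μ :=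
    Measure.measurable_lintegral (by fun_prop)
  fun_prop

lemma Gf_bdd (g : Vd d → ℝ) {K : ℝ} (hK : 0 ≤ K) (μ : Measure (Vd d)) : |Gf g K μ| ≤ K := by
  unfold Gf
  rw [abs_le]
  exact ⟨le_max_left _ _, max_le (by linarith) (min_le_left _ _)⟩

lemma emp_abs_le {R K : ℝ} {μ : Measure (Vd d)} (h : Emp R μ) {g : Vd d → ℝ}
    (hg : ∀ v, ‖v‖ ≤ R → |g v| ≤ K) : |∫ v, g v ∂μ| ≤ K := by
  have := h.prob
  have h1 := norm_integral_le_of_norm_le_const (μ := μ) (f := g) (C := K)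
    (h.ball.mono fun v hv => hg v hv)
  simpa using h1

lemma Gf_eq {R K : ℝ} {μ : Measure (Vd d)} (h : Emp R μ) {g : Vd d → ℝ}
    (hg : ∀ v, ‖v‖ ≤ R → |g v| ≤ K) : Gf g K μ = ∫ v, g v ∂μ := by
  unfold Gf
  rw [← integral_eq_lintegral_pos_part_sub_lintegral_neg_part (h.int g)]
  have := abs_le.1 (emp_abs_le h hg)
  rw [min_eq_right this.2, max_eq_right this.1]

lemma del_bdd {R K : ℝ} {g : Vd d → ℝ} (hg : ∀ v, ‖v‖ ≤ 2 * R → |g v| ≤ K) {v vs σ : Vd d}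
    (hσ : ‖σ‖ = 1) (hv : ‖v‖ ≤ R) (hvs : ‖vs‖ ≤ R) : |Del g ((v, vs), σ)| ≤ 4 * K := by
  have h := norm_post_le hσ hv hvs
  have h0 := norm_nonneg v
  have h1 := abs_le.1 (hg _ h.1)
  have h2 := abs_le.1 (hg _ h.2)
  have h3 := abs_le.1 (hg v (by linarith))
  have h4 := abs_le.1 (hg vs (by linarith))
  unfold Del
  rw [abs_le]; constructor <;> simp only <;> linarith

lemma int_sph (hG : Good B b κ δ) {h : Tri d → ℝ} (hm : Measurable h) {v vs : Vd d} {K : ℝ}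
    (hb : ∀ σ, ‖σ‖ = 1 → |h ((v, vs), σ)| ≤ K) :
    Integrable (fun σ => h ((v, vs), σ)) (b (v, vs)) := by
  have := hG.markov
  exact Integrable.of_bound (hm.comp measurable_prodMk_left).aestronglyMeasurable K
    ((hG.sph (v, vs)).mono fun σ hσ => hb σ hσ)

lemma kacGen_Gf (hG : Good B b κ δ) {N : ℕ} {μ : Measure (Vd d)} (h : μ ∈ empiricalSphere d N)
    {g : Vd d → ℝ} {K : ℝ} (hK : ∀ v, ‖v‖ ≤ 2 * √N → |g v| ≤ K) :
    kacGen B N (Gf g K) μ = Qf b (Del g) μ := by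
  have hN : (N:ℝ) ≠ 0 := by exact_mod_cast (emp_data h).1.ne'
  have hE := emp_of_mem h
  have hr := Real.sqrt_nonneg (N:ℝ)
  have e0 : Gf g K μ = ∫ v, g v ∂μ := Gf_eq hE fun v hv => hK v (by linarith)
  rw [kacGen_eq hG h (Gf g K) (fun p => (N:ℝ)⁻¹ * Del g p)]
  · simp only [Qf, Ab, integral_const_mul, mul_left_comm _ (N:ℝ)⁻¹]
    rw [← mul_assoc, inv_mul_cancel₀ hN, one_mul]
  · intro v vs σ hσ h1 h2
    rw [Gf_eq h1 hK, e0, h2]; ring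

lemma Qf_add {μ : Measure (Vd d)} {R : ℝ} (hE : Emp R μ) (hG : Good B b κ δ) {h1 h2 : Tri d → ℝ}
    (m1 : Measurable h1) (m2 : Measurable h2) {K1 K2 : ℝ}
    (b1 : ∀ v vs σ, ‖σ‖ = 1 → ‖v‖ ≤ R → ‖vs‖ ≤ R → |h1 ((v, vs), σ)| ≤ K1)
    (b2 : ∀ v vs σ, ‖σ‖ = 1 → ‖v‖ ≤ R → ‖vs‖ ≤ R → |h2 ((v, vs), σ)| ≤ K2) :
    Qf b (fun p => h1 p + h2 p) μ = Qf b h1 μ + Qf b h2 μ := by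
  unfold Qf
  rw [← integral_add (hE.int _) (hE.int _)]
  refine integral_congr_ae ?_
  filter_upwards [hE.ball] with v hv
  rw [← integral_add (hE.int _) (hE.int _)]
  refine integral_congr_ae ?_
  filter_upwards [hE.ball] with vs hvs
  unfold Ab
  rw [← mul_add, ← integral_add (int_sph hG m1 fun σ hσ => b1 v vs σ hσ hv hvs)
    (int_sph hG m2 fun σ hσ => b2 v vs σ hσ hv hvs)]

lemma Qf_smul (c : ℝ) (h : Tri d → ℝ) (μ : Measure (Vd d)) :
    Qf b (fun p => c * h p) μ = c * Qf b h μ := by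
  simp only [Qf, Ab, integral_const_mul, mul_left_comm _ c]

lemma kacGen_Gf_sq (hG : Good B b κ δ) {N : ℕ} {μ : Measure (Vd d)} (h : μ ∈ empiricalSphere d N)
    {g : Vd d → ℝ} (hg : Measurable g) {K : ℝ} (hK : ∀ v, ‖v‖ ≤ 2 * √N → |g v| ≤ K) :
    kacGen B N (fun μ => Gf g K μ ^ 2) μ
      = 2 * Gf g K μ * Qf b (Del g) μ + (N:ℝ)⁻¹ * Qf b (fun p => Del g p ^ 2) μ := by
  have hN : (N:ℝ) ≠ 0 := by exact_mod_cast (emp_data h).1.ne'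
  have hE := emp_of_mem h
  have hr := Real.sqrt_nonneg (N:ℝ)
  have e0 : Gf g K μ = ∫ v, g v ∂μ := Gf_eq hE fun v hv => hK v (by linarith)
  set X := ∫ v, g v ∂μ
  rw [kacGen_eq hG h _ (fun p => (2 * X * (N:ℝ)⁻¹) * Del g p + ((N:ℝ)⁻¹ ^ 2) * Del g p ^ 2)]
  · rw [Qf_add hE hG ((meas_Del hg).const_mul _) (((meas_Del hg).pow_const 2).const_mul _)
      (K1 := |2 * X * (N:ℝ)⁻¹| * (4 * K)) (K2 := (N:ℝ)⁻¹ ^ 2 * (4 * K) ^ 2), Qf_smul, Qf_smul, e0]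
    · field_simp
    · intro v vs σ hσ hv hvs
      rw [abs_mul]; gcongr; exact del_bdd hK hσ hv hvs
    · intro v vs σ hσ hv hvs
      rw [abs_mul, abs_of_nonneg (by positivity : (0:ℝ) ≤ (N:ℝ)⁻¹ ^ 2), abs_pow]
      gcongr; exact del_bdd hK hσ hv hvs
  · intro v vs σ hσ h1 h2
    rw [Gf_eq h1 hK, e0, h2]; ring

lemma Qf_le {μ : Measure (Vd d)} {R : ℝ} (hE : Emp R μ) (h : Tri d → ℝ) (k : Vd d → Vd d → ℝ)
    (hk : ∀ v vs, ‖v‖ ≤ R → ‖vs‖ ≤ R → Ab b h v vs ≤ k v vs) :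
    Qf b h μ ≤ ∫ v, ∫ vs, k v vs ∂μ ∂μ := by
  unfold Qf
  refine integral_mono_ae (hE.int _) (hE.int _) ?_
  filter_upwards [hE.ball] with v hv
  refine integral_mono_ae (hE.int _) (hE.int _) ?_
  filter_upwards [hE.ball] with vs hvs
  exact hk v vs hv hvs

lemma Ab_abs_le (hG : Good B b κ δ) {h : Tri d → ℝ} {v vs : Vd d} {K : ℝ}
    (hK : ∀ σ, ‖σ‖ = 1 → |h ((v, vs), σ)| ≤ K) : |Ab b h v vs| ≤ ‖v - vs‖ * K := by
  have := hG.markov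
  unfold Ab
  rw [abs_mul, abs_of_nonneg (norm_nonneg _)]
  refine mul_le_mul_of_nonneg_left ?_ (norm_nonneg _)
  have h1 := norm_integral_le_of_norm_le_const (μ := b (v, vs)) ((hG.sph (v, vs)).mono fun σ hσ =>
    (Real.norm_eq_abs _).trans_le (hK σ hσ))
  simpa using h1

lemma Qf_abs_le {μ : Measure (Vd d)} {R : ℝ} (hE : Emp R μ) (h : Tri d → ℝ) (k : Vd d → Vd d → ℝ)
    (hk : ∀ v vs, ‖v‖ ≤ R → ‖vs‖ ≤ R → |Ab b h v vs| ≤ k v vs) :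
    |Qf b h μ| ≤ ∫ v, ∫ vs, k v vs ∂μ ∂μ := by
  unfold Qf
  refine (abs_integral_le_integral_abs).trans (integral_mono_ae (hE.int _) (hE.int _) ?_)
  filter_upwards [hE.ball] with v hv
  refine (abs_integral_le_integral_abs).trans (integral_mono_ae (hE.int _) (hE.int _) ?_)
  filter_upwards [hE.ball] with vs hvs
  exact hk v vs hv hvs

lemma Qf_bdd (hG : Good B b κ δ) {μ : Measure (Vd d)} {R : ℝ} (hE : Emp R μ) (h : Tri d → ℝ) {K : ℝ}
    (hK0 : 0 ≤ K) (hK : ∀ v vs σ, ‖σ‖ = 1 → ‖v‖ ≤ R → ‖vs‖ ≤ R → |h ((v, vs), σ)| ≤ K) :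
    |Qf b h μ| ≤ 2 * R * K := by
  have := hE.prob
  refine (Qf_abs_le hE h (fun _ _ => 2 * R * K) fun v vs hv hvs => ?_).trans (by simp)
  refine (Ab_abs_le hG fun σ hσ => hK v vs σ hσ hv hvs).trans ?_
  gcongr
  linarith [norm_sub_le v vs]

lemma Ab_meas (hG : Good B b κ δ) {h : Tri d → ℝ} (hm : Measurable h) :
    Measurable (fun p : Vd d × Vd d => Ab b h p.1 p.2) := by
  have := hG.markov
  unfold Ab
  have h1 : StronglyMeasurable fun p : Vd d × Vd d => ∫ σ, h (p, σ) ∂(b p) :=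
    StronglyMeasurable.integral_kernel_prod_right' (κ := b) hm.stronglyMeasurable
  have h2 : Measurable fun p : Vd d × Vd d => ‖p.1 - p.2‖ := by fun_prop
  exact h2.mul h1.measurable

lemma integral_meas_of {X : Type*} [MeasurableSpace X] {m : X → Measure (Vd d)} (hm : Measurable m)
    (hp : ∀ x, IsProbabilityMeasure (m x)) {g : X → Vd d → ℝ} (hg : Measurable (Function.uncurry g)) :
    Measurable fun x => ∫ v, g x v ∂(m x) := by
  let k : Kernel X (Vd d) := ⟨m, hm⟩
  have : IsMarkovKernel k := ⟨hp⟩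
  exact (StronglyMeasurable.integral_kernel_prod_right (κ := k) hg.stronglyMeasurable).measurable

lemma Qf_meas (hG : Good B b κ δ) {X : Type*} [MeasurableSpace X] {m : X → Measure (Vd d)}
    (hm : Measurable m) (hp : ∀ x, IsProbabilityMeasure (m x)) {h : Tri d → ℝ} (hh : Measurable h) :
    Measurable fun x => Qf b h (m x) := by
  unfold Qf
  refine integral_meas_of hm hp (g := fun x v => ∫ vs, Ab b h v vs ∂(m x)) ?_
  refine integral_meas_of (m := fun p : X × Vd d => m p.1) (hm.comp measurable_fst)
    (fun p => hp p.1) (g := fun p vs => Ab b h p.2 vs) ?_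
  have h1 : Measurable fun q : (X × Vd d) × Vd d => (q.1.2, q.2) := by fun_prop
  have h2 := (Ab_meas hG hh).comp h1
  exact h2

end partC


section partD

variable {d : ℕ}

lemma bl_testF {f : Vd d → ℝ} {K L : ℝ} (hK : ∀ v, |f v| ≤ K) (hL : ∀ v w, |f v - f w| ≤ L * ‖v - w‖)
    (hL0 : 0 ≤ L) : (fun v => (K + L + 1)⁻¹ * f v) ∈ testF d := by
  have hK0 : 0 ≤ K := (abs_nonneg _).trans (hK 0)
  have hc : 0 < K + L + 1 := by linarith
  have hmain : ∀ v v' : Vd d, |f v / wt v - f v' / wt v'| ≤ (K + L) * ‖v - v'‖ := by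
    intro v v'
    have h1 := one_le_wt v
    have h2 := one_le_wt v'
    have e : f v / wt v - f v' / wt v' = (f v - f v') / wt v + f v' * ((wt v' - wt v) / (wt v * wt v')) := by
      field_simp; ring
    have h3 : |wt v' - wt v| ≤ ‖v - v'‖ * (wt v * wt v') := by
      have e2 : wt v' - wt v = (‖v'‖ - ‖v‖) * (‖v'‖ + ‖v‖) := by unfold wt; ring
      rw [e2, abs_mul]
      have h4 : |‖v'‖ - ‖v‖| ≤ ‖v - v'‖ := by rw [norm_sub_rev]; exact abs_norm_sub_norm_le v' v
      have h5 : |‖v'‖ + ‖v‖| ≤ wt v * wt v' := by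
        rw [abs_of_nonneg (by positivity)]
        have h6 : ‖v‖ ≤ wt v / 2 := by unfold wt; nlinarith [sq_nonneg (‖v‖ - 1)]
        have h7 : ‖v'‖ ≤ wt v' / 2 := by unfold wt; nlinarith [sq_nonneg (‖v'‖ - 1)]
        nlinarith
      gcongr
    rw [e]
    have h8 : |(f v - f v') / wt v| ≤ L * ‖v - v'‖ := by
      rw [abs_div, abs_of_pos (wt_pos v)]
      exact (div_le_self (abs_nonneg _) h1).trans (hL v v')
    have h9 : |f v' * ((wt v' - wt v) / (wt v * wt v'))| ≤ K * ‖v - v'‖ := by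
      rw [abs_mul, abs_div, abs_of_pos (by positivity : 0 < wt v * wt v')]
      gcongr
      · exact hK v'
      · rw [div_le_iff₀ (by positivity)]; exact h3
    have h10 := abs_add_le ((f v - f v') / wt v) (f v' * ((wt v' - wt v) / (wt v * wt v')))
    linarith
  refine ⟨fun v => ?_, fun v v' => ?_⟩
  · have h1 := one_le_wt v
    have : |(K + L + 1)⁻¹ * f v| ≤ 1 := by
      rw [abs_mul, abs_of_pos (by positivity : 0 < (K + L + 1)⁻¹), inv_mul_le_iff₀ hc]
      linarith [hK v]
    change |((K + L + 1)⁻¹ * f v) / wt v| ≤ 1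
    rw [abs_div, abs_of_pos (wt_pos v)]
    exact (div_le_self (abs_nonneg _) h1).trans this
  · change |((K + L + 1)⁻¹ * f v) / wt v - ((K + L + 1)⁻¹ * f v') / wt v'| ≤ _
    rw [mul_div_assoc, mul_div_assoc, ← mul_sub, abs_mul, abs_of_pos (by positivity : 0 < (K + L + 1)⁻¹),
      inv_mul_le_iff₀ hc]
    refine (hmain v v').trans (mul_le_mul_of_nonneg_right (by linarith) (norm_nonneg _))

lemma meas_of_test {X : Type*} [MeasurableSpace X] {m : X → Measure (Vd d)}
    (hp : ∀ x, IsProbabilityMeasure (m x))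
    (h : ∀ f ∈ testF d, Measurable fun x => ∫ v, f v ∂(m x)) : Measurable m := by
  refine Measurable.measure_of_isPiSystem_of_isProbabilityMeasure (S := {s | IsClosed s})
    ?_ isPiSystem_isClosed ?_
  · rw [← borel_eq_generateFrom_isClosed]; exact BorelSpace.measurable_eq
  intro s hs
  have hpos : ∀ n : ℕ, (0:ℝ) < 1 / ((n:ℝ) + 1) := fun n => by positivity
  refine ENNReal.measurable_of_tendsto
    (f := fun (n : ℕ) x => ∫⁻ v, (thickenedIndicator (hpos n) s v : ℝ≥0∞) ∂(m x)) (fun n => ?_)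
    (tendsto_pi_nhds.2 fun x => tendsto_lintegral_thickenedIndicator_of_isClosed (m x) hs hpos
      tendsto_one_div_add_atTop_nhds_zero_nat)
  set F : Vd d → ℝ := fun v => (thickenedIndicator (hpos n) s v : ℝ) with hF
  have hF1 : ∀ v, |F v| ≤ 1 := fun v => by
    simp only [hF, NNReal.abs_eq]
    exact_mod_cast thickenedIndicator_le_one (hpos n) s v
  have hlip := lipschitzWith_thickenedIndicator (hpos n) s
  have h2 := h _ (bl_testF (f := F) (K := 1) (L := (1 / ((n:ℝ) + 1)).toNNReal⁻¹) hF1 (fun v w => by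
      have := hlip.dist_le_mul v w
      rw [NNReal.dist_eq, dist_eq_norm] at this
      exact this) (by positivity))
  simp only [integral_const_mul] at h2
  have h3 : Measurable fun x => ∫ v, F v ∂(m x) := by
    have h4 := h2.const_mul ((1:ℝ) + ((1 / ((n:ℝ) + 1)).toNNReal⁻¹ : ℝ≥0) + 1)
    have hne : ((1:ℝ) + ((1 / ((n:ℝ) + 1)).toNNReal⁻¹ : ℝ≥0) + 1) ≠ 0 := by positivity
    simp only [← NNReal.coe_inv] at h4
    simpa only [mul_inv_cancel_left₀ hne] using h4
  have h5 : (fun x => ∫⁻ v, (thickenedIndicator (hpos n) s v : ℝ≥0∞) ∂(m x))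
      = fun x => ENNReal.ofReal (∫ v, F v ∂(m x)) := by
    funext x
    rw [ofReal_integral_eq_lintegral_ofReal]
    · simp [hF]
    · refine Integrable.of_bound (C := 1) ?_ (ae_of_all _ fun v => by simpa using hF1 v)
      exact (NNReal.continuous_coe.comp (thickenedIndicator (hpos n) s).continuous).aestronglyMeasurable
    · exact ae_of_all _ fun v => by simp [hF]
  rw [h5]
  exact h3.ennreal_ofReal

lemma joint_meas {Ω : Type*} [MeasurableSpace Ω] {f : ℝ → Ω → ℝ} (hm : ∀ t, Measurable (f t))
    (hr : ∀ ω t, ContinuousWithinAt (fun s => f s ω) (Set.Ici t) t) :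
    Measurable fun p : ℝ × Ω => f p.1 p.2 := by
  let a : ℕ → ℝ → ℝ := fun n t => (⌊((n:ℝ) + 1) * t⌋ + 1) / ((n:ℝ) + 1)
  have ha : ∀ n t, t ≤ a n t ∧ a n t ≤ t + 1 / ((n:ℝ) + 1) := by
    intro n t
    have hn : (0:ℝ) < (n:ℝ) + 1 := by positivity
    have h1 := Int.floor_le (((n:ℝ) + 1) * t)
    have h2 := Int.lt_floor_add_one (((n:ℝ) + 1) * t)
    constructor
    · rw [le_div_iff₀ hn]; linarith
    · rw [div_le_iff₀ hn, add_mul t, one_div_mul_cancel hn.ne']; linarith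
  refine measurable_of_tendsto_metrizable (f := fun (n : ℕ) (p : ℝ × Ω) => f (a n p.1) p.2) ?_ ?_
  · intro n
    have h1 : Measurable fun q : ℤ × Ω => f (((q.1:ℝ) + 1) / ((n:ℝ) + 1)) q.2 :=
      measurable_from_prod_countable_right fun k => hm (((k:ℝ) + 1) / ((n:ℝ) + 1))
    have h2 : Measurable fun p : ℝ × Ω => (⌊((n:ℝ) + 1) * p.1⌋, p.2) := by
      refine Measurable.prodMk ?_ measurable_snd
      exact Int.measurable_floor.comp (by fun_prop)
    exact h1.comp h2
  · rw [tendsto_pi_nhds]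
    rintro ⟨t, ω⟩
    have h1 : Tendsto (fun n => a n t) atTop (nhdsWithin t (Set.Ici t)) := by
      rw [tendsto_nhdsWithin_iff]
      refine ⟨?_, Eventually.of_forall fun n => (ha n t).1⟩
      refine tendsto_of_tendsto_of_tendsto_of_le_of_le tendsto_const_nhds
        (h := fun n : ℕ => t + 1 / ((n:ℝ) + 1)) ?_ (fun n => (ha n t).1) (fun n => (ha n t).2)
      have := (tendsto_one_div_add_atTop_nhds_zero_nat (𝕜 := ℝ)).const_add t
      simpa using this
    exact (hr ω t).tendsto.comp h1

variable {Ω : Type*} [m0 : MeasurableSpace Ω] {B : Vd d → Measure (Vd d)} {N : ℕ} {P : Measure Ω}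
  {𝓕 : Filtration ℝ m0} {m : ℝ → Ω → Measure (Vd d)}

lemma kp_adapted (h : IsKacProcess B N P 𝓕 m) (t : ℝ) : Measurable[𝓕 t] (m t) :=
  @meas_of_test d Ω (𝓕 t) (m t) (fun ω => (h.mem t ω).1.1) fun f hf => h.adapted f hf t

lemma kp_joint (h : IsKacProcess B N P 𝓕 m) : Measurable fun p : ℝ × Ω => m p.1 p.2 :=
  meas_of_test (fun p => (h.mem p.1 p.2).1.1) fun f hf =>
    joint_meas (f := fun t ω => ∫ v, f v ∂(m t ω)) (fun t => (h.adapted f hf t).mono (𝓕.le t) le_rfl)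
      fun ω t => h.rightCont ω f hf t

lemma kp_rc (h : IsKacProcess B N P 𝓕 m) {f : Vd d → ℝ} {K L : ℝ} (hK : ∀ v, |f v| ≤ K)
    (hL : ∀ v w, |f v - f w| ≤ L * ‖v - w‖) (hL0 : 0 ≤ L) (ω : Ω) (t : ℝ) :
    ContinuousWithinAt (fun s => ∫ v, f v ∂(m s ω)) (Set.Ici t) t := by
  have hK0 : 0 ≤ K := (abs_nonneg _).trans (hK 0)
  have h1 := (h.rightCont ω _ (bl_testF hK hL hL0) t).const_mul (K + L + 1)
  simp only [integral_const_mul] at h1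
  have hc : K + L + 1 ≠ 0 := by linarith
  refine h1.congr (fun y _ => ?_) ?_ <;> field_simp

end partD


section partE

variable {Ω : Type*} [m0 : MeasurableSpace Ω] {P : Measure Ω} [IsProbabilityMeasure P]

lemma ii_of_bdd {f : ℝ → ℝ} (hf : Measurable f) {C : ℝ} {a b : ℝ} (hab : a ≤ b)
    (hC : ∀ u ∈ Set.Ioc a b, |f u| ≤ C) :
    IntervalIntegrable f volume a b := by
  rw [intervalIntegrable_iff_integrableOn_Ioc_of_le hab]
  refine Measure.integrableOn_of_bounded (M := C) (by simp) hf.aestronglyMeasurable ?_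
  exact (ae_restrict_iff' measurableSet_Ioc).2 (ae_of_all _ hC)

lemma ii_bdd' {f : ℝ → ℝ} (hf : Measurable f) {C : ℝ} (hC : ∀ u, |f u| ≤ C) (a b : ℝ) :
    IntervalIntegrable f volume a b := by
  rcases le_total a b with h | h
  · exact ii_of_bdd hf h fun u _ => hC u
  · exact (ii_of_bdd hf h fun u _ => hC u).symm

lemma ibp {α β : ℝ → ℝ} {a b : ℝ} (hα : IntervalIntegrable α volume a b)
    (hβ : IntervalIntegrable β volume a b) :
    (∫ u in a..b, α u) * (∫ u in a..b, β u)
      = ∫ r in a..b, (α r * (∫ u in a..r, β u) + (∫ u in a..r, α u) * β r) := by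
  have h1 := hα.absolutelyContinuousOnInterval_intervalIntegral (c := a) (by simp)
  have h2 := hβ.absolutelyContinuousOnInterval_intervalIntegral (c := a) (by simp)
  have h3 := h1.integral_deriv_mul_eq_sub h2
  simp only [intervalIntegral.integral_same, mul_zero, sub_zero] at h3
  rw [← h3]
  refine intervalIntegral.integral_congr_ae ?_
  filter_upwards [hα.ae_hasDerivAt_integral, hβ.ae_hasDerivAt_integral] with x hx1 hx2 hx
  have hx' := Set.uIoc_subset_uIcc hx
  rw [(hx1 hx' a (by simp)).deriv, (hx2 hx' a (by simp)).deriv]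

lemma fub_int {F : ℝ → Ω → ℝ} (hF : Measurable fun p : ℝ × Ω => F p.1 p.2) {a b C : ℝ}
    (hC : ∀ u ∈ Set.Ioc a b, ∀ ω, |F u ω| ≤ C) :
    Integrable (fun p : ℝ × Ω => F p.1 p.2) ((volume.restrict (Set.Ioc a b)).prod P) := by
  refine Integrable.of_bound hF.aestronglyMeasurable C ?_
  have h1 : ∀ᵐ u ∂(volume.restrict (Set.Ioc a b)), u ∈ Set.Ioc a b := ae_restrict_mem measurableSet_Ioc
  have h2 := (Measure.quasiMeasurePreserving_fst (μ := volume.restrict (Set.Ioc a b)) (ν := P)).ae h1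
  filter_upwards [h2] with p hp
  exact hC _ hp _

lemma fub {F : ℝ → Ω → ℝ} (hF : Measurable fun p : ℝ × Ω => F p.1 p.2) {a b C : ℝ} (hab : a ≤ b)
    (hC : ∀ u ∈ Set.Ioc a b, ∀ ω, |F u ω| ≤ C) :
    ∫ ω, (∫ u in a..b, F u ω) ∂P = ∫ u in a..b, (∫ ω, F u ω ∂P) := by
  simp only [intervalIntegral.integral_of_le hab]
  exact (integral_integral_swap (fub_int hF hC)).symm

lemma meas_ii {m1 : MeasurableSpace Ω} {F : ℝ → Ω → ℝ} (hF : Measurable fun p : ℝ × Ω => F p.1 p.2) {a b : ℝ} (hab : a ≤ b) :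
    Measurable fun ω => ∫ u in a..b, F u ω := by
  simp only [intervalIntegral.integral_of_le hab]
  have h : Measurable fun p : Ω × ℝ => F p.2 p.1 := hF.comp measurable_swap
  exact (h.stronglyMeasurable.integral_prod_right' (ν := volume.restrict (Set.Ioc a b))).measurable

lemma meas_E {F : ℝ → Ω → ℝ} (hF : Measurable fun p : ℝ × Ω => F p.1 p.2) :
    Measurable fun u => ∫ ω, F u ω ∂P :=
  (hF.stronglyMeasurable.integral_prod_right' (ν := P)).measurable

lemma ii_abs_le {f : ℝ → ℝ} {C a b : ℝ} (hab : a ≤ b) (hC : ∀ u ∈ Set.Ioc a b, |f u| ≤ C) :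
    |∫ u in a..b, f u| ≤ C * (b - a) := by
  have := intervalIntegral.norm_integral_le_of_norm_le_const (a := a) (b := b) (f := f) (C := C)
    (by rw [Set.uIoc_of_le hab]; exact hC)
  rwa [abs_of_nonneg (by linarith : 0 ≤ b - a)] at this

lemma int_bdd {f : Ω → ℝ} (hf : Measurable f) {C : ℝ} (hC : ∀ ω, |f ω| ≤ C) : Integrable f P :=
  Integrable.of_bound hf.aestronglyMeasurable C (ae_of_all _ hC)

lemma E_abs_le {f : Ω → ℝ} {C : ℝ} (hC : ∀ ω, |f ω| ≤ C) : |∫ ω, f ω ∂P| ≤ C := by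
  have := norm_integral_le_of_norm_le_const (μ := P) (f := f) (C := C) (ae_of_all _ hC)
  simpa using this

lemma mart_orth {𝓕 : Filtration ℝ m0} {M : ℝ → Ω → ℝ} (hM : Martingale M 𝓕 P) {s t : ℝ} (hst : s ≤ t)
    {Z : Ω → ℝ} (hZ : Measurable[𝓕 s] Z) {C : ℝ} (hC : ∀ ω, |Z ω| ≤ C) :
    ∫ ω, Z ω * (M t ω - M s ω) ∂P = 0 := by
  have hZ' : Measurable Z := hZ.mono (𝓕.le s) le_rfl
  have h1 := condExp_stronglyMeasurable_mul_of_bound (𝓕.le s) hZ.stronglyMeasurable (hM.integrable t) C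
    (ae_of_all P hC)
  have h2 := hM.2 s t hst
  have h3 : ∫ ω, Z ω * M t ω ∂P = ∫ ω, Z ω * M s ω ∂P := by
    rw [← integral_condExp (𝓕.le s)]
    refine integral_congr_ae ?_
    filter_upwards [h1, h2] with ω h4 h5
    rw [Pi.mul_apply, h5] at h4
    exact h4
  simp only [mul_sub]
  rw [integral_sub, h3, sub_self]
  · exact (hM.integrable t).bdd_mul hZ'.aestronglyMeasurable (ae_of_all _ hC)
  · exact (hM.integrable s).bdd_mul hZ'.aestronglyMeasurable (ae_of_all _ hC)

lemma sq_bracket {𝓕 : Filtration ℝ m0} {X q γ : ℝ → Ω → ℝ}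
    (hX : Measurable fun p : ℝ × Ω => X p.1 p.2) (hq : Measurable fun p : ℝ × Ω => q p.1 p.2)
    (hγ : Measurable fun p : ℝ × Ω => γ p.1 p.2) {C : ℝ} (bX : ∀ u ω, |X u ω| ≤ C)
    (bq : ∀ u ω, |q u ω| ≤ C) (bγ : ∀ u ω, |γ u ω| ≤ C)
    (aX : ∀ u, Measurable[𝓕 u] (X u)) (aq : ∀ u, Measurable[𝓕 u] (q u))
    (hM : Martingale (fun t ω => X t ω - ∫ s in Set.Ioc (0:ℝ) t, q s ω) 𝓕 P)
    (hM2 : Martingale (fun t ω => X t ω ^ 2 - ∫ s in Set.Ioc (0:ℝ) t, (2 * X s ω * q s ω + γ s ω)) 𝓕 P)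
    {s t : ℝ} (hs : 0 ≤ s) (hst : s ≤ t) :
    ∫ ω, (X t ω - X s ω - ∫ u in s..t, q u ω) ^ 2 ∂P = ∫ u in s..t, (∫ ω, γ u ω ∂P) := by
  obtain ⟨ω0⟩ : Nonempty Ω := P.nonempty_of_neZero
  have hC0 : 0 ≤ C := (abs_nonneg _).trans (bX 0 ω0)
  have sec : ∀ {F : ℝ → Ω → ℝ}, (Measurable fun p : ℝ × Ω => F p.1 p.2) → ∀ ω, Measurable fun u => F u ω :=
    fun h ω => h.comp measurable_prodMk_right
  have sec' : ∀ {F : ℝ → Ω → ℝ}, (Measurable fun p : ℝ × Ω => F p.1 p.2) → ∀ u, Measurable fun ω => F u ω :=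
    fun h ω => h.comp measurable_prodMk_left
  have iq : ∀ ω a b, IntervalIntegrable (fun u => q u ω) volume a b := fun ω a b =>
    ii_bdd' (sec hq ω) (fun u => bq u ω) a b
  set A : ℝ → Ω → ℝ := fun r ω => ∫ u in s..r, q u ω with hA
  -- joint measurability of A
  have mA' : Measurable fun p : ℝ × Ω => ∫ u in s..(max s p.1), q u p.2 := by
    refine joint_meas (f := fun r ω => ∫ u in s..(max s r), q u ω)
      (fun r => meas_ii hq (le_max_left s r)) fun ω r => ?_
    have h1 : Continuous fun r => ∫ u in s..r, q u ω :=
      intervalIntegral.continuous_primitive (fun a b => iq ω a b) s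
    exact (h1.comp (by fun_prop : Continuous fun r => max s r)).continuousWithinAt
  have incr : ∀ r r', 0 ≤ r → r ≤ r' → ∀ ω, (X r' ω - ∫ u in Set.Ioc (0:ℝ) r', q u ω)
      - (X r ω - ∫ u in Set.Ioc (0:ℝ) r, q u ω) = X r' ω - X r ω - ∫ u in r..r', q u ω := by
    intro r r' h0 h1 ω
    rw [← intervalIntegral.integral_of_le h0, ← intervalIntegral.integral_of_le (h0.trans h1),
      ← intervalIntegral.integral_add_adjacent_intervals (iq ω 0 r) (iq ω r r')]
    ring
  have mA : ∀ r, s ≤ r → Measurable (A r) := fun r hr => meas_ii hq hr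
  have bA : ∀ r, s ≤ r → r ≤ t → ∀ ω, |A r ω| ≤ C * (t - s) := fun r hr hr' ω =>
    (ii_abs_le hr fun u _ => bq u ω).trans (by gcongr)
  set Y : ℝ → Ω → ℝ := fun r ω => X r ω - X s ω - A r ω with hY
  -- orthogonality
  have o1 : ∫ ω, X s ω * Y t ω ∂P = 0 := by
    have := mart_orth hM hst (aX s) (bX s)
    simp only [incr s t hs hst] at this
    exact this
  have YC : ∀ r, s ≤ r → r ≤ t → ∀ ω, |Y r ω| ≤ 2 * C + C * (t - s) := by
    intro r h1 h2 ω
    have e1 := abs_le.1 (bX r ω)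
    have e2 := abs_le.1 (bX s ω)
    have e3 := abs_le.1 (bA r h1 h2 ω)
    rw [abs_le]; constructor <;> simp only [hY] <;> linarith
  have mY : ∀ r, s ≤ r → Measurable (Y r) := fun r h1 => ((sec' hX r).sub (sec' hX s)).sub (mA r h1)
  have o2 : ∀ r ∈ Set.Icc s t, ∫ ω, q r ω * Y t ω ∂P = ∫ ω, q r ω * Y r ω ∂P := by
    intro r hr
    have h1 := mart_orth hM hr.2 (aq r) (bq r)
    simp only [incr r t (hs.trans hr.1) hr.2] at h1
    rw [← sub_eq_zero, ← integral_sub, ← h1]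
    · congr 1; ext ω
      simp only [hY, hA]
      rw [← intervalIntegral.integral_add_adjacent_intervals (iq ω s r) (iq ω r t)]
      ring
    · refine int_bdd ((sec' hq r).mul (mY t hst)) (C := C * (2 * C + C * (t - s))) fun ω => ?_
      rw [abs_mul]
      exact mul_le_mul (bq r ω) (YC t hst le_rfl ω) (abs_nonneg _) hC0
    · refine int_bdd ((sec' hq r).mul (mY r hr.1)) (C := C * (2 * C + C * (t - s))) fun ω => ?_
      rw [abs_mul]
      exact mul_le_mul (bq r ω) (YC r hr.1 hr.2 ω) (abs_nonneg _) hC0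
  -- second martingale
  have b2 : ∀ u ω, |2 * X u ω * q u ω + γ u ω| ≤ 2 * C * C + C := by
    intro u ω
    refine (abs_add_le _ _).trans (add_le_add ?_ (bγ u ω))
    rw [abs_mul, abs_mul, abs_two]
    gcongr
    exacts [bX u ω, bq u ω]
  have m2 : Measurable fun p : ℝ × Ω => 2 * X p.1 p.2 * q p.1 p.2 + γ p.1 p.2 := by fun_prop
  have o3 : ∫ ω, (X t ω ^ 2 - X s ω ^ 2) ∂P
      = ∫ ω, (∫ u in s..t, (2 * X u ω * q u ω + γ u ω)) ∂P := by
    have h1 := mart_orth hM2 hst (Z := fun _ => 1) measurable_const (C := 1) (by simp)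
    rw [← sub_eq_zero, ← integral_sub, ← h1]
    · congr 1; ext ω
      have i2 : ∀ a b, IntervalIntegrable (fun u => 2 * X u ω * q u ω + γ u ω) volume a b := fun a b =>
        ii_bdd' (sec (F := fun u ω => 2 * X u ω * q u ω + γ u ω) m2 ω) (fun u => b2 u ω) a b
      rw [← intervalIntegral.integral_of_le hs, ← intervalIntegral.integral_of_le (hs.trans hst),
        ← intervalIntegral.integral_add_adjacent_intervals (i2 0 s) (i2 s t)]
      ring
    · refine int_bdd (((sec' hX t).pow_const 2).sub ((sec' hX s).pow_const 2)) (C := C ^ 2 + C ^ 2) fun ω => ?_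
      refine (abs_sub _ _).trans (add_le_add ?_ ?_) <;> rw [abs_pow] <;> gcongr
      exacts [bX t ω, bX s ω]
    · exact int_bdd (meas_ii (F := fun u ω => 2 * X u ω * q u ω + γ u ω) m2 hst)
        fun ω => ii_abs_le hst fun u _ => b2 u ω
  -- E[Y A]
  have yA : ∫ ω, Y t ω * A t ω ∂P = ∫ ω, (∫ r in s..t, q r ω * Y r ω) ∂P := by
    have h1 : ∀ ω, Y t ω * A t ω = ∫ r in s..t, q r ω * Y t ω := fun ω => by
      rw [intervalIntegral.integral_mul_const]; simp only [hA]; ring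
    have mj : Measurable fun p : ℝ × Ω => q p.1 p.2 * Y t p.2 := hq.mul ((mY t hst).comp measurable_snd)
    simp only [h1]
    rw [fub (F := fun r ω => q r ω * Y t ω) mj hst (C := C * (2 * C + C * (t - s))) (fun r hr ω => by
      rw [abs_mul]
      exact mul_le_mul (bq r ω) (YC t hst le_rfl ω) (abs_nonneg _) hC0)]
    have h2 : ∫ ω, (∫ r in s..t, q r ω * Y r ω) ∂P
        = ∫ ω, (∫ r in s..t, q r ω * (X r ω - X s ω - A (max s r) ω)) ∂P := by
      congr 1; ext ω
      refine intervalIntegral.integral_congr fun r hr => ?_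
      rw [Set.uIcc_of_le hst] at hr
      simp only [hY, max_eq_right hr.1]
    have mj2 : Measurable fun p : ℝ × Ω => q p.1 p.2 * (X p.1 p.2 - X s p.2 - A (max s p.1) p.2) :=
      hq.mul ((hX.sub ((sec' hX s).comp measurable_snd)).sub mA')
    rw [h2, fub (F := fun r ω => q r ω * (X r ω - X s ω - A (max s r) ω)) mj2 hst
      (C := C * (2 * C + C * (t - s))) (fun r hr ω => by
      rw [abs_mul, max_eq_right hr.1.le]
      exact mul_le_mul (bq r ω) (YC r hr.1.le hr.2 ω) (abs_nonneg _) hC0)]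
    refine intervalIntegral.integral_congr fun r hr => ?_
    rw [Set.uIcc_of_le hst] at hr
    simp only [max_eq_right hr.1]
    exact o2 r hr
  -- pathwise identity
  have path : ∀ ω, (∫ r in s..t, q r ω * Y r ω)
      = (∫ r in s..t, X r ω * q r ω) - X s ω * A t ω - A t ω ^ 2 / 2 := by
    intro ω
    have h1 := ibp (iq ω s t) (iq ω s t)
    have cA : Continuous fun r => A r ω := intervalIntegral.continuous_primitive (fun a b => iq ω a b) s
    have i1 : IntervalIntegrable (fun r => A r ω * q r ω) volume s t :=
      (iq ω s t).continuousOn_mul cA.continuousOn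
    have i2 : IntervalIntegrable (fun r => X r ω * q r ω) volume s t := by
      have mm : Measurable fun u => X u ω * q u ω := (sec hX ω).mul (sec hq ω)
      refine ii_bdd' mm (C := C * C) (fun u => ?_) s t
      rw [abs_mul]; exact mul_le_mul (bX u ω) (bq u ω) (abs_nonneg _) hC0
    have h2 : (∫ r in s..t, (q r ω * (∫ u in s..r, q u ω) + (∫ u in s..r, q u ω) * q r ω))
        = 2 * ∫ r in s..t, A r ω * q r ω := by
      rw [← intervalIntegral.integral_const_mul]
      congr 1; ext r; simp only [hA]; ring
    rw [h2] at h1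
    have h3 : (∫ r in s..t, q r ω * Y r ω) = ∫ r in s..t, (X r ω * q r ω - X s ω * q r ω - A r ω * q r ω) := by
      congr 1; ext r; simp only [hY]; ring
    rw [h3, intervalIntegral.integral_sub (i2.sub ((iq ω s t).const_mul _)) i1,
      intervalIntegral.integral_sub i2 ((iq ω s t).const_mul _), intervalIntegral.integral_const_mul]
    simp only [hA] at h1 ⊢
    linarith
  have gq : ∀ ω, (∫ u in s..t, (2 * X u ω * q u ω + γ u ω))
      = 2 * (∫ r in s..t, X r ω * q r ω) + ∫ u in s..t, γ u ω := by
    intro ω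
    have i2 : IntervalIntegrable (fun r => X r ω * q r ω) volume s t := by
      have mm : Measurable fun u => X u ω * q u ω := (sec hX ω).mul (sec hq ω)
      refine ii_bdd' mm (C := C * C) (fun u => ?_) s t
      rw [abs_mul]; exact mul_le_mul (bX u ω) (bq u ω) (abs_nonneg _) hC0
    rw [← intervalIntegral.integral_const_mul, ← intervalIntegral.integral_add (i2.const_mul 2)
      (ii_bdd' (sec hγ ω) (fun u => bγ u ω) s t)]
    congr 1; ext r; ring
  -- integrability
  have I1 : Integrable (fun ω => X t ω ^ 2 - X s ω ^ 2) P := by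
    refine int_bdd (((sec' hX t).pow_const 2).sub ((sec' hX s).pow_const 2)) (C := C ^ 2 + C ^ 2) fun ω => ?_
    refine (abs_sub _ _).trans (add_le_add ?_ ?_) <;> rw [abs_pow] <;> gcongr
    exacts [bX t ω, bX s ω]
  have I2 : Integrable (fun ω => X s ω * Y t ω) P :=
    int_bdd ((sec' hX s).mul (mY t hst)) (C := C * (2 * C + C * (t - s))) fun ω => by
      rw [abs_mul]; exact mul_le_mul (bX s ω) (YC t hst le_rfl ω) (abs_nonneg _) hC0
  have I3 : Integrable (fun ω => X s ω * A t ω) P :=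
    int_bdd ((sec' hX s).mul (mA t hst)) (C := C * (C * (t - s))) fun ω => by
      rw [abs_mul]; exact mul_le_mul (bX s ω) (bA t hst le_rfl ω) (abs_nonneg _) hC0
  have I4 : Integrable (fun ω => A t ω ^ 2) P :=
    int_bdd ((mA t hst).pow_const 2) (C := (C * (t - s)) ^ 2) fun ω => by
      rw [abs_pow]; gcongr; exact bA t hst le_rfl ω
  have I5 : Integrable (fun ω => Y t ω * A t ω) P :=
    int_bdd ((mY t hst).mul (mA t hst)) (C := (2 * C + C * (t - s)) * (C * (t - s))) fun ω => by
      rw [abs_mul]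
      exact mul_le_mul (YC t hst le_rfl ω) (bA t hst le_rfl ω) (abs_nonneg _)
        ((abs_nonneg _).trans (YC t hst le_rfl ω))
  have mXq : Measurable fun p : ℝ × Ω => X p.1 p.2 * q p.1 p.2 := hX.mul hq
  have I6 : Integrable (fun ω => ∫ r in s..t, X r ω * q r ω) P :=
    int_bdd (meas_ii (F := fun r ω => X r ω * q r ω) mXq hst) (C := C * C * (t - s)) fun ω =>
      ii_abs_le hst fun u _ => by
        rw [abs_mul]; exact mul_le_mul (bX u ω) (bq u ω) (abs_nonneg _) hC0
  have I7 : Integrable (fun ω => ∫ r in s..t, γ r ω) P :=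
    int_bdd (meas_ii hγ hst) (C := C * (t - s)) fun ω => ii_abs_le hst fun u _ => bγ u ω
  have e1 : ∫ ω, (X t ω ^ 2 - X s ω ^ 2) ∂P
      = 2 * ∫ ω, (∫ r in s..t, X r ω * q r ω) ∂P + ∫ ω, (∫ u in s..t, γ u ω) ∂P := by
    rw [o3]; simp only [gq]
    rw [integral_add (I6.const_mul 2) I7, integral_const_mul]
  have e2 : ∫ ω, Y t ω * A t ω ∂P = ∫ ω, (∫ r in s..t, X r ω * q r ω) ∂P
      - ∫ ω, X s ω * A t ω ∂P - (∫ ω, A t ω ^ 2 ∂P) / 2 := by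
    have I63 : Integrable (fun ω => (∫ r in s..t, X r ω * q r ω) - X s ω * A t ω) P := I6.sub I3
    rw [yA]; simp only [path]
    rw [integral_sub I63 (I4.div_const 2), integral_sub I6 I3, integral_div]
  have e3 : ∫ ω, (X t ω - X s ω - ∫ u in s..t, q u ω) ^ 2 ∂P
      = ∫ ω, (((((X t ω ^ 2 - X s ω ^ 2) - 2 * (X s ω * Y t ω)) - 2 * (X s ω * A t ω))
        - 2 * (Y t ω * A t ω)) - A t ω ^ 2) ∂P := by
    congr 1; ext ω; simp only [hY, hA]; ring
  have J1 : Integrable (fun ω => (X t ω ^ 2 - X s ω ^ 2) - 2 * (X s ω * Y t ω)) P :=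
    I1.sub (I2.const_mul 2)
  have J2 : Integrable (fun ω => ((X t ω ^ 2 - X s ω ^ 2) - 2 * (X s ω * Y t ω))
      - 2 * (X s ω * A t ω)) P := J1.sub (I3.const_mul 2)
  have J3 : Integrable (fun ω => (((X t ω ^ 2 - X s ω ^ 2) - 2 * (X s ω * Y t ω))
      - 2 * (X s ω * A t ω)) - 2 * (Y t ω * A t ω)) P := J2.sub (I5.const_mul 2)
  rw [e3, integral_sub J3 I4, integral_sub J2 (I5.const_mul 2),
    integral_sub J1 (I3.const_mul 2), integral_sub I1 (I2.const_mul 2),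
    integral_const_mul, integral_const_mul, integral_const_mul, o1, e1, e2,
    ← fub hγ hst (fun u _ ω => bγ u ω)]
  ring

end partE


section partP

variable {d N : ℕ} {Ω : Type*} [m0 : MeasurableSpace Ω] {P : Measure Ω} [IsProbabilityMeasure P]
  {𝓕 : Filtration ℝ m0} {B : Vd d → Measure (Vd d)} {b : Kernel (Vd d × Vd d) (Vd d)} {κ δ : ℝ}
  {m : ℝ → Ω → Measure (Vd d)}

def Mt (b : Kernel (Vd d × Vd d) (Vd d)) (m : ℝ → Ω → Measure (Vd d)) (τ : ℝ) (g : Vd d → ℝ)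
    (t : ℝ) (ω : Ω) : ℝ :=
  ∫ v, g v ∂(m t ω) - ∫ v, g v ∂(m τ ω) - ∫ s in τ..t, Qf b (Del g) (m s ω)

lemma LB.norm {g : Vd d → ℝ} (hg : LB g) : ∃ K, 0 ≤ K ∧ ∀ v, ‖v‖ ≤ 2 * √N → |g v| ≤ K := hg.bdd _

lemma kp_X_meas (h : IsKacProcess B N P 𝓕 m) {g : Vd d → ℝ} (hg : Measurable g) :
    Measurable fun p : ℝ × Ω => ∫ v, g v ∂(m p.1 p.2) :=
  integral_meas_of (kp_joint h) (fun p => (emp_of_mem (h.mem _ _)).prob) (hg.comp measurable_snd)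

lemma kp_X_adp (h : IsKacProcess B N P 𝓕 m) {g : Vd d → ℝ} (hg : Measurable g) (t : ℝ) :
    Measurable[𝓕 t] fun ω => ∫ v, g v ∂(m t ω) :=
  @integral_meas_of d Ω (𝓕 t) (m t) (kp_adapted h t) (fun p => (emp_of_mem (h.mem _ _)).prob) _
    (hg.comp measurable_snd)

lemma kp_Q_meas (hG : Good B b κ δ) (h : IsKacProcess B N P 𝓕 m) {k : Tri d → ℝ} (hk : Measurable k) :
    Measurable fun p : ℝ × Ω => Qf b k (m p.1 p.2) :=
  Qf_meas hG (kp_joint h) (fun p => (emp_of_mem (h.mem _ _)).prob) hk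

lemma kp_Q_adp (hG : Good B b κ δ) (h : IsKacProcess B N P 𝓕 m) {k : Tri d → ℝ} (hk : Measurable k) (t : ℝ) :
    Measurable[𝓕 t] fun ω => Qf b k (m t ω) :=
  @Qf_meas d B b κ δ hG Ω (𝓕 t) (m t) (kp_adapted h t) (fun p => (emp_of_mem (h.mem _ _)).prob) k hk

lemma kp_mart (hG : Good B b κ δ) (h : IsKacProcess B N P 𝓕 m) {g : Vd d → ℝ} (hg : LB g) :
    Martingale (fun t ω => ∫ v, g v ∂(m t ω) - ∫ s in Set.Ioc (0:ℝ) t, Qf b (Del g) (m s ω)) 𝓕 P := by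
  obtain ⟨K, hK0, hK⟩ := hg.norm (N := N)
  have hK' : ∀ v, ‖v‖ ≤ √N → |g v| ≤ K := fun v hv => hK v (hv.trans (by linarith [Real.sqrt_nonneg N]))
  have h1 := h.martingale (Gf g K) (Gf_meas hg.meas K) ⟨K, Gf_bdd g hK0⟩
  simp only [fun t ω => Gf_eq (emp_of_mem (h.mem t ω)) hK', fun t ω => kacGen_Gf hG (h.mem t ω) hK] at h1
  exact h1

lemma kp_mart2 (hG : Good B b κ δ) (h : IsKacProcess B N P 𝓕 m) {g : Vd d → ℝ} (hg : LB g) :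
    Martingale (fun t ω => (∫ v, g v ∂(m t ω)) ^ 2 - ∫ s in Set.Ioc (0:ℝ) t,
      (2 * (∫ v, g v ∂(m s ω)) * Qf b (Del g) (m s ω)
        + (N:ℝ)⁻¹ * Qf b (fun p => Del g p ^ 2) (m s ω))) 𝓕 P := by
  obtain ⟨K, hK0, hK⟩ := hg.norm (N := N)
  have hK' : ∀ v, ‖v‖ ≤ √N → |g v| ≤ K := fun v hv => hK v (hv.trans (by linarith [Real.sqrt_nonneg N]))
  have h1 := h.martingale (fun μ => Gf g K μ ^ 2) ((Gf_meas hg.meas K).pow_const 2)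
    ⟨K ^ 2, fun ν => by rw [abs_pow]; exact pow_le_pow_left₀ (abs_nonneg _) (Gf_bdd g hK0 ν) 2⟩
  simp only [fun t ω => kacGen_Gf_sq hG (h.mem t ω) hg.meas hK,
    fun t ω => Gf_eq (emp_of_mem (h.mem t ω)) hK'] at h1
  exact h1

lemma kp_bdds (hG : Good B b κ δ) (h : IsKacProcess B N P 𝓕 m) {g : Vd d → ℝ} (hg : LB g) :
    ∃ C, 0 ≤ C ∧ (∀ t ω, |∫ v, g v ∂(m t ω)| ≤ C) ∧ (∀ t ω, |Qf b (Del g) (m t ω)| ≤ C) ∧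
      ∀ t ω, |(N:ℝ)⁻¹ * Qf b (fun p => Del g p ^ 2) (m t ω)| ≤ C := by
  obtain ⟨K, hK0, hK⟩ := hg.norm (N := N)
  have hK' : ∀ v, ‖v‖ ≤ √N → |g v| ≤ K := fun v hv => hK v (hv.trans (by linarith [Real.sqrt_nonneg N]))
  have a1 : (0:ℝ) ≤ 2 * √N * (4 * K) := by positivity
  have a2 : (0:ℝ) ≤ (N:ℝ)⁻¹ * (2 * √N * (4 * K) ^ 2) := by positivity
  refine ⟨K + 2 * √N * (4 * K) + (N:ℝ)⁻¹ * (2 * √N * (4 * K) ^ 2), by positivity, fun t ω => ?_,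
    fun t ω => ?_, fun t ω => ?_⟩
  · have := emp_abs_le (emp_of_mem (h.mem t ω)) hK'
    linarith
  · have := Qf_bdd hG (emp_of_mem (h.mem t ω)) (Del g) (K := 4 * K) (by positivity)
      (fun v vs σ hσ hv hvs => del_bdd hK hσ hv hvs)
    linarith
  · have := Qf_bdd hG (emp_of_mem (h.mem t ω)) (fun p => Del g p ^ 2) (K := (4 * K) ^ 2) (by positivity)
      (fun v vs σ hσ hv hvs => by
        rw [abs_pow]; exact pow_le_pow_left₀ (abs_nonneg _) (del_bdd hK hσ hv hvs) 2)
    rw [abs_mul, abs_of_nonneg (by positivity : (0:ℝ) ≤ (N:ℝ)⁻¹)]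
    have := mul_le_mul_of_nonneg_left this (by positivity : (0:ℝ) ≤ (N:ℝ)⁻¹)
    linarith

lemma kp_Q_ii (hG : Good B b κ δ) (h : IsKacProcess B N P 𝓕 m) {g : Vd d → ℝ} (hg : LB g) (ω : Ω) (s t : ℝ) :
    IntervalIntegrable (fun u => Qf b (Del g) (m u ω)) volume s t := by
  obtain ⟨C, hC0, h1, h2, h3⟩ := kp_bdds hG h hg
  exact ii_bdd' ((kp_Q_meas hG h (meas_Del hg.meas)).comp measurable_prodMk_right) (fun u => h2 u ω) s t

lemma Mt_incr (hG : Good B b κ δ) (h : IsKacProcess B N P 𝓕 m) {g : Vd d → ℝ} (hg : LB g)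
    {s t : ℝ} (hs : 0 ≤ s) (hst : s ≤ t) (ω : Ω) :
    (∫ v, g v ∂(m t ω) - ∫ s in Set.Ioc (0:ℝ) t, Qf b (Del g) (m s ω))
     - (∫ v, g v ∂(m s ω) - ∫ s in Set.Ioc (0:ℝ) s, Qf b (Del g) (m s ω)) = Mt b m s g t ω := by
  rw [Mt, ← intervalIntegral.integral_of_le hs, ← intervalIntegral.integral_of_le (hs.trans hst),
      ← intervalIntegral.integral_add_adjacent_intervals (kp_Q_ii hG h hg ω 0 s) (kp_Q_ii hG h hg ω s t)]
  ring

lemma Mt_add (hG : Good B b κ δ) (h : IsKacProcess B N P 𝓕 m) {g : Vd d → ℝ} (hg : LB g)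
    (τ s t : ℝ) (ω : Ω) : Mt b m τ g t ω = Mt b m τ g s ω + Mt b m s g t ω := by
  simp only [Mt]
  rw [← intervalIntegral.integral_add_adjacent_intervals (kp_Q_ii hG h hg ω τ s) (kp_Q_ii hG h hg ω s t)]
  ring

lemma Mt_adp (hG : Good B b κ δ) (h : IsKacProcess B N P 𝓕 m) {g : Vd d → ℝ} (hg : LB g)
    {s t : ℝ} (hs : 0 ≤ s) (hst : s ≤ t) : Measurable[𝓕 t] (Mt b m s g t) := by
  have h1 := (kp_mart hG h hg).1
  have h2 := ((h1 t).measurable).sub ((h1 s).measurable.mono (𝓕.mono hst) le_rfl)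
  convert h2 using 1
  ext ω
  exact (Mt_incr hG h hg hs hst ω).symm

lemma Mt_bdd (hG : Good B b κ δ) (h : IsKacProcess B N P 𝓕 m) {g : Vd d → ℝ} (hg : LB g)
    {s t : ℝ} (hst : s ≤ t) : ∃ C, 0 ≤ C ∧ ∀ ω, |Mt b m s g t ω| ≤ C := by
  obtain ⟨C, hC0, h1, h2, h3⟩ := kp_bdds hG h hg
  refine ⟨2 * C + C * (t - s), by have := sub_nonneg.2 hst; positivity, fun ω => ?_⟩
  have e1 := abs_le.1 (h1 t ω)
  have e2 := abs_le.1 (h1 s ω)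
  have e3 := abs_le.1 (ii_abs_le (f := fun u => Qf b (Del g) (m u ω)) hst fun u _ => h2 u ω)
  rw [Mt, abs_le]; constructor <;> linarith

lemma kp_exp (hG : Good B b κ δ) (h : IsKacProcess B N P 𝓕 m) {g : Vd d → ℝ} (hg : LB g)
    {s t : ℝ} (hs : 0 ≤ s) (hst : s ≤ t) :
    ∫ ω, (∫ v, g v ∂(m t ω)) ∂P = ∫ ω, (∫ v, g v ∂(m s ω)) ∂P
      + ∫ u in s..t, (∫ ω, Qf b (Del g) (m u ω) ∂P) := by
  obtain ⟨C, hC0, h1, h2, h3⟩ := kp_bdds hG h hg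
  have e1 := mart_orth (kp_mart hG h hg) hst (Z := fun _ => 1) measurable_const (C := 1) (by simp)
  simp only [Mt_incr hG h hg hs hst, Mt, one_mul] at e1
  have mX := fun t => (kp_X_adp h hg.meas t).mono (𝓕.le t) le_rfl
  have mQ := kp_Q_meas hG h (meas_Del hg.meas)
  have I1 := fun t => int_bdd (P := P) (mX t) (h1 t)
  have I3 : Integrable (fun ω => ∫ u in s..t, Qf b (Del g) (m u ω)) P :=
    int_bdd (meas_ii (F := fun u ω => Qf b (Del g) (m u ω)) mQ hst)
      fun ω => ii_abs_le hst fun u _ => h2 u ω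
  have I12 : Integrable (fun ω => ∫ v, g v ∂(m t ω) - ∫ v, g v ∂(m s ω)) P := (I1 t).sub (I1 s)
  rw [integral_sub I12 I3, integral_sub (I1 t) (I1 s),
    fub (F := fun u ω => Qf b (Del g) (m u ω)) mQ hst (fun u _ ω => h2 u ω)] at e1
  linarith

lemma Mt_sq (hG : Good B b κ δ) (h : IsKacProcess B N P 𝓕 m) {g : Vd d → ℝ} (hg : LB g)
    {s t : ℝ} (hs : 0 ≤ s) (hst : s ≤ t) :
    ∫ ω, Mt b m s g t ω ^ 2 ∂P = (N:ℝ)⁻¹ * ∫ u in s..t, (∫ ω, Qf b (fun p => Del g p ^ 2) (m u ω) ∂P) := by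
  obtain ⟨C, hC0, h1, h2, h3⟩ := kp_bdds hG h hg
  have := sq_bracket (P := P) (𝓕 := 𝓕) (X := fun t ω => ∫ v, g v ∂(m t ω)) (q := fun t ω => Qf b (Del g) (m t ω))
    (γ := fun t ω => (N:ℝ)⁻¹ * Qf b (fun p => Del g p ^ 2) (m t ω))
    (kp_X_meas h hg.meas) (kp_Q_meas hG h (meas_Del hg.meas))
    ((kp_Q_meas hG h ((meas_Del hg.meas).pow_const 2)).const_mul _) h1 h2 h3
    (kp_X_adp h hg.meas) (kp_Q_adp hG h (meas_Del hg.meas)) (kp_mart hG h hg) (kp_mart2 hG h hg) hs hst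
  rw [show (∫ ω, Mt b m s g t ω ^ 2 ∂P) = _ from this, ← intervalIntegral.integral_const_mul]
  simp only [integral_const_mul]

lemma Mt_sub (hG : Good B b κ δ) (h : IsKacProcess B N P 𝓕 m) {g : Vd d → ℝ} (hg : LB g)
    {τ s t : ℝ} (hτ : 0 ≤ τ) (hs : τ ≤ s) (hst : s ≤ t) {A : Set Ω} (hA : MeasurableSet[𝓕 s] A) :
    ∫ ω in A, Mt b m τ g s ω ^ 2 ∂P ≤ ∫ ω in A, Mt b m τ g t ω ^ 2 ∂P := by
  obtain ⟨C1, hC1, c1⟩ := Mt_bdd hG h hg hs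
  obtain ⟨C2, hC2, c2⟩ := Mt_bdd hG h hg hst
  have a1 := Mt_adp hG h hg hτ hs
  have a2 := Mt_adp hG h hg (hτ.trans hs) hst
  have a1' := a1.mono (𝓕.le s) le_rfl
  have a2' := a2.mono (𝓕.le t) le_rfl
  have hA' := 𝓕.le s A hA
  have h0 : ∫ ω in A, Mt b m τ g s ω * Mt b m s g t ω ∂P = 0 := by
    have := mart_orth (kp_mart hG h hg) hst (Z := A.indicator (Mt b m τ g s)) (a1.indicator hA) (C := C1)
      (fun ω => by by_cases hω : ω ∈ A <;> simp [hω, c1, hC1])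
    simp only [Mt_incr hG h hg (hτ.trans hs) hst] at this
    rw [← integral_indicator hA', ← this]
    congr 1; ext ω
    by_cases hω : ω ∈ A <;> simp [hω]
  have I1 : Integrable (fun ω => Mt b m τ g s ω ^ 2) (P.restrict A) :=
    (int_bdd (a1'.pow_const 2) (C := C1 ^ 2) fun ω => by
      rw [abs_pow]; exact pow_le_pow_left₀ (abs_nonneg _) (c1 ω) 2).integrableOn
  have I2 : Integrable (fun ω => Mt b m s g t ω ^ 2) (P.restrict A) :=
    (int_bdd (a2'.pow_const 2) (C := C2 ^ 2) fun ω => by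
      rw [abs_pow]; exact pow_le_pow_left₀ (abs_nonneg _) (c2 ω) 2).integrableOn
  have I3 : Integrable (fun ω => Mt b m τ g s ω * Mt b m s g t ω) (P.restrict A) :=
    (int_bdd (a1'.mul a2') (C := C1 * C2) fun ω => by
      rw [Pi.mul_apply, abs_mul]; exact mul_le_mul (c1 ω) (c2 ω) (abs_nonneg _) hC1).integrableOn
  have I13 : Integrable (fun ω => Mt b m τ g s ω ^ 2 + 2 * (Mt b m τ g s ω * Mt b m s g t ω)) (P.restrict A) :=
    I1.add (I3.const_mul 2)
  have e : ∫ ω in A, Mt b m τ g t ω ^ 2 ∂P = ∫ ω in A, ((Mt b m τ g s ω ^ 2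
      + 2 * (Mt b m τ g s ω * Mt b m s g t ω)) + Mt b m s g t ω ^ 2) ∂P := by
    congr 1; ext ω; rw [Mt_add hG h hg τ s t ω]; ring
  rw [e, integral_add I13 I2, integral_add I1 (I3.const_mul 2), integral_const_mul, h0]
  have : 0 ≤ ∫ ω in A, Mt b m s g t ω ^ 2 ∂P := integral_nonneg fun ω => sq_nonneg _
  linarith

end partP


section partF

lemma ode_mom (n : ℕ) {δ D T : ℝ} (hδ : 0 < δ) (hD : 0 ≤ D) (hT : 0 < T) :
    ∃ C, 0 ≤ C ∧ ∀ φ ψ χ : ℝ → ℝ, (∀ a b, IntervalIntegrable χ volume a b) →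
      (∀ t, 0 ≤ t → φ t = φ 0 + ∫ u in (0:ℝ)..t, χ u) →
      (∀ t, χ t ≤ -2 * δ * ψ t + 4 * D * φ t + 4 * D) →
      (∀ t β, 0 < β → φ t ≤ β * ψ t + (β⁻¹) ^ n) →
      ∀ t, 0 < t → t ≤ T → t ^ (n + 1) * φ t ≤ C * t := by
  set k : ℝ := n + 1 with hk
  have hk0 : 0 < k := by positivity
  set A : ℝ := k + 4 * D * T with hA
  have hA0 : 0 < A := by positivity
  set β0 : ℝ := 2 * δ / A with hβ0
  have hβ : 0 < β0 := by positivity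
  refine ⟨A * (β0⁻¹) ^ n + 4 * D * T ^ (n + 1), by positivity, ?_⟩
  intro φ ψ χ hχ hφ h1 h2 t ht htT
  set C := A * (β0⁻¹) ^ n + 4 * D * T ^ (n + 1)
  have key : ∀ r ∈ Set.Ioo 0 t, k * r ^ n * (φ r) + r ^ (n + 1) * χ r ≤ C := by
    intro r hr
    have hr0 : 0 < r := hr.1
    have hrT : r ≤ T := hr.2.le.trans htT
    have e1 := h2 r (2 * δ * r / (k + 4 * D * r)) (by positivity)
    have hB : 0 < k + 4 * D * r := by positivity
    have hBA : k + 4 * D * r ≤ A := by rw [hA]; gcongr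
    have e2 : (k + 4 * D * r) * φ r ≤ 2 * δ * r * ψ r
        + (k + 4 * D * r) * ((2 * δ * r / (k + 4 * D * r))⁻¹) ^ n := by
      have := mul_le_mul_of_nonneg_left e1 hB.le
      refine this.trans (le_of_eq ?_)
      field_simp
    have e3 : (2 * δ * r / (k + 4 * D * r))⁻¹ ≤ β0⁻¹ * r⁻¹ := by
      rw [hβ0, inv_div, inv_div, ← div_eq_mul_inv, div_div]
      gcongr
    have e4 : (k + 4 * D * r) * ((2 * δ * r / (k + 4 * D * r))⁻¹) ^ n ≤ A * (β0⁻¹ * r⁻¹) ^ n := by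
      gcongr
    have e5 : k * φ r + r * χ r ≤ A * (β0⁻¹ * r⁻¹) ^ n + 4 * D * r := by
      have := mul_le_mul_of_nonneg_left (h1 r) hr0.le
      nlinarith
    have e6 := mul_le_mul_of_nonneg_left e5 (pow_nonneg hr0.le n)
    have e7 : r ^ n * (A * (β0⁻¹ * r⁻¹) ^ n + 4 * D * r) = A * (β0⁻¹) ^ n + 4 * D * r ^ (n + 1) := by
      rw [mul_pow, mul_add, inv_pow r]; field_simp; ring
    rw [e7] at e6
    have e8 : 4 * D * r ^ (n + 1) ≤ 4 * D * T ^ (n + 1) := by gcongr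
    calc _ = r ^ n * (k * φ r + r * χ r) := by ring
      _ ≤ _ := e6.trans (by simp only [C]; linarith)
  have hα : ∀ a b, IntervalIntegrable (fun r : ℝ => k * r ^ n) volume a b := fun a b =>
    Continuous.intervalIntegrable (by fun_prop) a b
  have iα : ∀ s : ℝ, (∫ u in (0:ℝ)..s, k * u ^ n) = s ^ (n + 1) := fun s => by
    rw [intervalIntegral.integral_const_mul, integral_pow, zero_pow (by omega), sub_zero, hk]; field_simp
  have e := ibp (hα 0 t) (hχ 0 t)
  simp only [iα] at e
  have cχ : Continuous fun r => ∫ u in (0:ℝ)..r, χ u := intervalIntegral.continuous_primitive hχ 0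
  have J1 : IntervalIntegrable (fun r => k * r ^ n * (∫ u in (0:ℝ)..r, χ u) + r ^ (n + 1) * χ r) volume 0 t := by
    refine IntervalIntegrable.add (Continuous.intervalIntegrable (by fun_prop) _ _) ?_
    exact (hχ 0 t).continuousOn_mul (by fun_prop)
  have J2 : IntervalIntegrable (fun r => k * r ^ n * φ 0) volume 0 t := (hα 0 t).mul_const _
  have e2 : t ^ (n + 1) * φ t = ∫ r in (0:ℝ)..t, ((k * r ^ n * (∫ u in (0:ℝ)..r, χ u) + r ^ (n + 1) * χ r)
      + k * r ^ n * φ 0) := by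
    rw [intervalIntegral.integral_add J1 J2, ← e, intervalIntegral.integral_mul_const, iα, hφ t ht.le]; ring
  rw [e2]
  calc _ ≤ ∫ r in (0:ℝ)..t, C := by
        refine intervalIntegral.integral_mono_on_of_le_Ioo ht.le (J1.add J2) (by simp) fun r hr => ?_
        refine le_trans (le_of_eq ?_) (key r hr)
        rw [hφ r hr.1.le]; ring
    _ = C * t := by simp; ring

lemma pow_split (q : ℕ) {x y : ℝ} (hx : 0 ≤ x) (hy : 0 ≤ y) :
    (x + y) ^ (q + 2) ≤ x ^ (q + 2) + y ^ (q + 2) + 4 ^ q * (x ^ (q + 1) * y + x * y ^ (q + 1)) := by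
  induction q with
  | zero => simp only [zero_add, pow_zero, one_mul, pow_one]; nlinarith
  | succ q ih =>
    have h4 : (1:ℝ) ≤ 4 ^ q := one_le_pow₀ (by norm_num)
    have e1 : x ^ 2 * y ^ (q + 1) + x ^ (q + 1) * y ^ 2 ≤ 2 * (x ^ (q + 2) * y + x * y ^ (q + 2)) := by
      rcases le_total x y with h | h
      · have a1 : x ^ 2 * y ^ (q + 1) ≤ x * y ^ (q + 2) := by
          have : x * (x * y ^ (q + 1)) ≤ x * (y * y ^ (q + 1)) := by gcongr
          calc _ = x * (x * y ^ (q + 1)) := by ring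
            _ ≤ _ := this
            _ = _ := by ring
        have a2 : x ^ (q + 1) * y ^ 2 ≤ x * y ^ (q + 2) := by
          have : x ^ q * (x * y ^ 2) ≤ y ^ q * (x * y ^ 2) := by gcongr
          calc _ = x ^ q * (x * y ^ 2) := by ring
            _ ≤ _ := this
            _ = _ := by ring
        have : 0 ≤ x ^ (q + 2) * y := by positivity
        linarith
      · have a1 : x ^ (q + 1) * y ^ 2 ≤ x ^ (q + 2) * y := by
          have : y * (y * x ^ (q + 1)) ≤ y * (x * x ^ (q + 1)) := by gcongr
          calc _ = y * (y * x ^ (q + 1)) := by ring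
            _ ≤ _ := this
            _ = _ := by ring
        have a2 : x ^ 2 * y ^ (q + 1) ≤ x ^ (q + 2) * y := by
          have : y ^ q * (y * x ^ 2) ≤ x ^ q * (y * x ^ 2) := by gcongr
          calc _ = y ^ q * (y * x ^ 2) := by ring
            _ ≤ _ := this
            _ = _ := by ring
        have : 0 ≤ x * y ^ (q + 2) := by positivity
        linarith
    have e2 := mul_le_mul_of_nonneg_left ih (add_nonneg hx hy)
    have e3 := mul_le_mul_of_nonneg_left e1 (by positivity : (0:ℝ) ≤ 4 ^ q)
    have p1 : 0 ≤ x ^ (q + 2) * y := by positivity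
    have p2 : 0 ≤ x * y ^ (q + 2) := by positivity
    have e4 : x ^ (q + 2) * y + x * y ^ (q + 2) ≤ 4 ^ q * (x ^ (q + 2) * y + x * y ^ (q + 2)) := by
      nlinarith
    calc (x + y) ^ (q + 1 + 2) = (x + y) * (x + y) ^ (q + 2) := by ring
      _ ≤ _ := e2
      _ = x ^ (q + 3) + y ^ (q + 3) + (x ^ (q + 2) * y + x * y ^ (q + 2))
          + 4 ^ q * (x ^ (q + 2) * y + x * y ^ (q + 2)) + 4 ^ q * (x ^ 2 * y ^ (q + 1) + x ^ (q + 1) * y ^ 2) := by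
            ring
      _ ≤ _ := by
          have : (4:ℝ) ^ (q + 1) = 4 * 4 ^ q := by ring
          rw [this]
          have e5 : x ^ (q + 1 + 2) = x ^ (q + 3) := by ring
          have e6 : y ^ (q + 1 + 2) = y ^ (q + 3) := by ring
          have e7 : x ^ (q + 1 + 1) = x ^ (q + 2) := by ring
          have e8 : y ^ (q + 1 + 1) = y ^ (q + 2) := by ring
          rw [e5, e6, e7, e8]
          linarith

variable {d N : ℕ} {B : Vd d → Measure (Vd d)} {b : Kernel (Vd d × Vd d) (Vd d)} {κ δ : ℝ}

lemma povz_int (hG : Good B b κ δ) (q : ℕ) {v vs : Vd d} (hne : v ≠ vs) :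
    ∫ σ, Del (fun v => ‖v‖ ^ (2 * (q + 2))) ((v, vs), σ) ∂(b (v, vs))
      ≤ (1 - δ) * (‖v‖ ^ 2 + ‖vs‖ ^ 2) ^ (q + 2) - (‖v‖ ^ 2) ^ (q + 2) - (‖vs‖ ^ 2) ^ (q + 2) := by
  have := hG.markov
  set E := ‖v‖ ^ 2 + ‖vs‖ ^ 2 with hE
  have hE0 : 0 ≤ E := by positivity
  have iI : Integrable (fun σ => (inner ℝ (v + vs) σ) ^ 2) (b (v, vs)) := by
    refine int_sph hG (h := fun p => (inner ℝ (p.1.1 + p.1.2) p.2) ^ 2) (by fun_prop) (K := ‖v + vs‖ ^ 2)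
      fun σ hσ => ?_
    have := abs_real_inner_le_norm (v + vs) σ
    rw [hσ, mul_one] at this
    simp only [abs_pow]
    gcongr
  have pt : ∀ᵐ σ ∂(b (v, vs)), Del (fun v => ‖v‖ ^ (2 * (q + 2))) ((v, vs), σ)
      ≤ (E ^ 2 / 2 * E ^ q - (‖v‖ ^ 2) ^ (q + 2) - (‖vs‖ ^ 2) ^ (q + 2))
        + (E ^ q * ‖v - vs‖ ^ 2 / 2) * (inner ℝ (v + vs) σ) ^ 2 := by
    filter_upwards [hG.sph (v, vs)] with σ hσ
    obtain ⟨s1, s2⟩ := post_sq v vs σ hσ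
    have s3 := post_energy v vs σ hσ
    simp only [Del, pow_mul]
    set X := ‖postV v vs σ‖ ^ 2
    set Y := ‖postVs v vs σ‖ ^ 2
    have hX : 0 ≤ X := by positivity
    have hY : 0 ≤ Y := by positivity
    have hXE : X ≤ E := by rw [hE]; linarith
    have hYE : Y ≤ E := by rw [hE]; linarith
    have b1 : X ^ (q + 2) ≤ E ^ q * X ^ 2 := by rw [pow_add]; gcongr
    have b2 : Y ^ (q + 2) ≤ E ^ q * Y ^ 2 := by rw [pow_add]; gcongr
    have b3 : E ^ q * X ^ 2 + E ^ q * Y ^ 2 = E ^ 2 / 2 * E ^ q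
        + (E ^ q * ‖v - vs‖ ^ 2 / 2) * (inner ℝ (v + vs) σ) ^ 2 := by
      rw [s1, s2]; simp only [hE]; ring
    linarith
  have i1 : Integrable (fun σ => Del (fun v => ‖v‖ ^ (2 * (q + 2))) ((v, vs), σ)) (b (v, vs)) := by
    refine int_sph hG (meas_Del (by fun_prop)) (K := 4 * (2 * (‖v‖ + ‖vs‖)) ^ (2 * (q + 2))) fun σ hσ => ?_
    refine del_bdd (R := ‖v‖ + ‖vs‖) (fun w hw => ?_) hσ (by linarith [norm_nonneg vs]) (by linarith [norm_nonneg v])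
    rw [abs_of_nonneg (by positivity)]
    gcongr
  refine (integral_mono_ae i1 ((integrable_const _).add (iI.const_mul _)) pt).trans ?_
  simp only [Pi.add_apply]
  rw [integral_add (integrable_const _) (iI.const_mul _), integral_const_mul]
  simp only [integral_const, probReal_univ, smul_eq_mul, one_mul]
  have p1 := hG.pov v vs (v + vs) hne
  have p2 : ‖v - vs‖ ^ 2 * ‖v + vs‖ ^ 2 ≤ E ^ 2 := by
    have := parallelogram_law_with_norm ℝ v vs
    have h2 : ‖v + vs‖ ^ 2 + ‖v - vs‖ ^ 2 = 2 * E := by rw [hE]; nlinarith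
    nlinarith [sq_nonneg (‖v + vs‖ ^ 2 - ‖v - vs‖ ^ 2)]
  have p0 : 0 ≤ ∫ σ, (inner ℝ (v + vs) σ) ^ 2 ∂(b (v, vs)) := integral_nonneg fun σ => sq_nonneg _
  have p4 : 0 ≤ 1 - 2 * δ := by
    have h1 := hG.pov v vs (v - vs) hne
    have h0 : 0 ≤ ∫ σ, (inner ℝ (v - vs) σ) ^ 2 ∂(b (v, vs)) := integral_nonneg fun σ => sq_nonneg _
    have h2 : 0 < ‖v - vs‖ ^ 2 := by have := norm_pos_iff.2 (sub_ne_zero.2 hne); positivity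
    by_contra hc
    push Not at hc
    nlinarith
  have p3 : ‖v - vs‖ ^ 2 * ∫ σ, (inner ℝ (v + vs) σ) ^ 2 ∂(b (v, vs)) ≤ (1 - 2 * δ) * E ^ 2 := by
    calc _ ≤ ‖v - vs‖ ^ 2 * ((1 - 2 * δ) * ‖v + vs‖ ^ 2) := by gcongr
      _ = (1 - 2 * δ) * (‖v - vs‖ ^ 2 * ‖v + vs‖ ^ 2) := by ring
      _ ≤ _ := by gcongr
  have p5 := mul_le_mul_of_nonneg_left p3 (by positivity : 0 ≤ E ^ q / 2)
  have p6 : E ^ (q + 2) = E ^ q * E ^ 2 := pow_add _ _ _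
  rw [p6]
  nlinarith

lemma povz (hG : Good B b κ δ) (q : ℕ) (v vs : Vd d) :
    Ab b (Del (fun v => ‖v‖ ^ (2 * (q + 2)))) v vs ≤
      -δ * (‖v‖ ^ (2 * q + 5) + ‖vs‖ ^ (2 * q + 5)) + (δ + 3 * 4 ^ q) *
        ((‖v‖ ^ (2 * q + 4) + 1) * (‖vs‖ ^ 2 + 1) + (‖v‖ ^ 2 + 1) * (‖vs‖ ^ (2 * q + 4) + 1)) := by
  have hδ := hG.δ0
  have hδ1 := hG.δ1
  by_cases hne : v = vs
  · subst hne
    have h1 : ∀ x : ℝ, 0 ≤ x → x ^ (2 * q + 5) ≤ (x ^ (2 * q + 4) + 1) * (x ^ 2 + 1) := by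
      intro x hx
      have : x ≤ x ^ 2 + 1 := by nlinarith
      calc x ^ (2 * q + 5) = x ^ (2 * q + 4) * x := by ring
        _ ≤ (x ^ (2 * q + 4) + 1) * (x ^ 2 + 1) := by gcongr; linarith
    have h2 := h1 ‖v‖ (norm_nonneg v)
    have h3 : 0 ≤ (‖v‖ ^ (2 * q + 4) + 1) * (‖v‖ ^ 2 + 1) := by positivity
    have h4 : (0:ℝ) ≤ 3 * 4 ^ q * ((‖v‖ ^ (2 * q + 4) + 1) * (‖v‖ ^ 2 + 1)) := by positivity
    simp only [Ab, sub_self, norm_zero, zero_mul]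
    nlinarith
  · have e1 := povz_int hG q hne
    set a := ‖v‖ with ha
    set c := ‖vs‖ with hc
    have a0 : 0 ≤ a := norm_nonneg _
    have c0 : 0 ≤ c := norm_nonneg _
    have e2 := pow_split q (sq_nonneg a) (sq_nonneg c)
    set r := ‖v - vs‖ with hr
    have r0 : 0 ≤ r := norm_nonneg _
    have r1 : r ≤ a + c := norm_sub_le _ _
    have r2 : a - c ≤ r := norm_sub_norm_le _ _
    have r3 : c - a ≤ r := by rw [hr, norm_sub_rev]; exact norm_sub_norm_le _ _
    have Z0 : 0 ≤ (a ^ 2) ^ (q + 1) * c ^ 2 + a ^ 2 * (c ^ 2) ^ (q + 1) := by positivity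
    have e3 : ∫ σ, Del (fun v => ‖v‖ ^ (2 * (q + 2))) ((v, vs), σ) ∂(b (v, vs))
      ≤ -δ * ((a ^ 2) ^ (q + 2) + (c ^ 2) ^ (q + 2))
        + 4 ^ q * ((a ^ 2) ^ (q + 1) * c ^ 2 + a ^ 2 * (c ^ 2) ^ (q + 1)) := by
      have := mul_le_mul_of_nonneg_left e2 (by linarith : 0 ≤ 1 - δ)
      have h2 : (0:ℝ) ≤ δ * (4 ^ q * ((a ^ 2) ^ (q + 1) * c ^ 2 + a ^ 2 * (c ^ 2) ^ (q + 1))) := by positivity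
      nlinarith
    have e4 := mul_le_mul_of_nonneg_left e3 r0
    have f1 : a ^ (2 * q + 5) - a ^ (2 * q + 4) * c ≤ r * (a ^ 2) ^ (q + 2) := by
      have := mul_le_mul_of_nonneg_right r2 (by positivity : 0 ≤ (a ^ 2) ^ (q + 2))
      refine le_trans (le_of_eq ?_) this
      ring
    have f2 : c ^ (2 * q + 5) - c ^ (2 * q + 4) * a ≤ r * (c ^ 2) ^ (q + 2) := by
      have := mul_le_mul_of_nonneg_right r3 (by positivity : 0 ≤ (c ^ 2) ^ (q + 2))
      refine le_trans (le_of_eq ?_) this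
      ring
    have g1 : ∀ x y : ℝ, 0 ≤ x → 0 ≤ y → (x ^ 2) ^ (q + 1) * y ^ 3 ≤ x ^ (2 * q + 3) * y ^ 2 + x ^ 2 * y ^ (2 * q + 3) := by
      intro x y hx hy
      rcases le_total x y with h | h
      · have : x ^ (2 * q) * (x ^ 2 * y ^ 3) ≤ y ^ (2 * q) * (x ^ 2 * y ^ 3) := by gcongr
        have h2 : 0 ≤ x ^ (2 * q + 3) * y ^ 2 := by positivity
        calc _ = x ^ (2 * q) * (x ^ 2 * y ^ 3) := by ring
          _ ≤ _ := this
          _ = x ^ 2 * y ^ (2 * q + 3) := by ring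
          _ ≤ _ := by linarith
      · have : y * (y ^ 2 * x ^ (2 * q + 2)) ≤ x * (y ^ 2 * x ^ (2 * q + 2)) := by gcongr
        have h2 : 0 ≤ x ^ 2 * y ^ (2 * q + 3) := by positivity
        calc _ = y * (y ^ 2 * x ^ (2 * q + 2)) := by ring
          _ ≤ _ := this
          _ = x ^ (2 * q + 3) * y ^ 2 := by ring
          _ ≤ _ := by linarith
    have f3 : r * ((a ^ 2) ^ (q + 1) * c ^ 2 + a ^ 2 * (c ^ 2) ^ (q + 1))
        ≤ 3 * (a ^ (2 * q + 3) * c ^ 2 + a ^ 2 * c ^ (2 * q + 3)) := by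
      calc _ ≤ (a + c) * ((a ^ 2) ^ (q + 1) * c ^ 2 + a ^ 2 * (c ^ 2) ^ (q + 1)) := by gcongr
        _ = a ^ (2 * q + 3) * c ^ 2 + a ^ 2 * c ^ (2 * q + 3) + (a ^ 2) ^ (q + 1) * c ^ 3
            + (c ^ 2) ^ (q + 1) * a ^ 3 := by ring
        _ ≤ _ := by have := g1 a c a0 c0; have := g1 c a c0 a0; linarith
    have g2 : ∀ x : ℝ, 0 ≤ x → x ^ (2 * q + 3) ≤ x ^ (2 * q + 4) + 1 := by
      intro x hx
      rcases le_total x 1 with h | h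
      · have h1 := pow_le_one₀ (n := 2 * q + 3) hx h
        have : 0 ≤ x ^ (2 * q + 4) := by positivity
        linarith
      · have := pow_le_pow_right₀ h (by omega : 2 * q + 3 ≤ 2 * q + 4)
        linarith
    have g3 : ∀ x : ℝ, x ≤ x ^ 2 + 1 := fun x => by nlinarith
    have f4 : a ^ (2 * q + 3) * c ^ 2 ≤ (a ^ (2 * q + 4) + 1) * (c ^ 2 + 1) := by
      have := g2 a a0; gcongr; linarith
    have f5 : a ^ 2 * c ^ (2 * q + 3) ≤ (a ^ 2 + 1) * (c ^ (2 * q + 4) + 1) := by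
      have := g2 c c0; gcongr; linarith
    have f6 : a ^ (2 * q + 4) * c ≤ (a ^ (2 * q + 4) + 1) * (c ^ 2 + 1) := by
      have := g3 c; gcongr; linarith
    have f7 : c ^ (2 * q + 4) * a ≤ (a ^ 2 + 1) * (c ^ (2 * q + 4) + 1) := by
      rw [mul_comm]; have := g3 a; gcongr; linarith
    have f8 := mul_le_mul_of_nonneg_left (f3.trans (mul_le_mul_of_nonneg_left (add_le_add f4 f5) (by norm_num)))
      (by positivity : (0:ℝ) ≤ 4 ^ q)
    have f9 := mul_le_mul_of_nonneg_left (add_le_add f1 f2) hδ.le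
    have f10 := mul_le_mul_of_nonneg_left (add_le_add f6 f7) hδ.le
    rw [Ab]
    nlinarith

end partF


section partM

variable {d N : ℕ} {B : Vd d → Measure (Vd d)} {b : Kernel (Vd d × Vd d) (Vd d)} {κ δ : ℝ}

lemma LB_cont {g : Vd d → ℝ} (hg : Continuous g) : LB g := by
  refine ⟨hg.measurable, fun D => ?_⟩
  obtain ⟨K, hK⟩ := (isCompact_closedBall (0 : Vd d) D).exists_bound_of_continuousOn hg.continuousOn
  refine ⟨max K 0, le_max_right _ _, fun v hv => (hK v (by simpa using hv)).trans (le_max_left _ _)⟩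

lemma young {x β : ℝ} (hx : 0 ≤ x) (hβ : 0 < β) (n : ℕ) :
    x ^ (n + 2) ≤ β * x ^ (n + 3) + (β⁻¹) ^ n * x ^ 2 := by
  rcases le_total 1 (β * x) with h | h
  · have h1 : 1 * x ^ (n + 2) ≤ (β * x) * x ^ (n + 2) := by gcongr
    have h2 : 0 ≤ (β⁻¹) ^ n * x ^ 2 := by positivity
    calc _ = 1 * x ^ (n + 2) := by ring
      _ ≤ _ := h1
      _ = β * x ^ (n + 3) := by ring
      _ ≤ _ := by linarith
  · have h0 : x ≤ β⁻¹ := by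
      rw [← one_div, le_div_iff₀ hβ]; linarith
    have h1 : x ^ n * x ^ 2 ≤ (β⁻¹) ^ n * x ^ 2 := by gcongr
    have h2 : 0 ≤ β * x ^ (n + 3) := by positivity
    calc _ = x ^ n * x ^ 2 := by ring
      _ ≤ _ := by linarith

lemma emp_mono {R : ℝ} {μ : Measure (Vd d)} (h : Emp R μ) {f g : Vd d → ℝ}
    (hfg : ∀ v, f v ≤ g v) : ∫ v, f v ∂μ ≤ ∫ v, g v ∂μ :=
  integral_mono (h.int f) (h.int g) hfg

lemma emp_Q_mom (hG : Good B b κ δ) (q : ℕ) {μ : Measure (Vd d)} (h : μ ∈ empiricalSphere d N) :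
    Qf b (Del (fun v => ‖v‖ ^ (2 * (q + 2)))) μ ≤ -2 * δ * ∫ v, ‖v‖ ^ (2 * q + 5) ∂μ
      + 4 * (δ + 3 * 4 ^ q) * ∫ v, ‖v‖ ^ (2 * q + 4) ∂μ + 4 * (δ + 3 * 4 ^ q) := by
  have hE := emp_of_mem h
  have := hE.prob
  have h2 : ∫ v, ‖v‖ ^ 2 ∂μ = 1 := h.1.2.2
  refine (Qf_le hE _ _ fun v vs _ _ => povz hG q v vs).trans (le_of_eq ?_)
  set D := δ + 3 * 4 ^ q
  set S := ∫ v, ‖v‖ ^ (2 * q + 5) ∂μ with hS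
  set M := ∫ v, ‖v‖ ^ (2 * q + 4) ∂μ with hM
  have I := hE.int
  have in1 : ∀ v : Vd d, ∫ vs : Vd d, (-δ * (‖v‖ ^ (2 * q + 5) + ‖vs‖ ^ (2 * q + 5)) + D *
        ((‖v‖ ^ (2 * q + 4) + 1) * (‖vs‖ ^ 2 + 1) + (‖v‖ ^ 2 + 1) * (‖vs‖ ^ (2 * q + 4) + 1))) ∂μ
      = -δ * (‖v‖ ^ (2 * q + 5) + S) + D * ((‖v‖ ^ (2 * q + 4) + 1) * 2 + (‖v‖ ^ 2 + 1) * (M + 1)) := by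
    intro v
    rw [integral_add (I _) (I _), integral_const_mul, integral_const_mul, integral_add (I _) (I _),
      integral_add (I _) (I _), integral_const_mul, integral_const_mul, integral_add (I _) (I _),
      integral_add (I _) (I _), h2, ← hS, ← hM]
    simp only [integral_const, probReal_univ, smul_eq_mul, one_mul]
    ring
  simp only [in1]
  rw [integral_add (I _) (I _), integral_const_mul, integral_const_mul, integral_add (I _) (I _),
      integral_add (I _) (I _), integral_mul_const, integral_mul_const, integral_add (I _) (I _),
      integral_add (I _) (I _), h2, ← hS, ← hM]
  simp only [integral_const, probReal_univ, smul_eq_mul, one_mul]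
  ring

lemma mom0 (hG : Good B b κ δ) (q : ℕ) {τ T : ℝ} (hτ : 0 < τ) (hτT : τ ≤ T) : ∃ C, 0 ≤ C ∧
    ∀ (Ω : Type) (m0 : MeasurableSpace Ω) (P : Measure Ω), IsProbabilityMeasure P →
      ∀ (𝓕 : Filtration ℝ m0) (N : ℕ) (m : ℝ → Ω → Measure (Vd d)), IsKacProcess B N P 𝓕 m →
      ∀ t, τ ≤ t → t ≤ T → ∫ ω, (∫ v, ‖v‖ ^ (2 * q + 4) ∂(m t ω)) ∂P ≤ C := by
  have hδ := hG.δ0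
  obtain ⟨C, hC0, hC⟩ := ode_mom (2 * q + 2) (D := δ + 3 * 4 ^ q) hδ (by positivity) (hτ.trans_le hτT)
  refine ⟨C * T / τ ^ (2 * q + 3), by have := hτ.trans_le hτT; positivity, ?_⟩
  intro Ω m0 P hP 𝓕 N m h t h1 h2
  have g1 : LB (fun v : Vd d => ‖v‖ ^ (2 * q + 4)) := LB_cont (by fun_prop)
  have g2 : LB (fun v : Vd d => ‖v‖ ^ (2 * q + 5)) := LB_cont (by fun_prop)
  obtain ⟨C1, _, b1, b2, _⟩ := kp_bdds hG h g1
  obtain ⟨C2, _, b3, b4, _⟩ := kp_bdds hG h g2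
  have J1 := fun t => int_bdd (P := P) ((kp_X_adp h g1.meas t).mono (𝓕.le t) le_rfl) (b1 t)
  have J2 := fun t => int_bdd (P := P) ((kp_X_adp h g2.meas t).mono (𝓕.le t) le_rfl) (b3 t)
  have J3 := fun t => int_bdd (P := P) ((kp_Q_adp hG h (meas_Del g1.meas) t).mono (𝓕.le t) le_rfl) (b2 t)
  have := hC (fun t => ∫ ω, (∫ v, ‖v‖ ^ (2 * q + 4) ∂(m t ω)) ∂P)
    (fun t => ∫ ω, (∫ v, ‖v‖ ^ (2 * q + 5) ∂(m t ω)) ∂P)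
    (fun t => ∫ ω, Qf b (Del (fun v => ‖v‖ ^ (2 * q + 4))) (m t ω) ∂P) ?_ ?_ ?_ ?_ t (hτ.trans_le h1) h2
  · have ht := hτ.trans_le h1
    set φ := ∫ ω, (∫ v, ‖v‖ ^ (2 * q + 4) ∂(m t ω)) ∂P with hφ
    have hφ0 : 0 ≤ φ := integral_nonneg fun ω => integral_nonneg fun v => by positivity
    rw [le_div_iff₀ (by positivity)]
    calc φ * τ ^ (2 * q + 3) ≤ φ * t ^ (2 * q + 3) := by gcongr
      _ = t ^ (2 * q + 2 + 1) * φ := by ring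
      _ ≤ C * t := this
      _ ≤ C * T := by gcongr
  · intro a c
    exact ii_bdd' (meas_E (F := fun t ω => Qf b (Del (fun v => ‖v‖ ^ (2 * q + 4))) (m t ω))
      (kp_Q_meas hG h (meas_Del g1.meas))) (fun t => E_abs_le (b2 t)) a c
  · intro t ht
    exact kp_exp hG h g1 le_rfl ht
  · intro t
    have e : ∀ ω, Qf b (Del (fun v => ‖v‖ ^ (2 * q + 4))) (m t ω) ≤ -2 * δ * ∫ v, ‖v‖ ^ (2 * q + 5) ∂(m t ω)
      + 4 * (δ + 3 * 4 ^ q) * ∫ v, ‖v‖ ^ (2 * q + 4) ∂(m t ω) + 4 * (δ + 3 * 4 ^ q) :=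
      fun ω => emp_Q_mom hG q (h.mem t ω)
    have J5 : Integrable (fun ω => -2 * δ * ∫ v, ‖v‖ ^ (2 * q + 5) ∂(m t ω)
      + 4 * (δ + 3 * 4 ^ q) * ∫ v, ‖v‖ ^ (2 * q + 4) ∂(m t ω)) P := ((J2 t).const_mul _).add ((J1 t).const_mul _)
    refine (integral_mono (J3 t) (J5.add (integrable_const _)) e).trans (le_of_eq ?_)
    simp only [Pi.add_apply]
    rw [integral_add J5 (integrable_const _), integral_add ((J2 t).const_mul _) ((J1 t).const_mul _),
      integral_const_mul, integral_const_mul]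
    simp
  · intro t β hβ
    have e : ∀ ω, ∫ v, ‖v‖ ^ (2 * q + 4) ∂(m t ω) ≤ β * ∫ v, ‖v‖ ^ (2 * q + 5) ∂(m t ω) + (β⁻¹) ^ (2 * q + 2) := by
      intro ω
      have hE := emp_of_mem (h.mem t ω)
      have h2 : ∫ v, ‖v‖ ^ 2 ∂(m t ω) = 1 := (h.mem t ω).1.2.2
      refine (emp_mono hE fun v => young (norm_nonneg v) hβ (2 * q + 2)).trans (le_of_eq ?_)
      rw [integral_add (hE.int _) (hE.int _), integral_const_mul, integral_const_mul, h2, mul_one]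
    refine (integral_mono (J1 t) (((J2 t).const_mul _).add (integrable_const _)) e).trans (le_of_eq ?_)
    simp only [Pi.add_apply]
    rw [integral_add ((J2 t).const_mul _) (integrable_const _), integral_const_mul]
    simp

lemma wt_pow_le (p : ℕ) (v : Vd d) : wt v ^ p ≤ 2 ^ p * (2 + ‖v‖ ^ (2 * p + 4)) := by
  rw [wt]
  have h0 := norm_nonneg v
  rcases le_total ‖v‖ 1 with h | h
  · have h1 : 1 + ‖v‖ ^ 2 ≤ 2 := by nlinarith
    have h2 : (0:ℝ) ≤ ‖v‖ ^ (2 * p + 4) := by positivity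
    calc (1 + ‖v‖ ^ 2) ^ p ≤ 2 ^ p := by gcongr
      _ ≤ 2 ^ p * (2 + ‖v‖ ^ (2 * p + 4)) := le_mul_of_one_le_right (by positivity) (by linarith)
  · have h1 : 1 + ‖v‖ ^ 2 ≤ 2 * ‖v‖ ^ 2 := by nlinarith
    have h2 : ‖v‖ ^ (2 * p) ≤ ‖v‖ ^ (2 * p + 4) := pow_le_pow_right₀ h (by omega)
    calc (1 + ‖v‖ ^ 2) ^ p ≤ (2 * ‖v‖ ^ 2) ^ p := by gcongr
      _ = 2 ^ p * ‖v‖ ^ (2 * p) := by rw [mul_pow, pow_mul]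
      _ ≤ _ := by gcongr; linarith

def Mo (p : ℕ) (μ : Measure (Vd d)) : ℝ := ∫ v, wt v ^ p ∂μ

lemma LB_wt (p : ℕ) : LB (fun v : Vd d => wt v ^ p) := LB_cont (cont_wt.pow p)

lemma mom1 (hG : Good B b κ δ) (p : ℕ) {τ T : ℝ} (hτ : 0 < τ) (hτT : τ ≤ T) : ∃ C, 0 ≤ C ∧
    ∀ (Ω : Type) (m0 : MeasurableSpace Ω) (P : Measure Ω), IsProbabilityMeasure P →
      ∀ (𝓕 : Filtration ℝ m0) (N : ℕ) (m : ℝ → Ω → Measure (Vd d)), IsKacProcess B N P 𝓕 m →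
      ∀ t, τ ≤ t → t ≤ T → ∫ ω, Mo p (m t ω) ∂P ≤ C := by
  obtain ⟨C, hC0, hC⟩ := mom0 hG p hτ hτT
  refine ⟨2 ^ p * (2 + C), by positivity, ?_⟩
  intro Ω m0 P hP 𝓕 N m h t h1 h2
  have g1 : LB (fun v : Vd d => ‖v‖ ^ (2 * p + 4)) := LB_cont (by fun_prop)
  obtain ⟨C1, _, b1, b2, _⟩ := kp_bdds hG h g1
  obtain ⟨C2, _, b3, b4, _⟩ := kp_bdds hG h (LB_wt p)
  have J1 := fun t => int_bdd (P := P) ((kp_X_adp h g1.meas t).mono (𝓕.le t) le_rfl) (b1 t)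
  have J2 := fun t => int_bdd (P := P) ((kp_X_adp h (LB_wt p).meas t).mono (𝓕.le t) le_rfl) (b3 t)
  have e : ∀ ω, ∫ v, wt v ^ p ∂(m t ω) ≤ 2 ^ p * (2 + ∫ v, ‖v‖ ^ (2 * p + 4) ∂(m t ω)) := by
    intro ω
    have hE := emp_of_mem (h.mem t ω)
    have := hE.prob
    refine (emp_mono hE fun v => wt_pow_le p v).trans (le_of_eq ?_)
    rw [integral_const_mul, integral_add (hE.int _) (hE.int _)]
    simp
  refine (integral_mono (J2 t) (((integrable_const _).add (J1 t)).const_mul _) e).trans ?_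
  simp only [Pi.add_apply]
  rw [integral_const_mul, integral_add (integrable_const _) (J1 t)]
  simp only [integral_const, probReal_univ, smul_eq_mul, one_mul]
  gcongr
  exact hC Ω m0 P hP 𝓕 N m h t h1 h2

end partM


section partQ

variable {d N : ℕ} {B : Vd d → Measure (Vd d)} {b : Kernel (Vd d × Vd d) (Vd d)} {κ δ : ℝ}

lemma Mo_nonneg (p : ℕ) (μ : Measure (Vd d)) : 0 ≤ Mo p μ :=
  integral_nonneg fun v => pow_nonneg (wt_pos v).le p

lemma Mo_sq {R : ℝ} {μ : Measure (Vd d)} (hE : Emp R μ) (p : ℕ) : Mo p μ ^ 2 ≤ Mo (2 * p) μ := by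
  have := hE.prob
  set a := Mo p μ with ha
  have h0 : 0 ≤ ∫ v, (wt v ^ p - a) ^ 2 ∂μ := integral_nonneg fun v => sq_nonneg _
  have h1 : ∫ v, (wt v ^ p - a) ^ 2 ∂μ = ∫ v, (wt v ^ (2 * p) - 2 * a * wt v ^ p + a ^ 2) ∂μ := by
    congr 1; ext v; ring
  rw [h1, integral_add (hE.int _) (hE.int _), integral_sub (hE.int _) (hE.int _), integral_const_mul] at h0
  simp only [integral_const, probReal_univ, smul_eq_mul, one_mul] at h0
  have h2 : ∫ v, wt v ^ p ∂μ = a := rfl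
  rw [h2] at h0
  have h3 : ∫ v, wt v ^ (2 * p) ∂μ = Mo (2 * p) μ := rfl
  rw [h3] at h0
  nlinarith

lemma Qwt (hG : Good B b κ δ) {R : ℝ} {μ : Measure (Vd d)} (hE : Emp R μ) {h : Tri d → ℝ} {c : ℝ} (hc : 0 ≤ c)
    (p : ℕ) (hh : ∀ v vs σ, ‖σ‖ = 1 → |h ((v, vs), σ)| ≤ c * (wt v * wt vs) ^ p) :
    |Qf b h μ| ≤ c * Mo (2 * p + 2) μ := by
  have h1 := Qf_abs_le (b := b) hE h (fun v vs => c * (wt v ^ (p + 1) * wt vs ^ (p + 1))) fun v vs _ _ => by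
    refine (Ab_abs_le hG (K := c * (wt v * wt vs) ^ p) fun σ hσ => hh v vs σ hσ).trans ?_
    have := wt_pos v
    have := wt_pos vs
    calc _ ≤ (wt v * wt vs) * (c * (wt v * wt vs) ^ p) := by gcongr; exact rt_le v vs
      _ = _ := by ring
  refine h1.trans ?_
  simp only [integral_const_mul, integral_mul_const]
  have h2 := Mo_sq hE (p + 1)
  have h3 : ∫ v, wt v ^ (p + 1) ∂μ = Mo (p + 1) μ := rfl
  rw [h3, show 2 * p + 2 = 2 * (p + 1) by ring]
  gcongr
  linarith

lemma Del_wt {g : Vd d → ℝ} {c : ℝ} (hc : 0 ≤ c) (p : ℕ) (hg : ∀ v, |g v| ≤ c * wt v ^ p) {v vs σ : Vd d}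
    (hσ : ‖σ‖ = 1) : |Del g ((v, vs), σ)| ≤ 4 * c * 2 ^ p * (wt v * wt vs) ^ p := by
  obtain ⟨h1, h2⟩ := wt_post_le v vs σ hσ
  have p0 := fun v : Vd d => (wt_pos v).le
  have h3 : wt v ≤ 2 * (wt v * wt vs) := by have := wt_add_le v vs; linarith [p0 vs]
  have h4 : wt vs ≤ 2 * (wt v * wt vs) := by have := wt_add_le v vs; linarith [p0 v]
  have key : ∀ u : Vd d, wt u ≤ 2 * (wt v * wt vs) → |g u| ≤ c * 2 ^ p * (wt v * wt vs) ^ p := by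
    intro u hu
    calc |g u| ≤ c * wt u ^ p := hg u
      _ ≤ c * (2 * (wt v * wt vs)) ^ p := by have := p0 u; gcongr
      _ = _ := by rw [mul_pow]; ring
  have e1 := abs_le.1 (key _ h1)
  have e2 := abs_le.1 (key _ h2)
  have e3 := abs_le.1 (key _ h3)
  have e4 := abs_le.1 (key _ h4)
  rw [abs_le]; simp only [Del]; constructor <;> linarith

variable {Ω : Type*} [m0 : MeasurableSpace Ω] {P : Measure Ω} [IsProbabilityMeasure P]
  {𝓕 : Filtration ℝ m0} {m : ℝ → Ω → Measure (Vd d)}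

lemma Mo_ii (hG : Good B b κ δ) (h : IsKacProcess B N P 𝓕 m) (p : ℕ) (ω : Ω) (s t : ℝ) :
    IntervalIntegrable (fun u => Mo p (m u ω)) volume s t := by
  obtain ⟨C, hC0, h1, h2, h3⟩ := kp_bdds hG h (LB_wt p)
  exact ii_bdd' ((kp_X_meas h (LB_wt p).meas).comp measurable_prodMk_right) (fun u => h1 u ω) s t

lemma int_Q_le (hG : Good B b κ δ) (h : IsKacProcess B N P 𝓕 m) {g : Vd d → ℝ} (hg : LB g)
    {c : ℝ} (hc : 0 ≤ c) (hgc : ∀ v, |g v| ≤ c * wt v ^ 2) {τ t T : ℝ} (h1 : τ ≤ t) (h2 : t ≤ T) (ω : Ω) :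
    |∫ s in τ..t, Qf b (Del g) (m s ω)| ≤ c * (16 * ∫ s in τ..T, Mo 6 (m s ω)) := by
  have e1 : |∫ s in τ..t, Qf b (Del g) (m s ω)| ≤ ∫ s in τ..t, 16 * c * Mo 6 (m s ω) := by
    refine (intervalIntegral.abs_integral_le_integral_abs h1).trans ?_
    refine intervalIntegral.integral_mono_on h1 (kp_Q_ii hG h hg ω τ t).abs
      ((Mo_ii hG h 6 ω τ t).const_mul _) fun s _ => ?_
    have := Qwt hG (emp_of_mem (h.mem s ω)) (h := Del g) (c := 16 * c) (by positivity) 2 fun v vs σ hσ => by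
      refine (Del_wt hc 2 hgc hσ).trans (le_of_eq ?_); ring
    simpa using this
  have e2 : ∫ s in τ..T, Mo 6 (m s ω) = (∫ s in τ..t, Mo 6 (m s ω)) + ∫ s in t..T, Mo 6 (m s ω) :=
    (intervalIntegral.integral_add_adjacent_intervals (Mo_ii hG h 6 ω τ t) (Mo_ii hG h 6 ω t T)).symm
  have e3 : 0 ≤ ∫ s in t..T, Mo 6 (m s ω) := intervalIntegral.integral_nonneg h2 fun _ _ => Mo_nonneg _ _
  rw [intervalIntegral.integral_const_mul] at e1
  rw [e2]
  nlinarith [mul_nonneg hc e3]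

lemma X_le (h : IsKacProcess B N P 𝓕 m) {g : Vd d → ℝ}
    {c : ℝ} (p : ℕ) (hgc : ∀ v, |g v| ≤ c * wt v ^ p) (t : ℝ) (ω : Ω) :
    |∫ v, g v ∂(m t ω)| ≤ c * Mo p (m t ω) := by
  have hE := emp_of_mem (h.mem t ω)
  refine abs_integral_le_integral_abs.trans ((emp_mono hE hgc).trans (le_of_eq ?_))
  rw [integral_const_mul]; rfl

lemma Mt_le (hG : Good B b κ δ) (h : IsKacProcess B N P 𝓕 m) {g : Vd d → ℝ} (hg : LB g)
    {c : ℝ} (hc : 0 ≤ c) (hgc : ∀ v, |g v| ≤ c * wt v ^ 2) {τ t T : ℝ} (h1 : τ ≤ t) (h2 : t ≤ T) (ω : Ω) :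
    |Mt b m τ g t ω| ≤ c * (Mo 2 (m t ω) + Mo 2 (m τ ω) + 16 * ∫ s in τ..T, Mo 6 (m s ω)) := by
  have e1 := abs_le.1 (int_Q_le hG h hg hc hgc h1 h2 ω)
  have e2 := abs_le.1 (X_le h 2 hgc t ω)
  have e3 := abs_le.1 (X_le h 2 hgc τ ω)
  rw [Mt, abs_le]; constructor <;> nlinarith

lemma LB.add {g1 g2 : Vd d → ℝ} (h1 : LB g1) (h2 : LB g2) : LB (fun v => g1 v + g2 v) := by
  refine ⟨h1.meas.add h2.meas, fun D => ?_⟩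
  obtain ⟨K1, a1, b1⟩ := h1.bdd D
  obtain ⟨K2, a2, b2⟩ := h2.bdd D
  exact ⟨K1 + K2, by positivity, fun v hv => (abs_add_le _ _).trans (add_le_add (b1 v hv) (b2 v hv))⟩

lemma LB.smul {g1 : Vd d → ℝ} (h1 : LB g1) (c : ℝ) : LB (fun v => c * g1 v) := by
  refine ⟨h1.meas.const_mul c, fun D => ?_⟩
  obtain ⟨K1, a1, b1⟩ := h1.bdd D
  exact ⟨|c| * K1, by positivity, fun v hv => by rw [abs_mul]; gcongr; exact b1 v hv⟩

lemma Qf_Del_add (hG : Good B b κ δ) {μ : Measure (Vd d)} {R : ℝ} (hE : Emp R μ)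
    {g1 g2 : Vd d → ℝ} (h1 : LB g1) (h2 : LB g2) :
    Qf b (Del fun v => g1 v + g2 v) μ = Qf b (Del g1) μ + Qf b (Del g2) μ := by
  obtain ⟨K1, a1, b1⟩ := h1.bdd (2 * R)
  obtain ⟨K2, a2, b2⟩ := h2.bdd (2 * R)
  rw [← Qf_add hE hG (meas_Del h1.meas) (meas_Del h2.meas)
    (fun v vs σ hσ hv hvs => del_bdd b1 hσ hv hvs) (fun v vs σ hσ hv hvs => del_bdd b2 hσ hv hvs)]
  congr 1; ext p; simp only [Del]; ring

lemma Qf_Del_smul (μ : Measure (Vd d)) (g : Vd d → ℝ) (c : ℝ) :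
    Qf b (Del fun v => c * g v) μ = c * Qf b (Del g) μ := by
  rw [← Qf_smul]
  congr 1; ext p; simp only [Del]; ring

lemma Mt_add2 (hG : Good B b κ δ) (h : IsKacProcess B N P 𝓕 m) {g1 g2 : Vd d → ℝ} (h1 : LB g1) (h2 : LB g2)
    (τ t : ℝ) (ω : Ω) :
    Mt b m τ (fun v => g1 v + g2 v) t ω = Mt b m τ g1 t ω + Mt b m τ g2 t ω := by
  simp only [Mt, fun s => Qf_Del_add hG (emp_of_mem (h.mem s ω)) h1 h2]
  rw [intervalIntegral.integral_add (kp_Q_ii hG h h1 ω τ t) (kp_Q_ii hG h h2 ω τ t),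
    integral_add ((emp_of_mem (h.mem t ω)).int _) ((emp_of_mem (h.mem t ω)).int _),
    integral_add ((emp_of_mem (h.mem τ ω)).int _) ((emp_of_mem (h.mem τ ω)).int _)]
  ring

lemma Mt_smul (g : Vd d → ℝ) (c τ t : ℝ) (ω : Ω) :
    Mt b m τ (fun v => c * g v) t ω = c * Mt b m τ g t ω := by
  simp only [Mt, Qf_Del_smul, integral_const_mul, intervalIntegral.integral_const_mul]
  ring

lemma LB_sum {ι : Type*} (s : Finset ι) {g : ι → Vd d → ℝ} (hg : ∀ i, LB (g i)) (c : ι → ℝ) :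
    LB (fun v => ∑ i ∈ s, c i * g i v) := by
  classical
  induction s using Finset.induction_on with
  | empty => simp only [Finset.sum_empty]; exact LB_cont continuous_const
  | insert a s ha ih => simp only [Finset.sum_insert ha]; exact ((hg a).smul _).add ih

lemma Mt_sum (hG : Good B b κ δ) (h : IsKacProcess B N P 𝓕 m) {ι : Type*} (s : Finset ι) {g : ι → Vd d → ℝ}
    (hg : ∀ i, LB (g i)) (c : ι → ℝ) (τ t : ℝ) (ω : Ω) :
    Mt b m τ (fun v => ∑ i ∈ s, c i * g i v) t ω = ∑ i ∈ s, c i * Mt b m τ (g i) t ω := by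
  classical
  induction s using Finset.induction_on with
  | empty =>
    simp only [Finset.sum_empty]
    have := Mt_smul (b := b) (m := m) (fun _ => 0) 0 τ t ω
    simpa using this
  | insert a s ha ih =>
    simp only [Finset.sum_insert ha]
    rw [Mt_add2 hG h ((hg a).smul _) (LB_sum s hg c), Mt_smul, ih]

lemma Qf_congr (hG : Good B b κ δ) {μ : Measure (Vd d)} {R : ℝ} (hE : Emp R μ) {h1 h2 : Tri d → ℝ}
    (hh : ∀ v vs σ, ‖σ‖ = 1 → ‖v‖ ≤ R → ‖vs‖ ≤ R → h1 ((v, vs), σ) = h2 ((v, vs), σ)) :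
    Qf b h1 μ = Qf b h2 μ := by
  refine integral_congr_ae ?_
  filter_upwards [hE.ball] with v hv
  refine integral_congr_ae ?_
  filter_upwards [hE.ball] with vs hvs
  simp only [Ab]
  congr 1
  refine integral_congr_ae ?_
  filter_upwards [hG.sph (v, vs)] with σ hσ
  exact hh v vs σ hσ hv hvs

lemma Mt_congr (hG : Good B b κ δ) (h : IsKacProcess B N P 𝓕 m) {g1 g2 : Vd d → ℝ}
    (hh : ∀ v, ‖v‖ ≤ 2 * √N → g1 v = g2 v) (τ t : ℝ) (ω : Ω) :
    Mt b m τ g1 t ω = Mt b m τ g2 t ω := by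
  have hs : √(N:ℝ) ≤ 2 * √N := by linarith [Real.sqrt_nonneg (N:ℝ)]
  have e1 : ∀ s, ∫ v, g1 v ∂(m s ω) = ∫ v, g2 v ∂(m s ω) := fun s => by
    refine integral_congr_ae ?_
    filter_upwards [(emp_of_mem (h.mem s ω)).ball] with v hv
    exact hh v (hv.trans hs)
  have e2 : ∀ s, Qf b (Del g1) (m s ω) = Qf b (Del g2) (m s ω) := fun s => by
    refine Qf_congr hG (emp_of_mem (h.mem s ω)) fun v vs σ hσ hv hvs => ?_
    obtain ⟨a1, a2⟩ := norm_post_le hσ hv hvs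
    simp only [Del]
    rw [hh _ a1, hh _ a2, hh _ (hv.trans hs), hh _ (hvs.trans hs)]
  simp only [Mt, e1, e2]

end partQ


section partG

variable {d : ℕ}

def cell (k : ℕ) (v : Vd d) : Fin d → ℤ := fun i => ⌊(2:ℝ) ^ k * v i⌋

def cnr (k : ℕ) (z : Fin d → ℤ) : Vd d := WithLp.toLp 2 fun i => ((2:ℝ) ^ k)⁻¹ * (z i : ℝ)

def par (z : Fin d → ℤ) : Fin d → ℤ := fun i => z i / 2

def ci (k : ℕ) (z : Fin d → ℤ) (v : Vd d) : ℝ := if cell k v = z then 1 else 0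

lemma cell_par (k : ℕ) (v : Vd d) : cell k v = par (cell (k + 1) v) := by
  ext i
  simp only [cell, par]
  set y := (2:ℝ) ^ k * v i with hy
  have : (2:ℝ) ^ (k + 1) * v i = 2 * y := by rw [hy]; ring
  rw [this]
  have h1 := Int.floor_le y
  have h2 := Int.lt_floor_add_one y
  have h3 : 2 * ⌊y⌋ ≤ ⌊2 * y⌋ := by rw [Int.le_floor]; push_cast; linarith
  have h4 : ⌊2 * y⌋ < 2 * ⌊y⌋ + 2 := by rw [Int.floor_lt]; push_cast; linarith
  omega

lemma norm_le_coord {x : Vd d} {c : ℝ} (hc : 0 ≤ c) (h : ∀ i, |x i| ≤ c) : ‖x‖ ≤ d * c := by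
  rw [EuclideanSpace.norm_eq]
  refine Real.sqrt_le_iff.2 ⟨by positivity, ?_⟩
  calc ∑ i, ‖x i‖ ^ 2 ≤ ∑ i : Fin d, c ^ 2 := by
        refine Finset.sum_le_sum fun i _ => ?_
        exact pow_le_pow_left₀ (norm_nonneg _) (h i) 2
    _ = d * c ^ 2 := by simp
    _ ≤ (d * c) ^ 2 := by
        rw [mul_pow]
        have : (d:ℝ) ≤ (d:ℝ) ^ 2 := by exact_mod_cast Nat.le_self_pow (by norm_num) d
        gcongr

lemma coord_le (x : Vd d) (i : Fin d) : |x i| ≤ ‖x‖ := PiLp.norm_apply_le x i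

lemma cnr_near (k : ℕ) (v : Vd d) : ‖v - cnr k (cell k v)‖ ≤ d * ((2:ℝ) ^ k)⁻¹ := by
  refine norm_le_coord (by positivity) fun i => ?_
  simp only [PiLp.sub_apply, cnr, cell]
  have h0 : (0:ℝ) < 2 ^ k := by positivity
  have h1 := Int.floor_le ((2:ℝ) ^ k * v i)
  have h2 := Int.lt_floor_add_one ((2:ℝ) ^ k * v i)
  have e : v i - ((2:ℝ) ^ k)⁻¹ * (⌊(2:ℝ) ^ k * v i⌋ : ℝ) = ((2:ℝ) ^ k)⁻¹ * ((2:ℝ) ^ k * v i - ⌊(2:ℝ) ^ k * v i⌋) := by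
    field_simp
  rw [e, abs_mul, abs_of_pos (inv_pos.2 h0), abs_of_nonneg (by linarith)]
  exact mul_le_of_le_one_right (by positivity) (by linarith)

lemma cnr_par (k : ℕ) (z : Fin d → ℤ) : ‖cnr (k + 1) z - cnr k (par z)‖ ≤ d * ((2:ℝ) ^ (k + 1))⁻¹ := by
  refine norm_le_coord (by positivity) fun i => ?_
  simp only [PiLp.sub_apply, cnr, par]
  have h0 : (0:ℝ) < 2 ^ k := by positivity
  have h1 : 2 * (z i / 2) ≤ z i := by omega
  have h2 : z i ≤ 2 * (z i / 2) + 1 := by omega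
  have h1' : 2 * ((z i / 2 : ℤ) : ℝ) ≤ z i := by exact_mod_cast h1
  have h2' : (z i : ℝ) ≤ 2 * ((z i / 2 : ℤ) : ℝ) + 1 := by exact_mod_cast h2
  have e : ((2:ℝ) ^ (k + 1))⁻¹ * (z i : ℝ) - ((2:ℝ) ^ k)⁻¹ * ((z i / 2 : ℤ) : ℝ)
      = ((2:ℝ) ^ (k + 1))⁻¹ * ((z i : ℝ) - 2 * ((z i / 2 : ℤ) : ℝ)) := by
    rw [pow_succ]; field_simp
  rw [e, abs_mul, abs_of_pos (by positivity), abs_of_nonneg (by linarith)]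
  exact mul_le_of_le_one_right (by positivity) (by linarith)

def Gam (d : ℕ) : ℝ := 2 + 2 * (d:ℝ) ^ 2

lemma Gam_ge : 1 ≤ Gam d := by rw [Gam]; nlinarith [sq_nonneg (d:ℝ)]

lemma wt_near {x y : Vd d} (h : ‖x - y‖ ≤ d) : wt x ≤ Gam d * wt y := by
  have h1 : ‖x‖ ≤ ‖y‖ + d := by
    have := norm_add_le (x - y) y; rw [sub_add_cancel] at this; linarith
  have h2 : ‖x‖ ^ 2 ≤ (‖y‖ + d) ^ 2 := by gcongr
  rw [wt, wt, Gam]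
  nlinarith [sq_nonneg (‖y‖ - d), sq_nonneg ((d:ℝ) * ‖y‖), sq_nonneg (‖y‖), sq_nonneg (d:ℝ)]

lemma inv_two_pow_le (k : ℕ) : ((2:ℝ) ^ k)⁻¹ ≤ 1 := inv_le_one_of_one_le₀ (one_le_pow₀ (by norm_num))

lemma d_inv_le (k : ℕ) : d * ((2:ℝ) ^ k)⁻¹ ≤ (d:ℝ) :=
  mul_le_of_le_one_right (by positivity) (inv_two_pow_le k)

def K2 (d : ℕ) : Set (Vd d → ℝ) :=
  {g | (∀ v, |g v| ≤ wt v ^ 2) ∧ ∀ x y, |g x - g y| ≤ ‖x - y‖ * (wt x ^ 2 + wt y ^ 2)}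

def co (g : Vd d → ℝ) : ℕ → (Fin d → ℤ) → ℝ
  | 0, z => g (cnr 0 z)
  | k + 1, z => g (cnr (k + 1) z) - g (cnr k (par z))

def D1 (d : ℕ) : ℝ := 1 + d * (1 + Gam d ^ 2)

lemma D1_ge : 1 ≤ D1 d := by rw [D1]; have : (0:ℝ) ≤ d * (1 + Gam d ^ 2) := by positivity
                             linarith

lemma co_le {g : Vd d → ℝ} (hg : g ∈ K2 d) (k : ℕ) (z : Fin d → ℤ) :
    |co g k z| ≤ D1 d * (((2:ℝ) ^ k)⁻¹ * wt (cnr k z) ^ 2) := by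
  have h1 := D1_ge (d := d)
  cases k with
  | zero =>
    simp only [co, pow_zero, inv_one, one_mul]
    exact (hg.1 _).trans (le_mul_of_one_le_left (by have := wt_pos (cnr 0 z : Vd d); positivity) h1)
  | succ k =>
    simp only [co]
    have h2 := cnr_par k z
    have h3 : wt (cnr k (par z)) ≤ Gam d * wt (cnr (k + 1) z) :=
      wt_near (by rw [norm_sub_rev]; exact h2.trans (d_inv_le _))
    have p1 := wt_pos (cnr (k + 1) z : Vd d)
    have p2 := wt_pos (cnr k (par z) : Vd d)
    have hG0 : 0 ≤ Gam d := by linarith [Gam_ge (d := d)]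
    calc _ ≤ _ := hg.2 _ _
      _ ≤ (d * ((2:ℝ) ^ (k + 1))⁻¹) * (wt (cnr (k + 1) z) ^ 2 + (Gam d * wt (cnr (k + 1) z)) ^ 2) := by gcongr
      _ = (d * (1 + Gam d ^ 2)) * (((2:ℝ) ^ (k + 1))⁻¹ * wt (cnr (k + 1) z) ^ 2) := by ring
      _ ≤ _ := by gcongr; rw [D1]; linarith

lemma rem_le {g : Vd d → ℝ} (hg : g ∈ K2 d) (K : ℕ) (v : Vd d) :
    |g v - g (cnr K (cell K v))| ≤ D1 d * ((2:ℝ) ^ K)⁻¹ * wt v ^ 2 := by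
  have h2 := cnr_near K v
  have h3 : wt (cnr K (cell K v)) ≤ Gam d * wt v :=
      wt_near (by rw [norm_sub_rev]; exact h2.trans (d_inv_le _))
  have p1 := wt_pos (cnr K (cell K v))
  have p2 := wt_pos v
  have hG0 : 0 ≤ Gam d := by linarith [Gam_ge (d := d)]
  calc _ ≤ _ := hg.2 _ _
      _ ≤ (d * ((2:ℝ) ^ K)⁻¹) * (wt v ^ 2 + (Gam d * wt v) ^ 2) := by gcongr
      _ = (d * (1 + Gam d ^ 2)) * (((2:ℝ) ^ K)⁻¹ * wt v ^ 2) := by ring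
      _ ≤ D1 d * (((2:ℝ) ^ K)⁻¹ * wt v ^ 2) := by gcongr; rw [D1]; linarith
      _ = _ := by ring

def box (d L : ℕ) : Finset (Fin d → ℤ) := Fintype.piFinset fun _ => Finset.Icc (-(L:ℤ)) L

lemma cell_box {K L : ℕ} {R : ℝ} (hL : 2 ^ K * R + 1 ≤ L) {k : ℕ} (hk : k ≤ K) {v : Vd d} (hv : ‖v‖ ≤ R) :
    cell k v ∈ box d L := by
  rw [box, Fintype.mem_piFinset]
  intro i
  have h1 := (coord_le v i).trans hv
  have h2 : |(2:ℝ) ^ k * v i| ≤ 2 ^ K * R := by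
    rw [abs_mul, abs_of_pos (by positivity : (0:ℝ) < 2 ^ k)]
    have : (2:ℝ) ^ k ≤ 2 ^ K := pow_le_pow_right₀ (by norm_num) hk
    gcongr
  rw [abs_le] at h2
  rw [Finset.mem_Icc, cell]
  constructor
  · rw [Int.le_floor]; push_cast; linarith
  · have h3 := Int.floor_le ((2:ℝ) ^ k * v i)
    have : ((⌊(2:ℝ) ^ k * v i⌋ : ℤ) : ℝ) ≤ ((L:ℤ):ℝ) := by push_cast; linarith
    exact_mod_cast this

lemma sum_ci {s : Finset (Fin d → ℤ)} (c : (Fin d → ℤ) → ℝ) {k : ℕ} {v : Vd d} (h : cell k v ∈ s) :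
    ∑ z ∈ s, c z * ci k z v = c (cell k v) := by
  simp only [ci, mul_ite, mul_one, mul_zero]
  rw [Finset.sum_ite_eq]; simp [h]

lemma chain (g : Vd d → ℝ) (K : ℕ) {s : Finset (Fin d → ℤ)} {v : Vd d} (h : ∀ k ≤ K, cell k v ∈ s) :
    ∑ k ∈ Finset.range (K + 1), ∑ z ∈ s, co g k z * ci k z v = g (cnr K (cell K v)) := by
  induction K with
  | zero => simp [sum_ci _ (h 0 le_rfl), co]
  | succ K ih =>
    rw [Finset.sum_range_succ, ih fun k hk => h k (by omega), sum_ci _ (h _ le_rfl)]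
    simp only [co, ← cell_par]
    ring

lemma cell_meas (k : ℕ) : Measurable (cell k : Vd d → Fin d → ℤ) := by
  refine measurable_pi_lambda _ fun i => ?_
  exact Int.measurable_floor.comp (by fun_prop)

lemma LB_ci (k : ℕ) (z : Fin d → ℤ) : LB (ci k z : Vd d → ℝ) := by
  refine ⟨?_, fun D => ⟨1, zero_le_one, fun v _ => ?_⟩⟩
  · exact Measurable.ite (cell_meas k (measurableSet_singleton z)) measurable_const measurable_const
  · simp only [ci]; split_ifs <;> simp

def aw (v : Vd d) : ℝ := ∏ i, (1 + |v i|) ^ 2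

lemma aw_pos (v : Vd d) : 0 < aw v := Finset.prod_pos fun i _ => by positivity

lemma aw_le (v : Vd d) : aw v ≤ (2 * wt v) ^ d := by
  have : ∀ i ∈ (Finset.univ : Finset (Fin d)), (1 + |v i|) ^ 2 ≤ 2 * wt v := by
    intro i _
    have h1 := coord_le v i
    have : |v i| ^ 2 ≤ ‖v‖ ^ 2 := by gcongr
    rw [wt]; nlinarith [sq_nonneg (1 - |v i|)]
  refine (Finset.prod_le_prod (fun i _ => by positivity) this).trans (by simp)

lemma sum1 (n L : ℕ) (hn : 1 ≤ n) :
    ∑ j ∈ Finset.Icc (-(L:ℤ)) (L:ℤ), ((1 + |((n:ℝ))⁻¹ * ((j:ℤ):ℝ)|) ^ 2)⁻¹ ≤ (1 + 2 * (n:ℝ) : ℝ) := by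
  have hn' : (1:ℝ) ≤ n := by exact_mod_cast hn
  have step : ∀ L : ℕ, ((1 + ((n:ℝ))⁻¹ * ((L:ℝ) + 1)) ^ 2)⁻¹ ≤ (n:ℝ) ^ 2 / (n + L) - (n:ℝ) ^ 2 / (n + L + 1) := by
    intro L
    have e1 : ((1 + ((n:ℝ))⁻¹ * ((L:ℝ) + 1)) ^ 2)⁻¹ = (n:ℝ) ^ 2 / (n + L + 1) ^ 2 := by
      field_simp; ring
    have e2 : (n:ℝ) ^ 2 / (n + L) - (n:ℝ) ^ 2 / (n + L + 1) = (n:ℝ) ^ 2 / ((n + L) * (n + L + 1)) := by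
      field_simp; ring
    rw [e1, e2]
    gcongr
    nlinarith
  have key : ∑ j ∈ Finset.Icc (-(L:ℤ)) (L:ℤ), ((1 + |((n:ℝ))⁻¹ * ((j:ℤ):ℝ)|) ^ 2)⁻¹ ≤ 1 + 2 * ((n:ℝ) - (n:ℝ) ^ 2 / (n + L)) := by
    induction L with
    | zero =>
      have : (n:ℝ) ^ 2 / (n + ((0:ℕ):ℝ)) = n := by simp; field_simp
      rw [this]; simp
    | succ L ih =>
      have e : Finset.Icc (-((L + 1 : ℕ):ℤ)) ((L + 1 : ℕ):ℤ)
          = insert (-((L:ℤ) + 1)) (insert ((L:ℤ) + 1) (Finset.Icc (-(L:ℤ)) L)) := by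
        ext j; simp only [Finset.mem_insert, Finset.mem_Icc]; push_cast; omega
      rw [e, Finset.sum_insert, Finset.sum_insert]
      · have s1 := step L
        have a1 : |((n:ℝ))⁻¹ * (((-((L:ℤ) + 1) : ℤ)) : ℝ)| = ((n:ℝ))⁻¹ * ((L:ℝ) + 1) := by
          push_cast
          rw [mul_neg, abs_neg, abs_of_nonneg (by positivity)]
        have a2 : |((n:ℝ))⁻¹ * ((((L:ℤ) + 1 : ℤ)) : ℝ)| = ((n:ℝ))⁻¹ * ((L:ℝ) + 1) := by
          push_cast
          rw [abs_of_nonneg (by positivity)]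
        rw [a1, a2]
        push_cast
        rw [← add_assoc (n:ℝ)]
        linarith
      · simp
      · simp; omega
  have : 0 ≤ (n:ℝ) ^ 2 / (n + L) := by positivity
  linarith

lemma sum_aw (k L : ℕ) : ∑ z ∈ box d L, (aw (cnr k z))⁻¹ ≤ (3 * 2 ^ k) ^ d := by
  have h := Finset.prod_univ_sum (fun _ : Fin d => Finset.Icc (-(L:ℤ)) L)
    (fun _ j => ((1 + |((2:ℝ) ^ k)⁻¹ * (j:ℝ)|) ^ 2)⁻¹)
  have e : ∑ z ∈ box d L, (aw (cnr k z))⁻¹ = ∏ _i : Fin d, ∑ j ∈ Finset.Icc (-(L:ℤ)) L,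
      ((1 + |((2:ℝ) ^ k)⁻¹ * (j:ℝ)|) ^ 2)⁻¹ := by
    rw [h]
    refine Finset.sum_congr rfl fun z _ => ?_
    rw [aw, ← Finset.prod_inv_distrib]
    rfl
  rw [e]
  have h1 := sum1 (2 ^ k) L Nat.one_le_two_pow
  push_cast at h1
  have h2 : (1:ℝ) ≤ 2 ^ k := one_le_pow₀ (by norm_num)
  simp only [Finset.prod_const, Finset.card_univ, Fintype.card_fin]
  gcongr
  linarith

def Psi (x : Vd d) : ℝ := (wt x ^ 2) ^ 2 * aw x

lemma Psi_le (k : ℕ) (v : Vd d) : Psi (cnr k (cell k v)) ≤ (Gam d ^ 4 * (2 * Gam d) ^ d) * wt v ^ (d + 4) := by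
  have h3 : wt (cnr k (cell k v)) ≤ Gam d * wt v :=
      wt_near (by rw [norm_sub_rev]; exact (cnr_near k v).trans (d_inv_le _))
  have p1 := wt_pos (cnr k (cell k v))
  have p2 := wt_pos v
  have hG0 : 0 ≤ Gam d := by linarith [Gam_ge (d := d)]
  calc Psi (cnr k (cell k v)) ≤ (wt (cnr k (cell k v)) ^ 2) ^ 2 * (2 * wt (cnr k (cell k v))) ^ d := by
        rw [Psi]; gcongr; exact aw_le _
    _ ≤ ((Gam d * wt v) ^ 2) ^ 2 * (2 * (Gam d * wt v)) ^ d := by gcongr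
    _ = _ := by rw [mul_pow, mul_pow, ← mul_assoc, mul_pow, mul_pow]; ring

end partG


section partR

variable {d N : ℕ} {B : Vd d → Measure (Vd d)} {b : Kernel (Vd d × Vd d) (Vd d)} {κ δ : ℝ}
variable {Ω : Type*} [m0 : MeasurableSpace Ω] {P : Measure Ω} [IsProbabilityMeasure P]
  {𝓕 : Filtration ℝ m0} {m : ℝ → Ω → Measure (Vd d)}

def St (b : Kernel (Vd d × Vd d) (Vd d)) (m : ℝ → Ω → Measure (Vd d)) (τ : ℝ) {ι : Type*} (s : Finset ι)
    (c : ι → ℝ) (g : ι → Vd d → ℝ) (t : ℝ) (ω : Ω) : ℝ := ∑ i ∈ s, c i * Mt b m τ (g i) t ω ^ 2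

lemma St_int (hG : Good B b κ δ) (h : IsKacProcess B N P 𝓕 m) {g : Vd d → ℝ} (hg : LB g)
    {s t : ℝ} (hs : 0 ≤ s) (hst : s ≤ t) : Integrable (fun ω => Mt b m s g t ω ^ 2) P := by
  obtain ⟨C, h0, hC⟩ := Mt_bdd hG h hg hst
  refine int_bdd (((Mt_adp hG h hg hs hst).mono (𝓕.le t) le_rfl).pow_const 2) (C := C ^ 2) fun ω => ?_
  rw [abs_pow]
  exact pow_le_pow_left₀ (abs_nonneg _) (hC ω) 2

lemma St_max (hG : Good B b κ δ) (h : IsKacProcess B N P 𝓕 m) {ι : Type*} (s : Finset ι)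
    {c : ι → ℝ} (hc : ∀ i, 0 ≤ c i) {g : ι → Vd d → ℝ} (hg : ∀ i, LB (g i)) {τ hh : ℝ} (hτ : 0 ≤ τ) (h0 : 0 ≤ hh)
    (n : ℕ) {E a : ℝ} (ha : 0 < a) (hE : ∫ ω, St b m τ s c g (τ + n * hh) ω ∂P ≤ E) :
    P {ω | ∃ j ≤ n, a ≤ St b m τ s c g (τ + j * hh) ω} ≤ ENNReal.ofReal (E / a) := by
  have hmono : Monotone fun k : ℕ => τ + (k:ℝ) * hh := by
    intro i j hij
    have : (i:ℝ) ≤ j := by exact_mod_cast hij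
    simp only; gcongr
  have hge : ∀ k : ℕ, τ ≤ τ + (k:ℝ) * hh := fun k =>
    le_add_of_nonneg_right (mul_nonneg (Nat.cast_nonneg _) h0)
  let 𝒢 : Filtration ℕ m0 := ⟨fun k => 𝓕 (τ + k * hh), fun i j hij => 𝓕.mono (hmono hij), fun k => 𝓕.le _⟩
  have hint : ∀ k : ℕ, ∀ i, Integrable (fun ω => c i * Mt b m τ (g i) (τ + k * hh) ω ^ 2) P := fun k i =>
    (St_int hG h (hg i) hτ (hge k)).const_mul _
  have hsub : Submartingale (fun (k : ℕ) ω => St b m τ s c g (τ + k * hh) ω) 𝒢 P := by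
    refine submartingale_of_setIntegral_le ?_ ?_ ?_
    · intro k
      refine Measurable.stronglyMeasurable ?_
      unfold St
      refine Finset.measurable_fun_sum _ fun i _ => ?_
      exact ((Mt_adp hG h (hg i) hτ (hge k)).pow_const 2).const_mul _
    · intro k
      exact integrable_finset_sum _ fun i _ => hint k i
    · intro i j hij A hA
      have hA' : MeasurableSet A := 𝓕.le _ _ hA
      unfold St
      rw [integral_finset_sum _ fun k _ => (hint i k).integrableOn,
        integral_finset_sum _ fun k _ => (hint j k).integrableOn]
      refine Finset.sum_le_sum fun k _ => ?_
      rw [integral_const_mul, integral_const_mul]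
      exact mul_le_mul_of_nonneg_left (Mt_sub hG h (hg k) hτ (hge i) (hmono hij) hA) (hc k)
  have hnn : ∀ k ω, 0 ≤ St b m τ s c g k ω := fun k ω =>
    Finset.sum_nonneg fun i _ => mul_nonneg (hc i) (sq_nonneg _)
  have hmax := maximal_ineq hsub (fun k ω => hnn _ _) (ε := a.toNNReal) n
  have hset : {ω | ∃ j ≤ n, a ≤ St b m τ s c g (τ + j * hh) ω} = {ω | (a.toNNReal : ℝ) ≤
      (Finset.range (n + 1)).sup' Finset.nonempty_range_add_one fun k => St b m τ s c g (τ + k * hh) ω} := by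
    ext ω
    simp only [Set.mem_setOf_eq, Finset.le_sup'_iff, Finset.mem_range, Real.coe_toNNReal a ha.le]
    exact ⟨fun ⟨j, h1, h2⟩ => ⟨j, by omega, h2⟩, fun ⟨j, h1, h2⟩ => ⟨j, by omega, h2⟩⟩
  rw [← hset] at hmax
  have h2 : ENNReal.ofReal (∫ ω in {ω | ∃ j ≤ n, a ≤ St b m τ s c g (τ + j * hh) ω},
      St b m τ s c g (τ + n * hh) ω ∂P) ≤ ENNReal.ofReal E := by
    refine ENNReal.ofReal_le_ofReal (le_trans ?_ hE)
    exact setIntegral_le_integral (integrable_finset_sum _ fun i _ => hint n i) (Eventually.of_forall fun ω => hnn _ _)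
  have h3 := hmax.trans h2
  rw [ENNReal.ofReal_div_of_pos ha, ENNReal.le_div_iff_mul_le (Or.inl (by simpa using ha)) (Or.inl ENNReal.ofReal_ne_top),
    mul_comm]
  exact h3

def dy (τ T : ℝ) (n j : ℕ) : ℝ := τ + j * ((T - τ) / 2 ^ n)

lemma St_max2 (hG : Good B b κ δ) (h : IsKacProcess B N P 𝓕 m) {ι : Type*} (s : Finset ι)
    {c : ι → ℝ} (hc : ∀ i, 0 ≤ c i) {g : ι → Vd d → ℝ} (hg : ∀ i, LB (g i)) {τ T : ℝ} (hτ : 0 ≤ τ) (hT : τ ≤ T)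
    {E a : ℝ} (ha : 0 < a) (hE : ∫ ω, St b m τ s c g T ω ∂P ≤ E) :
    P {ω | ∃ n, ∃ j ≤ 2 ^ n, a ≤ St b m τ s c g (dy τ T n j) ω} ≤ ENNReal.ofReal (E / a) := by
  have e : {ω | ∃ n, ∃ j ≤ 2 ^ n, a ≤ St b m τ s c g (dy τ T n j) ω}
      = ⋃ n : ℕ, {ω | ∃ j ≤ 2 ^ n, a ≤ St b m τ s c g (dy τ T n j) ω} := by ext; simp
  rw [e, Monotone.measure_iUnion]
  · refine iSup_le fun n => ?_
    refine St_max hG h s hc hg hτ (div_nonneg (by linarith) (by positivity)) (2 ^ n) ha ?_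
    have : τ + ((2 ^ n : ℕ):ℝ) * ((T - τ) / 2 ^ n) = T := by push_cast; field_simp; ring
    rw [this]; exact hE
  · refine monotone_nat_of_le_succ fun n ω => ?_
    rintro ⟨j, hj, h2⟩
    refine ⟨2 * j, by rw [pow_succ]; omega, ?_⟩
    have : dy τ T (n + 1) (2 * j) = dy τ T n j := by
      simp only [dy]; push_cast; rw [pow_succ]; field_simp
    rw [this]; exact h2

def clp (R : ℝ) (x : Vd d) : Vd d := WithLp.toLp 2 fun i => max (-R) (min R (x i))

lemma clp_lip (R : ℝ) (x y : Vd d) : ‖clp R x - clp R y‖ ≤ ‖x - y‖ := by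
  rw [EuclideanSpace.norm_eq, EuclideanSpace.norm_eq]
  refine Real.sqrt_le_sqrt (Finset.sum_le_sum fun i _ => ?_)
  refine pow_le_pow_left₀ (norm_nonneg _) ?_ 2
  simp only [PiLp.sub_apply, clp, Real.norm_eq_abs]
  refine (abs_max_sub_max_le_max _ _ _ _).trans ?_
  simp only [sub_self, abs_zero]
  refine max_le (abs_nonneg _) ?_
  refine (abs_min_sub_min_le_max _ _ _ _).trans ?_
  simp

lemma clp_eq {R : ℝ} {x : Vd d} (h : ‖x‖ ≤ R) : clp R x = x := by
  ext i
  have := abs_le.1 ((coord_le x i).trans h)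
  simp only [clp]
  rw [min_eq_right this.2, max_eq_right this.1]

lemma clp_norm {R : ℝ} (hR : 0 ≤ R) (x : Vd d) : ‖clp R x‖ ≤ d * R := by
  refine norm_le_coord hR fun i => ?_
  simp only [clp]
  rw [abs_le]
  exact ⟨le_max_left _ _, max_le (by linarith) (min_le_left _ _)⟩

lemma K2_cont {g : Vd d → ℝ} (hg : g ∈ K2 d) : Continuous g := by
  rw [continuous_iff_continuousAt]
  intro x
  have : Tendsto (fun y => ‖y - x‖ * (wt y ^ 2 + wt x ^ 2)) (nhds x) (nhds 0) := by
    have : Continuous fun y => ‖y - x‖ * (wt y ^ 2 + wt x ^ 2) := by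
      have := cont_wt (d := d); fun_prop
    have h := this.tendsto x
    simpa using h
  rw [ContinuousAt, tendsto_iff_norm_sub_tendsto_zero]
  exact squeeze_zero (fun _ => norm_nonneg _) (fun y => hg.2 y x) this

lemma wt_K2 : (fun v : Vd d => wt v ^ 2) ∈ K2 d := by
  refine ⟨fun v => by rw [abs_of_nonneg (sq_nonneg _)], fun x y => ?_⟩
  have h1 : |‖x‖ - ‖y‖| ≤ ‖x - y‖ := abs_norm_sub_norm_le x y
  have e : wt x ^ 2 - wt y ^ 2 = (‖x‖ - ‖y‖) * ((‖x‖ + ‖y‖) * (wt x + wt y)) := by unfold wt; ring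
  have p1 := wt_pos x
  have p2 := wt_pos y
  have q1 : ‖x‖ + ‖y‖ ≤ (wt x + wt y) / 2 := by
    unfold wt; nlinarith [sq_nonneg (‖x‖ - 1), sq_nonneg (‖y‖ - 1)]
  rw [e, abs_mul, abs_of_nonneg (by positivity : 0 ≤ (‖x‖ + ‖y‖) * (wt x + wt y))]
  have : (‖x‖ + ‖y‖) * (wt x + wt y) ≤ wt x ^ 2 + wt y ^ 2 := by
    have : (‖x‖ + ‖y‖) * (wt x + wt y) ≤ (wt x + wt y) / 2 * (wt x + wt y) := by gcongr
    nlinarith [sq_nonneg (wt x - wt y)]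
  gcongr

lemma X_rc (h : IsKacProcess B N P 𝓕 m) {g : Vd d → ℝ} (hg : g ∈ K2 d) (ω : Ω) (t : ℝ) :
    ContinuousWithinAt (fun s => ∫ v, g v ∂(m s ω)) (Set.Ici t) t := by
  have hR : (0:ℝ) ≤ √N := Real.sqrt_nonneg _
  set W := (1 + (d * √(N:ℝ)) ^ 2) ^ 2 with hW
  have hw : ∀ x : Vd d, wt (clp (√N) x) ^ 2 ≤ W := fun x => by
    have := clp_norm hR x
    rw [hW]
    unfold wt
    gcongr
  have h1 := kp_rc h (f := fun v => g (clp (√N) v)) (K := W) (L := 2 * W)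
    (fun v => (hg.1 _).trans (hw v)) (fun v w => by
      refine (hg.2 _ _).trans ?_
      have := clp_lip (√N) v w
      have a1 := hw v
      have a2 := hw w
      calc _ ≤ ‖v - w‖ * (W + W) := by gcongr
        _ = _ := by ring) (by positivity) ω t
  have e : ∀ s, ∫ v, g (clp (√N) v) ∂(m s ω) = ∫ v, g v ∂(m s ω) := fun s => by
    refine integral_congr_ae ?_
    filter_upwards [(emp_of_mem (h.mem s ω)).ball] with v hv
    rw [clp_eq hv]
  simpa only [e] using h1

lemma Mt_rc (hG : Good B b κ δ) (h : IsKacProcess B N P 𝓕 m) {g : Vd d → ℝ} (hg : g ∈ K2 d) (ω : Ω) (τ t : ℝ) :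
    ContinuousWithinAt (fun s => Mt b m τ g s ω) (Set.Ici t) t := by
  unfold Mt
  refine ((X_rc h hg ω t).sub continuousWithinAt_const).sub ?_
  have : Continuous fun x => ∫ s in τ..x, Qf b (Del g) (m s ω) :=
    intervalIntegral.continuous_primitive (fun a c => kp_Q_ii hG h (LB_cont (K2_cont hg)) ω a c) τ
  exact this.continuousWithinAt

lemma dy_dense {τ T : ℝ} (hT : τ ≤ T) {F : ℝ → ℝ} (hF : ∀ t, ContinuousWithinAt F (Set.Ici t) t) {c : ℝ}
    (hc : ∀ n, ∀ j ≤ 2 ^ n, F (dy τ T n j) ≤ c) {t : ℝ} (h1 : τ ≤ t) (h2 : t ≤ T) : F t ≤ c := by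
  rcases h2.eq_or_lt with rfl | h3
  · have := hc 0 1 (by norm_num)
    simpa [dy] using this
  by_contra hcon
  push Not at hcon
  have hev := (hF t).eventually (eventually_gt_nhds hcon)
  rw [Filter.Eventually, mem_nhdsWithin, ] at hev
  obtain ⟨u, hu, htu, hsub⟩ := hev
  obtain ⟨r, hr, hball⟩ := Metric.isOpen_iff.1 hu t htu
  have hTt : 0 < T - τ := by linarith
  obtain ⟨n, hn⟩ := exists_pow_lt_of_lt_one (div_pos hr hTt) (by norm_num : (1/2:ℝ) < 1)
  have hp : (0:ℝ) < 2 ^ n := by positivity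
  have hn' : (T - τ) / 2 ^ n < r := by
    rw [one_div, inv_pow, lt_div_iff₀ hTt] at hn
    rw [div_eq_inv_mul]; exact hn
  have hh : 0 < (T - τ) / 2 ^ n := by positivity
  set y := (t - τ) / ((T - τ) / 2 ^ n) with hy
  have hy0 : 0 ≤ y := div_nonneg (by linarith) hh.le
  have hyt : y * ((T - τ) / 2 ^ n) = t - τ := by rw [hy]; field_simp
  have hj1 := Nat.le_ceil y
  have hj2 := Nat.ceil_lt_add_one hy0
  have hj3 : ⌈y⌉₊ ≤ 2 ^ n := by
    rw [Nat.ceil_le]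
    push_cast
    rw [hy, div_le_iff₀ hh, mul_div_cancel₀ _ hp.ne']
    linarith
  have hd := hc n _ hj3
  have m1 : t ≤ dy τ T n ⌈y⌉₊ := by
    rw [dy]
    have : y * ((T - τ) / 2 ^ n) ≤ ⌈y⌉₊ * ((T - τ) / 2 ^ n) := by gcongr
    linarith
  have m2 : dy τ T n ⌈y⌉₊ < t + r := by
    rw [dy]
    have : (⌈y⌉₊:ℝ) * ((T - τ) / 2 ^ n) < (y + 1) * ((T - τ) / 2 ^ n) := by gcongr
    linarith
  have m3 : dy τ T n ⌈y⌉₊ ∈ u ∩ Set.Ici t := ⟨hball (by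
    rw [Metric.mem_ball, Real.dist_eq, abs_lt]; constructor <;> linarith), m1⟩
  have := hsub m3
  simp only [Set.mem_ofPred_eq] at this
  linarith

end partR


section partS

variable {d N : ℕ} {B : Vd d → Measure (Vd d)} {b : Kernel (Vd d × Vd d) (Vd d)} {κ δ : ℝ}

def rho (d K k : ℕ) : ℝ := (((2:ℝ) ^ k) ^ d)⁻¹ * (2 ^ K)⁻¹ * (3 / 4) ^ (K - k)

lemma rho_pos (K k : ℕ) : 0 < rho d K k := by unfold rho; positivity

def ix (d K L : ℕ) : Finset (ℕ × (Fin d → ℤ)) := Finset.range (K + 1) ×ˢ box d L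

def Wc (K : ℕ) (p : ℕ × (Fin d → ℤ)) : ℝ := Psi (cnr p.1 p.2) * (((2:ℝ) ^ p.1)⁻¹ ^ 2 * (rho d K p.1)⁻¹)

lemma Psi_nn (x : Vd d) : 0 ≤ Psi x := by
  have := aw_pos x; unfold Psi; positivity

lemma Wc_nn (K : ℕ) (p : ℕ × (Fin d → ℤ)) : 0 ≤ Wc K p := by
  have := Psi_nn (cnr p.1 p.2); have := rho_pos (d := d) K p.1; unfold Wc; positivity

lemma geo_sum (x : ℝ) (hx0 : 0 ≤ x) (hx : x < 1) (K : ℕ) :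
    ∑ k ∈ Finset.range (K + 1), x ^ (K - k) ≤ (1 - x)⁻¹ := by
  have := Finset.sum_range_reflect (fun k => x ^ k) (K + 1)
  simp only [Nat.add_sub_cancel] at this
  rw [Finset.sum_congr rfl (fun k hk => by rw [show K - k = K + 1 - 1 - k by omega])] 
  simp only [Nat.add_sub_cancel]
  rw [this]
  rw [geom_sum_eq hx.ne, ← neg_div_neg_eq, neg_sub, neg_sub, div_eq_mul_inv]
  have : 0 < 1 - x := by linarith
  exact mul_le_of_le_one_left (by positivity) (by have := pow_nonneg hx0 (K + 1); linarith)

lemma rho_sum (K L : ℕ) : ∑ p ∈ ix d K L, rho d K p.1 * (aw (cnr p.1 p.2))⁻¹ ≤ 4 * 3 ^ d * ((2:ℝ) ^ K)⁻¹ := by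
  rw [ix, Finset.sum_product]
  calc _ ≤ ∑ k ∈ Finset.range (K + 1), 3 ^ d * ((2:ℝ) ^ K)⁻¹ * (3 / 4) ^ (K - k) := by
        refine Finset.sum_le_sum fun k _ => ?_
        simp only
        rw [← Finset.mul_sum]
        refine (mul_le_mul_of_nonneg_left (sum_aw k L) (rho_pos K k).le).trans (le_of_eq ?_)
        rw [rho, mul_pow]; field_simp
    _ ≤ 3 ^ d * ((2:ℝ) ^ K)⁻¹ * (1 - 3 / 4)⁻¹ := by
        rw [← Finset.mul_sum]
        refine mul_le_mul_of_nonneg_left (geo_sum _ (by norm_num) (by norm_num) K) (by positivity)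
    _ = _ := by norm_num; ring

lemma amgm (K : ℕ) (p : ℕ × (Fin d → ℤ)) (x : ℝ) :
    (((2:ℝ) ^ p.1)⁻¹ * wt (cnr p.1 p.2 : Vd d) ^ 2) * |x| ≤ rho d K p.1 * (aw (cnr p.1 p.2))⁻¹ + Wc K p * x ^ 2 := by
  have h1 := rho_pos (d := d) K p.1
  have h2 := aw_pos (cnr p.1 p.2 : Vd d)
  set r := rho d K p.1
  rw [Wc, Psi]
  set a := aw (cnr p.1 p.2 : Vd d)
  set y := (((2:ℝ) ^ p.1)⁻¹ * wt (cnr p.1 p.2 : Vd d) ^ 2) * |x| with hy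
  have e : (wt (cnr p.1 p.2 : Vd d) ^ 2) ^ 2 * a * (((2:ℝ) ^ p.1)⁻¹ ^ 2 * r⁻¹) * x ^ 2 = a * r⁻¹ * y ^ 2 := by
    rw [hy, mul_pow _ |x|, sq_abs]; ring
  rw [e]
  have hy0 : 0 ≤ y := by positivity
  have : a * r⁻¹ * y ^ 2 + r * a⁻¹ = (a * y - r) ^ 2 / (a * r) + 2 * y := by field_simp; ring
  have : 0 ≤ (a * y - r) ^ 2 / (a * r) := by positivity
  linarith

variable {Ω : Type*} [m0 : MeasurableSpace Ω] {P : Measure Ω} [IsProbabilityMeasure P]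
  {𝓕 : Filtration ℝ m0} {m : ℝ → Ω → Measure (Vd d)}

lemma chain_abs (hG : Good B b κ δ) (h : IsKacProcess B N P 𝓕 m) {K L : ℕ} (hL : 2 ^ K * (2 * √N) + 1 ≤ (L:ℝ))
    {g : Vd d → ℝ} (hg : g ∈ K2 d) {τ t T : ℝ} (h1 : τ ≤ t) (h2 : t ≤ T) (ω : Ω) :
    |Mt b m τ g t ω| ≤ D1 d * (4 * 3 ^ d * ((2:ℝ) ^ K)⁻¹ + St b m τ (ix d K L) (Wc K) (fun p => ci p.1 p.2) t ω)
      + D1 d * ((2:ℝ) ^ K)⁻¹ * (Mo 2 (m t ω) + Mo 2 (m τ ω) + 16 * ∫ s in τ..T, Mo 6 (m s ω)) := by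
  have hD := D1_ge (d := d)
  have hgc := K2_cont hg
  have mg : Measurable fun v => g v - g (cnr K (cell K v)) := by
    refine hgc.measurable.sub ?_
    have h0 : Measurable fun z : Fin d → ℤ => g (cnr K z) := measurable_of_countable _
    exact h0.comp (cell_meas K)
  have b1 : ∀ v, |g v - g (cnr K (cell K v))| ≤ (D1 d * ((2:ℝ) ^ K)⁻¹) * wt v ^ 2 := fun v => rem_le hg K v
  have lbr : LB fun v => g v - g (cnr K (cell K v)) := by
    refine ⟨mg, fun D => ?_⟩
    obtain ⟨C, hC0, hC⟩ := (LB_wt (d := d) 2).bdd D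
    refine ⟨(D1 d * ((2:ℝ) ^ K)⁻¹) * C, by positivity, fun v hv => (b1 v).trans ?_⟩
    gcongr
    exact (le_abs_self _).trans (hC v hv)
  have lbs : LB fun v => ∑ p ∈ ix d K L, co g p.1 p.2 * ci p.1 p.2 v :=
    LB_sum _ (g := fun p : ℕ × (Fin d → ℤ) => ci p.1 p.2) (fun p => LB_ci _ _) (fun p => co g p.1 p.2)
  have e1 : Mt b m τ g t ω = Mt b m τ (fun v => (∑ p ∈ ix d K L, co g p.1 p.2 * ci p.1 p.2 v)
      + (g v - g (cnr K (cell K v)))) t ω := by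
    refine Mt_congr hG h (fun v hv => ?_) τ t ω
    have := chain g K (s := box d L) (v := v) fun k hk => cell_box hL hk hv
    rw [ix, Finset.sum_product]
    simp only
    rw [this]; ring
  rw [e1, Mt_add2 hG h lbs lbr, Mt_sum hG h _ (g := fun p : ℕ × (Fin d → ℤ) => ci p.1 p.2) (fun p => LB_ci _ _)
    (fun p => co g p.1 p.2)]
  refine (abs_add_le _ _).trans (add_le_add ?_ ?_)
  · refine (Finset.abs_sum_le_sum_abs _ _).trans ?_
    calc _ ≤ ∑ p ∈ ix d K L, D1 d * (rho d K p.1 * (aw (cnr p.1 p.2))⁻¹ + Wc K p * Mt b m τ (ci p.1 p.2) t ω ^ 2) := by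
          refine Finset.sum_le_sum fun p _ => ?_
          rw [abs_mul]
          calc _ ≤ (D1 d * (((2:ℝ) ^ p.1)⁻¹ * wt (cnr p.1 p.2 : Vd d) ^ 2)) * |Mt b m τ (ci p.1 p.2) t ω| := by
                gcongr; exact co_le hg _ _
            _ = D1 d * ((((2:ℝ) ^ p.1)⁻¹ * wt (cnr p.1 p.2 : Vd d) ^ 2) * |Mt b m τ (ci p.1 p.2) t ω|) := by ring
            _ ≤ _ := by gcongr; exact amgm K p _
      _ ≤ _ := by
          rw [← Finset.mul_sum, Finset.sum_add_distrib]
          unfold St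
          gcongr
          exact rho_sum K L
  · exact Mt_le hG h lbr (by positivity) b1 h1 h2 ω

lemma sum_Psi_le (k L : ℕ) (v : Vd d) : ∑ z ∈ box d L, Psi (cnr k z) * ci k z v ≤
    (Gam d ^ 4 * (2 * Gam d) ^ d) * wt v ^ (d + 4) := by
  refine le_trans ?_ (Psi_le k v)
  by_cases hz : cell k v ∈ box d L
  · rw [sum_ci (fun z => Psi (cnr k z)) hz]
  · rw [Finset.sum_eq_zero]
    · exact Psi_nn _
    · intro z hz'
      have : cell k v ≠ z := fun hh => hz (hh ▸ hz')
      simp [ci, this]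

def Gp (d : ℕ) : ℝ := 16 * (Gam d ^ 4 * (2 * Gam d) ^ d) * 2 ^ (d + 4)

lemma Gp_nn : 0 ≤ Gp d := by
  have := Gam_ge (d := d); unfold Gp; positivity

lemma sum_Del_le (k L : ℕ) (v vs σ : Vd d) (hσ : ‖σ‖ = 1) :
    ∑ z ∈ box d L, Psi (cnr k z) * Del (ci k z) ((v, vs), σ) ^ 2 ≤ Gp d * (wt v * wt vs) ^ (d + 4) := by
  have hw := wt_post_le v vs σ hσ
  have hG0 : 0 ≤ Gam d := by linarith [Gam_ge (d := d)]
  have o1 := one_le_wt v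
  have o2 := one_le_wt vs
  have p1 := wt_pos (postV v vs σ)
  have p2 := wt_pos (postVs v vs σ)
  have hci : ∀ z (w : Vd d), ci k z w ^ 2 = ci k z w := fun z w => by unfold ci; split_ifs <;> norm_num
  have aux : ∀ w : Vd d, wt w ≤ 2 * (wt v * wt vs) → ∑ z ∈ box d L, Psi (cnr k z) * ci k z w ≤
      (Gam d ^ 4 * (2 * Gam d) ^ d) * (2 * (wt v * wt vs)) ^ (d + 4) := fun w hw => by
    refine (sum_Psi_le k L w).trans ?_
    have := wt_pos w
    gcongr
  have a1 := aux _ hw.1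
  have a2 := aux _ hw.2
  have a3 := aux v (by nlinarith)
  have a4 := aux vs (by nlinarith)
  have key : ∑ z ∈ box d L, Psi (cnr k z) * Del (ci k z) ((v, vs), σ) ^ 2 ≤
      ∑ z ∈ box d L, 4 * (Psi (cnr k z) * ci k z (postV v vs σ) + Psi (cnr k z) * ci k z (postVs v vs σ)
        + Psi (cnr k z) * ci k z v + Psi (cnr k z) * ci k z vs) := by
    refine Finset.sum_le_sum fun z _ => ?_
    have hP := Psi_nn (cnr k z)
    have : Del (ci k z) ((v, vs), σ) ^ 2 ≤ 4 * (ci k z (postV v vs σ) + ci k z (postVs v vs σ) + ci k z v + ci k z vs) := by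
      rw [← hci z v, ← hci z vs, ← hci z (postV v vs σ), ← hci z (postVs v vs σ)]
      simp only [Del]
      generalize ci k z v = x1
      generalize ci k z vs = x2
      generalize ci k z (postV v vs σ) = x3
      generalize ci k z (postVs v vs σ) = x4
      nlinarith [sq_nonneg (x1 - x2), sq_nonneg (x3 - x4), sq_nonneg (x1 + x3), sq_nonneg (x1 + x4), sq_nonneg (x2 + x3), sq_nonneg (x2 + x4)]
    calc _ ≤ Psi (cnr k z) * (4 * (ci k z (postV v vs σ) + ci k z (postVs v vs σ) + ci k z v + ci k z vs)) := by gcongr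
      _ = _ := by ring
  refine key.trans ?_
  rw [← Finset.mul_sum, Finset.sum_add_distrib, Finset.sum_add_distrib, Finset.sum_add_distrib]
  have e : Gp d * (wt v * wt vs) ^ (d + 4) = 16 * ((Gam d ^ 4 * (2 * Gam d) ^ d) * (2 * (wt v * wt vs)) ^ (d + 4)) := by
    rw [Gp, mul_pow 2 (wt v * wt vs)]; ring
  rw [e]; linarith

lemma Qf_sum (hG : Good B b κ δ) {R : ℝ} {μ : Measure (Vd d)} (hE : Emp R μ) {ι : Type*} (s : Finset ι) {g : ι → Vd d → ℝ}
    (hg : ∀ i, LB (g i)) (c : ι → ℝ) :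
    Qf b (fun p => ∑ i ∈ s, c i * Del (g i) p ^ 2) μ = ∑ i ∈ s, c i * Qf b (fun p => Del (g i) p ^ 2) μ := by
  classical
  have hb : ∀ i, ∃ K, ∀ v vs σ, ‖σ‖ = 1 → ‖v‖ ≤ R → ‖vs‖ ≤ R → |c i * Del (g i) ((v, vs), σ) ^ 2| ≤ K := by
    intro i
    obtain ⟨K, hK0, hK⟩ := (hg i).bdd (2 * R)
    refine ⟨|c i| * (4 * K) ^ 2, fun v vs σ h1 h2 h3 => ?_⟩
    rw [abs_mul, abs_pow]
    have := del_bdd hK h1 h2 h3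
    gcongr
  choose K hK using hb
  have hm : ∀ i, Measurable fun p => c i * Del (g i) p ^ 2 := fun i => ((meas_Del (hg i).meas).pow_const 2).const_mul _
  induction s using Finset.induction_on with
  | empty => simp [Qf, Ab]
  | insert a s ha ih =>
    simp only [Finset.sum_insert ha]
    rw [Qf_add hE hG (hm a) (Finset.measurable_fun_sum _ fun i _ => hm i) (K2 := ∑ i ∈ s, K i) (hK a) ?_, ih, Qf_smul]
    intro v vs σ h1 h2 h3
    exact (Finset.abs_sum_le_sum_abs _ _).trans (Finset.sum_le_sum fun i _ => hK i v vs σ h1 h2 h3)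

lemma Mo_E (hG : Good B b κ δ) (h : IsKacProcess B N P 𝓕 m) (p : ℕ) (t : ℝ) :
    Integrable (fun ω => Mo p (m t ω)) P := by
  obtain ⟨C, -, hC, -⟩ := kp_bdds hG h (LB_wt (d := d) p)
  exact int_bdd ((kp_X_meas h (LB_wt (d := d) p).meas).comp measurable_prodMk_left) (hC t)

lemma sq_bound (hG : Good B b κ δ) (h : IsKacProcess B N P 𝓕 m) {ι : Type*} (s : Finset ι) {g : ι → Vd d → ℝ}
    (hg : ∀ i, LB (g i)) {c : ι → ℝ} (hc : ∀ i, 0 ≤ c i) {G : ℝ} (hG0 : 0 ≤ G) (q : ℕ)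
    (hb : ∀ v vs σ : Vd d, ‖σ‖ = 1 → ∑ i ∈ s, c i * Del (g i) ((v, vs), σ) ^ 2 ≤ G * (wt v * wt vs) ^ q)
    {τ T A : ℝ} (hτ : 0 ≤ τ) (hT : τ ≤ T) (hA : ∀ t, τ ≤ t → t ≤ T → ∫ ω, Mo (2 * q + 2) (m t ω) ∂P ≤ A) :
    ∫ ω, St b m τ s c g T ω ∂P ≤ (N:ℝ)⁻¹ * (G * A * (T - τ)) := by
  unfold St
  rw [integral_finsetSum _ fun i _ => (St_int hG h (hg i) hτ hT).const_mul _]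
  simp only [integral_const_mul, Mt_sq hG h (hg _) hτ hT]
  have hii : ∀ i, IntervalIntegrable (fun u => c i * ∫ ω, Qf b (fun p => Del (g i) p ^ 2) (m u ω) ∂P) volume τ T := by
    intro i
    obtain ⟨C, hC0, -, -, hC⟩ := kp_bdds hG h (hg i)
    have hN : 0 < N := by
      obtain ⟨ω⟩ := nonempty_of_isProbabilityMeasure P
      exact (emp_data (h.mem 0 ω)).1
    have hmm := kp_Q_meas hG h ((meas_Del (hg i).meas).pow_const 2)
    refine IntervalIntegrable.const_mul (ii_bdd' (meas_E (F := fun u ω => Qf b (fun p => Del (g i) p ^ 2) (m u ω)) hmm)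
      (C := N * C) (fun u => E_abs_le fun ω => ?_) τ T) _
    have := hC u ω
    rw [abs_mul, abs_of_nonneg (by positivity)] at this
    have hN' : (0:ℝ) < N := by exact_mod_cast hN
    rwa [inv_mul_le_iff₀ hN'] at this
  have e : ∑ i ∈ s, c i * ((N:ℝ)⁻¹ * ∫ u in τ..T, ∫ ω, Qf b (fun p => Del (g i) p ^ 2) (m u ω) ∂P)
      = (N:ℝ)⁻¹ * ∫ u in τ..T, ∑ i ∈ s, c i * ∫ ω, Qf b (fun p => Del (g i) p ^ 2) (m u ω) ∂P := by
    rw [intervalIntegral.integral_finsetSum fun i _ => hii i, Finset.mul_sum]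
    refine Finset.sum_congr rfl fun i _ => ?_
    rw [intervalIntegral.integral_const_mul]; ring
  rw [e]
  refine mul_le_mul_of_nonneg_left ?_ (by positivity)
  refine (le_abs_self _).trans (ii_abs_le hT fun u hu => ?_)
  have e2 : ∑ i ∈ s, c i * ∫ ω, Qf b (fun p => Del (g i) p ^ 2) (m u ω) ∂P
      = ∫ ω, Qf b (fun p => ∑ i ∈ s, c i * Del (g i) p ^ 2) (m u ω) ∂P := by
    simp only [Qf_sum hG (emp_of_mem (h.mem u _)) s hg c]
    rw [integral_finsetSum]
    · simp only [integral_const_mul]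
    · intro i _
      obtain ⟨C, hC0, -, -, hC⟩ := kp_bdds hG h (hg i)
      have hmm := kp_Q_meas hG h ((meas_Del (hg i).meas).pow_const 2)
      by_cases hN : (N:ℝ) = 0
      · obtain ⟨ω⟩ := nonempty_of_isProbabilityMeasure P
        have := (emp_data (h.mem 0 ω)).1
        simp at hN; omega
      refine Integrable.const_mul (int_bdd (C := N * C) (hmm.comp measurable_prodMk_left) fun ω => ?_) _
      have := hC u ω
      rw [abs_mul, abs_of_nonneg (by positivity)] at this
      have hN' : (0:ℝ) < N := lt_of_le_of_ne (Nat.cast_nonneg _) (Ne.symm hN)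
      rwa [inv_mul_le_iff₀ hN'] at this
  rw [e2]
  have hptw : ∀ ω, |Qf b (fun p => ∑ i ∈ s, c i * Del (g i) p ^ 2) (m u ω)| ≤ G * Mo (2 * q + 2) (m u ω) := by
    intro ω
    refine Qwt hG (emp_of_mem (h.mem u ω)) hG0 q fun v vs σ hσ => ?_
    rw [abs_of_nonneg (Finset.sum_nonneg fun i _ => mul_nonneg (hc i) (sq_nonneg _))]
    exact hb v vs σ hσ
  calc _ ≤ ∫ ω, G * Mo (2 * q + 2) (m u ω) ∂P := by
        refine (abs_integral_le_integral_abs).trans ?_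
        refine integral_mono_of_nonneg (Eventually.of_forall fun _ => abs_nonneg _) ((Mo_E hG h _ _).const_mul _)
          (Eventually.of_forall hptw)
    _ ≤ G * A := by
        rw [integral_const_mul]
        exact mul_le_mul_of_nonneg_left (hA u hu.1.le hu.2) hG0

end partS


section partU

variable {d N : ℕ} {B : Vd d → Measure (Vd d)} {b : Kernel (Vd d × Vd d) (Vd d)} {κ δ : ℝ}

lemma geo_term (hd : 3 ≤ d) {K k : ℕ} (hk : k ≤ K) :
    ((2:ℝ) ^ k)⁻¹ ^ 2 * (rho d K k)⁻¹ ≤ (((2:ℝ) ^ K) ^ d * (2 ^ K)⁻¹) * (2 / 3) ^ (K - k) := by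
  obtain ⟨j, rfl⟩ := Nat.exists_eq_add_of_le hk
  obtain ⟨e, rfl⟩ := Nat.exists_eq_add_of_le hd
  rw [Nat.add_sub_cancel_left, rho, Nat.add_sub_cancel_left]
  have hu : (0:ℝ) < 2 ^ k := by positivity
  have hv : (1:ℝ) ≤ 2 ^ j := one_le_pow₀ (by norm_num)
  have e1 : ((3:ℝ) / 4) ^ j = 3 ^ j / (2 ^ j) ^ 2 := by rw [div_pow, ← pow_mul, mul_comm, pow_mul]; norm_num
  have e2 : ((2:ℝ) / 3) ^ j = 2 ^ j / 3 ^ j := div_pow _ _ _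
  rw [e1, e2, pow_add 2 k j, mul_pow]
  set u := (2:ℝ) ^ k
  set v := (2:ℝ) ^ j
  have h3 : (0:ℝ) < 3 ^ j := by positivity
  have hv0 : 0 < v := by linarith
  have hve : 1 ≤ v ^ e := one_le_pow₀ hv
  have lhs : u⁻¹ ^ 2 * ((u ^ (3 + e))⁻¹ * (u * v)⁻¹ * (3 ^ j / v ^ 2))⁻¹ = u ^ (2 + e) * (v ^ 3 / 3 ^ j) := by
    rw [show 3 + e = (2 + e) + 1 by ring, pow_succ]
    field_simp
    ring
  have rhs : u ^ (3 + e) * v ^ (3 + e) * (u * v)⁻¹ * (v / 3 ^ j) = u ^ (2 + e) * (v ^ 3 / 3 ^ j) * v ^ e := by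
    rw [show 3 + e = (2 + e) + 1 by ring, pow_succ, pow_succ v, pow_add v]
    field_simp
  rw [lhs, rhs]
  exact le_mul_of_one_le_right (by positivity) hve

lemma Wsum (hd : 3 ≤ d) (K L : ℕ) (v vs σ : Vd d) (hσ : ‖σ‖ = 1) :
    ∑ p ∈ ix d K L, Wc K p * Del (ci p.1 p.2) ((v, vs), σ) ^ 2
      ≤ (3 * (((2:ℝ) ^ K) ^ d * (2 ^ K)⁻¹) * Gp d) * (wt v * wt vs) ^ (d + 4) := by
  rw [ix, Finset.sum_product]
  have hGp := Gp_nn (d := d)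
  have p1 := wt_pos v
  have p2 := wt_pos vs
  set Y := Gp d * (wt v * wt vs) ^ (d + 4) with hY
  have hY0 : 0 ≤ Y := by positivity
  calc _ ≤ ∑ k ∈ Finset.range (K + 1), (((2:ℝ) ^ K) ^ d * (2 ^ K)⁻¹) * Y * (2 / 3) ^ (K - k) := by
        refine Finset.sum_le_sum fun k hk => ?_
        rw [Finset.mem_range] at hk
        simp only [Wc]
        have hr := rho_pos (d := d) K k
        calc _ = (((2:ℝ) ^ k)⁻¹ ^ 2 * (rho d K k)⁻¹) * ∑ z ∈ box d L, Psi (cnr k z) * Del (ci k z) ((v, vs), σ) ^ 2 := by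
              rw [Finset.mul_sum]; refine Finset.sum_congr rfl fun z _ => ?_; ring
          _ ≤ (((2:ℝ) ^ k)⁻¹ ^ 2 * (rho d K k)⁻¹) * Y := by
              gcongr; exact sum_Del_le k L v vs σ hσ
          _ ≤ ((((2:ℝ) ^ K) ^ d * (2 ^ K)⁻¹) * (2 / 3) ^ (K - k)) * Y := by
              exact mul_le_mul_of_nonneg_right (geo_term hd (by omega)) hY0
          _ = _ := by ring
    _ ≤ (((2:ℝ) ^ K) ^ d * (2 ^ K)⁻¹) * Y * (1 - 2 / 3)⁻¹ := by
        rw [← Finset.mul_sum]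
        exact mul_le_mul_of_nonneg_left (geo_sum _ (by norm_num) (by norm_num) K) (by positivity)
    _ = _ := by rw [hY]; norm_num; ring

lemma Mo2_eq {Ω : Type*} {m : ℝ → Ω → Measure (Vd d)} (τ t : ℝ) (ω : Ω) :
    Mo 2 (m t ω) = Mo 2 (m τ ω) + (∫ s in τ..t, Qf b (Del fun v => wt v ^ 2) (m s ω))
      + Mt b m τ (fun v => wt v ^ 2) t ω := by
  simp only [Mt, Mo]; ring

set_option maxHeartbeats 1000000 in
lemma one_proc (hG : Good B b κ δ) (hd : 3 ≤ d) {τ T ε : ℝ} (hτ : 0 < τ) (hτT : τ ≤ T) (hε : 0 < ε) :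
    ∃ C, 0 ≤ C ∧ ∀ (Ω : Type) (m0 : MeasurableSpace Ω) (P : Measure Ω), IsProbabilityMeasure P →
      ∀ (𝓕 : Filtration ℝ m0) (N : ℕ) (m : ℝ → Ω → Measure (Vd d)), IsKacProcess B N P 𝓕 m →
      ∀ K : ℕ, (2 ^ d) ^ K ≤ N → ∃ Bad : Set Ω, P Bad ≤ ENNReal.ofReal ε ∧ ∀ ω ∉ Bad, ∀ t, τ ≤ t → t ≤ T →
        Mo 2 (m t ω) ≤ C ∧ ∀ g ∈ K2 d, |Mt b m τ g t ω| ≤ C * ((2:ℝ) ^ K)⁻¹ := by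
  obtain ⟨A1, hA1, h1⟩ := mom1 hG (2 * (d + 4) + 2) hτ hτT
  obtain ⟨A2, hA2, h2⟩ := mom1 hG (2 * 4 + 2) hτ hτT
  obtain ⟨A3, hA3, h3⟩ := mom1 hG 2 hτ hτT
  obtain ⟨A4, hA4, h4⟩ := mom1 hG 6 hτ hτT
  have hGp := Gp_nn (d := d)
  have hD := D1_ge (d := d)
  have hTτ : 0 ≤ T - τ := by linarith
  set E1 := 3 * Gp d * (A1 * (T - τ)) + 1 with hE1
  set E2 := 256 * A2 * (T - τ) + 1 with hE2
  set E3 := A3 + 16 * (A4 * (T - τ)) + 1 with hE3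
  have p1 : 0 < E1 := by positivity
  have p2 : 0 < E2 := by positivity
  have p3 : 0 < E3 := by positivity
  set a1 := E1 * (3 / ε) with ha1
  set a2 := E2 * (3 / ε) with ha2
  set a3 := E3 * (3 / ε) with ha3
  have q1 : 0 < a1 := by positivity
  have q2 : 0 < a2 := by positivity
  have q3 : 0 < a3 := by positivity
  set Λ := a3 + (1 + a2) with hΛ
  set C0 := D1 d * (4 * 3 ^ d + a1) + D1 d * (Λ + a3) with hC0
  have hC00 : 0 ≤ C0 := by positivity
  refine ⟨Λ + C0, by positivity, ?_⟩
  intro Ω m0 P hP 𝓕 N m h K hKN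
  have hN : (0:ℝ) < N := by
    have : 0 < N := lt_of_lt_of_le (by positivity) hKN
    exact_mod_cast this
  have hN1 : (1:ℝ) ≤ N := by
    have : 1 ≤ N := le_trans Nat.one_le_two_pow (by rw [← pow_mul] at hKN; exact hKN)
    exact_mod_cast this
  have hKN' : ((2:ℝ) ^ K) ^ d ≤ N := by
    rw [← pow_mul, mul_comm, pow_mul]; exact_mod_cast hKN
  have hK0 : (0:ℝ) < ((2:ℝ) ^ K)⁻¹ := by positivity
  obtain ⟨L, hL⟩ := exists_nat_ge ((2:ℝ) ^ K * (2 * √N) + 1)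
  -- the chaining bad set
  have S1 : ∫ ω, St b m τ (ix d K L) (Wc K) (fun p => ci p.1 p.2) T ω ∂P ≤ E1 * ((2:ℝ) ^ K)⁻¹ := by
    refine (sq_bound hG h (ix d K L) (g := fun p => ci p.1 p.2) (fun p => LB_ci _ _) (Wc_nn K) (by positivity) (d + 4)
      (fun v vs σ hσ => Wsum hd K L v vs σ hσ) hτ.le hτT (A := A1) (fun t i1 i2 => h1 Ω m0 P hP 𝓕 N m h t i1 i2)).trans ?_
    have : (N:ℝ)⁻¹ * ((2:ℝ) ^ K) ^ d ≤ 1 := by rw [inv_mul_le_iff₀ hN]; linarith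
    calc _ = ((N:ℝ)⁻¹ * ((2:ℝ) ^ K) ^ d) * ((3 * Gp d * (A1 * (T - τ))) * ((2:ℝ) ^ K)⁻¹) := by ring
      _ ≤ 1 * ((3 * Gp d * (A1 * (T - τ))) * ((2:ℝ) ^ K)⁻¹) := by gcongr
      _ ≤ _ := by rw [one_mul]; gcongr; linarith
  have B1 := St_max2 hG h (ix d K L) (Wc_nn K) (g := fun p => ci p.1 p.2) (fun p => LB_ci _ _) hτ.le hτT
    (a := a1 * ((2:ℝ) ^ K)⁻¹) (by positivity) S1
  have S2 : ∫ ω, St b m τ (Finset.univ : Finset Unit) (fun _ => 1) (fun _ v => wt v ^ 2) T ω ∂P ≤ E2 := by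
    refine (sq_bound hG h (Finset.univ : Finset Unit) (g := fun _ v => wt v ^ 2) (fun _ => LB_wt 2) (c := fun _ => 1)
      (fun _ => zero_le_one) (G := 256) (by norm_num) 4
      (fun v vs σ hσ => ?_) hτ.le hτT (A := A2) (fun t i1 i2 => h2 Ω m0 P hP 𝓕 N m h t i1 i2)).trans ?_
    · have := Del_wt (g := fun v : Vd d => wt v ^ 2) (c := 1) zero_le_one 2 (fun v => by simp) (v := v) (vs := vs) hσ
      simp only [Finset.univ_unique, Finset.sum_singleton, one_mul]
      rw [← sq_abs]
      calc _ ≤ (4 * 1 * 2 ^ 2 * (wt v * wt vs) ^ 2) ^ 2 := by gcongr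
        _ = _ := by ring
    · have : (N:ℝ)⁻¹ ≤ 1 := inv_le_one_of_one_le₀ hN1
      calc _ ≤ 1 * (256 * A2 * (T - τ)) := by gcongr
        _ ≤ _ := by linarith
  have B2 := St_max2 hG h (Finset.univ : Finset Unit) (c := fun _ => 1) (fun _ => zero_le_one)
    (g := fun _ v => wt v ^ 2) (fun _ => LB_wt 2) hτ.le hτT q2 S2
  -- moment bad set
  set X : Ω → ℝ := fun ω => Mo 2 (m τ ω) + 16 * ∫ s in τ..T, Mo 6 (m s ω) with hX
  obtain ⟨C6, hC60, hC6, -⟩ := kp_bdds hG h (LB_wt (d := d) 6)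
  have m6 : Measurable fun p : ℝ × Ω => Mo 6 (m p.1 p.2) := kp_X_meas h (LB_wt (d := d) 6).meas
  have I6 : Integrable (fun ω => ∫ s in τ..T, Mo 6 (m s ω)) P := by
    refine int_bdd (meas_ii (F := fun s ω => Mo 6 (m s ω)) m6 hτT) (C := C6 * (T - τ)) fun ω => ?_
    exact ii_abs_le hτT fun u _ => hC6 u ω
  have I2 := Mo_E hG h 2 τ
  have IX : Integrable X P := I2.add (I6.const_mul 16)
  have S3 : ∫ ω, X ω ∂P ≤ E3 := by
    rw [hX, integral_add I2 (I6.const_mul 16), integral_const_mul,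
      fub (F := fun s ω => Mo 6 (m s ω)) m6 hτT (fun u _ ω => hC6 u ω)]
    have u1 := h3 Ω m0 P hP 𝓕 N m h τ le_rfl hτT
    have u2 : ∫ u in τ..T, ∫ ω, Mo 6 (m u ω) ∂P ≤ A4 * (T - τ) := by
      refine (le_abs_self _).trans (ii_abs_le hτT fun u hu => ?_)
      rw [abs_of_nonneg (integral_nonneg fun ω => Mo_nonneg _ _)]
      exact h4 Ω m0 P hP 𝓕 N m h u hu.1.le hu.2
    linarith
  have X6 : ∀ ω, 0 ≤ ∫ s in τ..T, Mo 6 (m s ω) := fun ω =>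
    intervalIntegral.integral_nonneg hτT fun u _ => Mo_nonneg _ _
  have X0 : ∀ ω, 0 ≤ X ω := fun ω => by
    have := X6 ω; have := Mo_nonneg 2 (m τ ω); simp only [hX]; linarith
  have B3 : P {ω | a3 ≤ X ω} ≤ ENNReal.ofReal (E3 / a3) := by
    have := mul_meas_ge_le_integral_of_nonneg (Eventually.of_forall X0) IX a3
    rw [← ENNReal.ofReal_toReal (measure_ne_top P {ω | a3 ≤ X ω})]
    refine ENNReal.ofReal_le_ofReal ?_
    rw [le_div_iff₀ q3, mul_comm]
    exact this.trans S3
  have r1 : E1 * ((2:ℝ) ^ K)⁻¹ / (a1 * ((2:ℝ) ^ K)⁻¹) = ε / 3 := by rw [ha1]; field_simp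
  have r2 : E2 / a2 = ε / 3 := by rw [ha2]; field_simp
  have r3 : E3 / a3 = ε / 3 := by rw [ha3]; field_simp
  rw [r1] at B1
  rw [r2] at B2
  rw [r3] at B3
  refine ⟨_ ∪ _ ∪ _, ((measure_union_le _ _).trans (add_le_add ((measure_union_le _ _).trans (add_le_add B1 B2)) B3)).trans ?_, ?_⟩
  · rw [← ENNReal.ofReal_add (by positivity) (by positivity), ← ENNReal.ofReal_add (by positivity) (by positivity)]
    exact ENNReal.ofReal_le_ofReal (by linarith)
  intro ω hω
  simp only [Set.mem_union, Set.mem_ofPred_eq, not_or, not_exists, not_and, not_le] at hω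
  obtain ⟨⟨w1, w2⟩, w3⟩ := hω
  have dyle : ∀ n : ℕ, ∀ j ≤ 2 ^ n, τ ≤ dy τ T n j ∧ dy τ T n j ≤ T := by
    intro n j hj
    have hj' : (j:ℝ) ≤ 2 ^ n := by exact_mod_cast hj
    have hh : 0 ≤ (T - τ) / 2 ^ n := by positivity
    have e : (2:ℝ) ^ n * ((T - τ) / 2 ^ n) = T - τ := by field_simp
    rw [dy]
    constructor
    · have : 0 ≤ (j:ℝ) * ((T - τ) / 2 ^ n) := by positivity
      linarith
    · have : (j:ℝ) * ((T - τ) / 2 ^ n) ≤ (2:ℝ) ^ n * ((T - τ) / 2 ^ n) := by gcongr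
      linarith
  have ab : ∀ x : ℝ, |x| ≤ 1 + x ^ 2 := fun x => by rw [← sq_abs]; nlinarith [sq_nonneg (|x| - 1), abs_nonneg x]
  have Mw : ∀ t, τ ≤ t → t ≤ T → |Mt b m τ (fun v => wt v ^ 2) t ω| ≤ 1 + a2 := by
    intro t i1 i2
    refine dy_dense hτT (F := fun t => |Mt b m τ (fun v => wt v ^ 2) t ω|) (fun t => (Mt_rc hG h wt_K2 ω τ t).abs)
      (fun n j hj => ?_) i1 i2
    have := w2 n j hj
    simp only [St, Finset.univ_unique, Finset.sum_singleton, one_mul] at this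
    linarith [ab (Mt b m τ (fun v => wt v ^ 2) (dy τ T n j) ω)]
  have M2 : ∀ t, τ ≤ t → t ≤ T → Mo 2 (m t ω) ≤ Λ := by
    intro t i1 i2
    have e := Mo2_eq (b := b) (m := m) τ t ω
    have v1 := int_Q_le hG h (LB_wt (d := d) 2) zero_le_one (fun v => by simp) i1 i2 ω
    have v2 := Mw t i1 i2
    have v3 := le_abs_self (∫ s in τ..t, Qf b (Del fun v => wt v ^ 2) (m s ω))
    have v4 := le_abs_self (Mt b m τ (fun v => wt v ^ 2) t ω)
    simp only [hX] at w3
    rw [e]; linarith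
  intro t i1 i2
  refine ⟨by linarith [M2 t i1 i2], fun g hg => ?_⟩
  refine dy_dense hτT (F := fun t => |Mt b m τ g t ω|) (fun t => (Mt_rc hG h hg ω τ t).abs)
      (fun n j hj => ?_) i1 i2
  obtain ⟨j1, j2⟩ := dyle n j hj
  have v1 := chain_abs hG h hL hg j1 j2 ω
  have v2 := (w1 n j hj).le
  have v3 := M2 _ j1 j2
  have v4 : Mo 2 (m τ ω) + 16 * ∫ s in τ..T, Mo 6 (m s ω) ≤ a3 := w3.le
  calc _ ≤ _ := v1
    _ ≤ D1 d * (4 * 3 ^ d * ((2:ℝ) ^ K)⁻¹ + a1 * ((2:ℝ) ^ K)⁻¹)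
      + D1 d * ((2:ℝ) ^ K)⁻¹ * (Λ + a3) := by
        exact add_le_add (mul_le_mul_of_nonneg_left (by linarith) (by linarith))
          (mul_le_mul_of_nonneg_left (by linarith) (mul_nonneg (by linarith) hK0.le))
    _ = C0 * ((2:ℝ) ^ K)⁻¹ := by rw [hC0]; ring
    _ ≤ _ := by
        refine mul_le_mul_of_nonneg_right ?_ hK0.le
        linarith

end partU


section partV

variable {d : ℕ} {B : Vd d → Measure (Vd d)} {b : Kernel (Vd d × Vd d) (Vd d)} {κ δ : ℝ}

def KK (d : ℕ) : Set (Vd d → ℝ) :=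
  {f | (∀ v, |f v| ≤ wt v) ∧ ∀ x y, |f x - f y| ≤ ‖x - y‖ * (wt x + wt y)}

lemma KK_cont {g : Vd d → ℝ} (hg : g ∈ KK d) : Continuous g := by
  rw [continuous_iff_continuousAt]
  intro x
  have : Tendsto (fun y => ‖y - x‖ * (wt y + wt x)) (nhds x) (nhds 0) := by
    have : Continuous fun y => ‖y - x‖ * (wt y + wt x) := by
      have := cont_wt (d := d); fun_prop
    have h := this.tendsto x
    simpa using h
  rw [ContinuousAt, tendsto_iff_norm_sub_tendsto_zero]
  exact squeeze_zero (fun _ => norm_nonneg _) (fun y => hg.2 y x) this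

def Gn (f : Vd d → ℝ) (v vs σ : Vd d) : ℝ := f (postV v vs σ) + f (postVs v vs σ)

lemma Gn_meas {f : Vd d → ℝ} (hf : Continuous f) (v vs : Vd d) : Measurable (Gn f v vs) := by
  have : Continuous (Gn f v vs) := by unfold Gn postV postVs; fun_prop
  exact this.measurable

lemma Gn_le {f : Vd d → ℝ} (hf : f ∈ KK d) (v vs σ : Vd d) (hσ : ‖σ‖ = 1) : |Gn f v vs σ| ≤ wt v + wt vs := by
  rw [← post_wt v vs σ hσ]
  exact (abs_add_le _ _).trans (add_le_add (hf.1 _) (hf.1 _))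

lemma sph_int (hG : Good B b κ δ) {g : Vd d → ℝ} (hg : Measurable g) {S : ℝ} (hS : ∀ σ, ‖σ‖ = 1 → |g σ| ≤ S)
    (p : Vd d × Vd d) : Integrable g (b p) := by
  have := hG.markov
  refine Integrable.of_bound hg.aestronglyMeasurable S ?_
  filter_upwards [hG.sph p] with σ hσ
  exact hS σ hσ

lemma sph_le (hG : Good B b κ δ) {g : Vd d → ℝ} {S : ℝ} (hS : ∀ σ, ‖σ‖ = 1 → |g σ| ≤ S)
    (p : Vd d × Vd d) : |∫ σ, g σ ∂(b p)| ≤ S := by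
  have := hG.markov
  have h := norm_integral_le_of_norm_le_const (μ := b p) (f := g) (C := S) (by
    filter_upwards [hG.sph p] with σ hσ
    exact hS σ hσ)
  simpa using h

lemma Ab_eq (hG : Good B b κ δ) {f : Vd d → ℝ} (hf : f ∈ KK d) (v vs : Vd d) :
    Ab b (Del f) v vs = ‖v - vs‖ * (∫ σ, Gn f v vs σ ∂(b (v, vs))) - ‖v - vs‖ * f v - ‖v - vs‖ * f vs := by
  have := hG.markov
  have I := sph_int hG (Gn_meas (KK_cont hf) v vs) (Gn_le hf v vs) (v, vs)
  have e : ∫ σ, Del f ((v, vs), σ) ∂(b (v, vs)) = (∫ σ, Gn f v vs σ ∂(b (v, vs))) - (f v + f vs) := by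
    have : ∀ σ, Del f ((v, vs), σ) = Gn f v vs σ - (f v + f vs) := fun σ => by simp only [Del, Gn]; ring
    simp only [this]
    rw [integral_sub I (integrable_const _)]
    simp
  rw [Ab, e]; ring

lemma A_up (hG : Good B b κ δ) {f : Vd d → ℝ} (hf : f ∈ KK d) (v vs : Vd d) :
    |Ab b (Del f) v vs + ‖v - vs‖ * f v| ≤ ‖v - vs‖ * (wt v + 2 * wt vs) := by
  rw [Ab_eq hG hf]
  have e : ‖v - vs‖ * (∫ σ, Gn f v vs σ ∂(b (v, vs))) - ‖v - vs‖ * f v - ‖v - vs‖ * f vs + ‖v - vs‖ * f v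
    = ‖v - vs‖ * ((∫ σ, Gn f v vs σ ∂(b (v, vs))) - f vs) := by ring
  rw [e, abs_mul, abs_of_nonneg (norm_nonneg _)]
  gcongr
  have h1 := sph_le hG (Gn_le hf v vs) (v, vs)
  have h2 := hf.1 vs
  refine (abs_sub _ _).trans ?_
  linarith

lemma A_key (hG : Good B b κ δ) {f : Vd d → ℝ} (hf : f ∈ KK d) (x y vs : Vd d) :
    |Ab b (Del f) x vs - Ab b (Del f) y vs + ‖x - vs‖ * (f x - f y)| ≤
      ‖x - y‖ * (‖x - vs‖ * (wt x + wt y + 2 * wt vs) + (κ + 1) * (wt y + wt vs)) := by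
  have hc := KK_cont hf
  have Ix := sph_int hG (Gn_meas hc x vs) (Gn_le hf x vs) (x, vs)
  have Iy := sph_int hG (Gn_meas hc y vs) (Gn_le hf y vs) (x, vs)
  have h1 := hG.lip x y vs (Gn f y vs) _ (Gn_meas hc y vs) (Gn_le hf y vs)
  have h2 : |(∫ σ, Gn f x vs σ ∂(b (x, vs))) - ∫ σ, Gn f y vs σ ∂(b (x, vs))| ≤ ‖x - y‖ * (wt x + wt y + 2 * wt vs) := by
    rw [← integral_sub Ix Iy]
    refine sph_le hG (fun σ hσ => ?_) _
    have l := post_lip x y vs σ hσ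
    have a1 := hf.2 (postV x vs σ) (postV y vs σ)
    have a2 := hf.2 (postVs x vs σ) (postVs y vs σ)
    have p1 := wt_pos (postV x vs σ)
    have p2 := wt_pos (postV y vs σ)
    have p3 := wt_pos (postVs x vs σ)
    have p4 := wt_pos (postVs y vs σ)
    have w1 := post_wt x vs σ hσ
    have w2 := post_wt y vs σ hσ
    have e : Gn f x vs σ - Gn f y vs σ = (f (postV x vs σ) - f (postV y vs σ)) + (f (postVs x vs σ) - f (postVs y vs σ)) := by
      simp only [Gn]; ring
    rw [e]
    calc _ ≤ _ := abs_add_le _ _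
      _ ≤ ‖x - y‖ * (wt (postV x vs σ) + wt (postV y vs σ)) + ‖x - y‖ * (wt (postVs x vs σ) + wt (postVs y vs σ)) := by
          refine add_le_add (a1.trans ?_) (a2.trans ?_)
          · gcongr; exact l.1
          · gcongr; exact l.2
      _ = ‖x - y‖ * ((wt (postV x vs σ) + wt (postVs x vs σ)) + (wt (postV y vs σ) + wt (postVs y vs σ))) := by ring
      _ = _ := by rw [w1, w2]; ring
  have h3 : |‖x - vs‖ - ‖y - vs‖| ≤ ‖x - y‖ := by
    have := abs_norm_sub_norm_le (x - vs) (y - vs)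
    simpa using this
  have h4 : |f y + f vs| ≤ wt y + wt vs := (abs_add_le _ _).trans (add_le_add (hf.1 _) (hf.1 _))
  rw [Ab_eq hG hf, Ab_eq hG hf]
  set Gx := ∫ σ, Gn f x vs σ ∂(b (x, vs))
  set Gyx := ∫ σ, Gn f y vs σ ∂(b (x, vs))
  set Gyy := ∫ σ, Gn f y vs σ ∂(b (y, vs))
  have e : ‖x - vs‖ * Gx - ‖x - vs‖ * f x - ‖x - vs‖ * f vs - (‖y - vs‖ * Gyy - ‖y - vs‖ * f y - ‖y - vs‖ * f vs)
      + ‖x - vs‖ * (f x - f y) = ‖x - vs‖ * (Gx - Gyx) + (‖x - vs‖ * Gyx - ‖y - vs‖ * Gyy)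
        - (‖x - vs‖ - ‖y - vs‖) * (f y + f vs) := by ring
  rw [e]
  have c1 : |‖x - vs‖ * (Gx - Gyx)| ≤ ‖x - vs‖ * (‖x - y‖ * (wt x + wt y + 2 * wt vs)) := by
    rw [abs_mul, abs_of_nonneg (norm_nonneg _)]; gcongr
  have c2 : |(‖x - vs‖ - ‖y - vs‖) * (f y + f vs)| ≤ ‖x - y‖ * (wt y + wt vs) := by
    rw [abs_mul]; gcongr
  refine (abs_sub _ _).trans ?_
  refine (add_le_add (abs_add_le _ _) le_rfl).trans ?_
  refine (add_le_add (add_le_add c1 h1) c2).trans (le_of_eq ?_)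
  ring

def Lo (b : Kernel (Vd d × Vd d) (Vd d)) (f : Vd d → ℝ) (μ ν : Measure (Vd d)) (v : Vd d) : ℝ :=
  (∫ vs, Ab b (Del f) v vs ∂μ) + ∫ vs, Ab b (Del f) v vs ∂ν

lemma emp_comm {N N' : ℕ} {μ ν : Measure (Vd d)} (hμ : μ ∈ empiricalSphere d N) (hν : ν ∈ empiricalSphere d N')
    (A : Vd d → Vd d → ℝ) : ∫ v, ∫ vs, A v vs ∂ν ∂μ = ∫ vs, ∫ v, A v vs ∂μ ∂ν := by
  obtain ⟨-, x, rfl, -⟩ := emp_data hμ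
  obtain ⟨-, y, rfl, -⟩ := emp_data hν
  simp only [integral_emp, Finset.mul_sum]
  rw [Finset.sum_comm]
  refine Finset.sum_congr rfl fun i _ => Finset.sum_congr rfl fun j _ => ?_
  ring

lemma Ab_symm (hG : Good B b κ δ) {f : Vd d → ℝ} (hf : Measurable f) (v vs : Vd d) :
    Ab b (Del f) v vs = Ab b (Del f) vs v := by
  by_cases h : v = vs
  · rw [h]
  · rw [Ab, Ab, hG.symm f hf v vs h, norm_sub_rev]

lemma q_eq (hG : Good B b κ δ) {f : Vd d → ℝ} (hf : Measurable f) {N N' : ℕ} {μ ν : Measure (Vd d)}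
    (hμ : μ ∈ empiricalSphere d N) (hν : ν ∈ empiricalSphere d N') :
    Qf b (Del f) μ - Qf b (Del f) ν = (∫ v, Lo b f μ ν v ∂μ) - ∫ v, Lo b f μ ν v ∂ν := by
  have eμ := emp_of_mem hμ
  have eν := emp_of_mem hν
  simp only [Lo, Qf]
  rw [integral_add (eμ.int _) (eμ.int _), integral_add (eν.int _) (eν.int _)]
  have : ∫ v, ∫ vs, Ab b (Del f) v vs ∂ν ∂μ = ∫ v, ∫ vs, Ab b (Del f) v vs ∂μ ∂ν := by
    rw [emp_comm hμ hν]
    simp only [Ab_symm hG hf]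
  rw [this]; ring

lemma emp_le {R : ℝ} {μ : Measure (Vd d)} (hE : Emp R μ) {F k : Vd d → ℝ} (h : ∀ v, |F v| ≤ k v) :
    |∫ v, F v ∂μ| ≤ ∫ v, k v ∂μ :=
  (abs_integral_le_integral_abs).trans (emp_mono hE h)

lemma L1_sq (hG : Good B b κ δ) {f : Vd d → ℝ} (hf : f ∈ KK d) {R : ℝ} {μ : Measure (Vd d)} (hE : Emp R μ) (x : Vd d) :
    |∫ vs, Ab b (Del f) x vs ∂μ| ≤ 4 * Mo 2 μ * wt x ^ 2 := by
  refine (emp_le hE (k := fun vs => (4 * wt x ^ 2) * wt vs ^ 2) fun vs => ?_).trans (le_of_eq ?_)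
  · have h1 := A_up hG hf x vs
    have h2 := hf.1 x
    have h3 := rt_le x vs
    have o1 := one_le_wt x
    have o2 := one_le_wt vs
    have h4 : |Ab b (Del f) x vs| ≤ ‖x - vs‖ * (wt x + 2 * wt vs) + ‖x - vs‖ * wt x := by
      have e : Ab b (Del f) x vs = (Ab b (Del f) x vs + ‖x - vs‖ * f x) - ‖x - vs‖ * f x := by ring
      rw [e]
      refine (abs_sub _ _).trans (add_le_add h1 ?_)
      rw [abs_mul, abs_of_nonneg (norm_nonneg _)]; gcongr
    refine h4.trans ?_
    have h5 := wt_add_le x vs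
    calc _ = ‖x - vs‖ * (2 * (wt x + wt vs)) := by ring
      _ ≤ (wt x * wt vs) * (2 * (2 * (wt x * wt vs))) := by gcongr
      _ = _ := by ring
  · rw [integral_const_mul, Mo]; ring

lemma L1_lip (hG : Good B b κ δ) {f : Vd d → ℝ} (hf : f ∈ KK d) {R : ℝ} {μ : Measure (Vd d)} (hE : Emp R μ) (x y : Vd d) :
    |(∫ vs, Ab b (Del f) x vs ∂μ) - ∫ vs, Ab b (Del f) y vs ∂μ| ≤ 5 * κ * Mo 2 μ * (‖x - y‖ * (wt x ^ 2 + wt y ^ 2)) := by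
  rw [← integral_sub (hE.int _) (hE.int _)]
  have hκ := hG.κ1
  refine (emp_le hE (k := fun vs => (5 * κ * (‖x - y‖ * (wt x ^ 2 + wt y ^ 2))) * wt vs ^ 2) fun vs => ?_).trans (le_of_eq ?_)
  · have h1 := A_key hG hf x y vs
    have h2 := hf.2 x y
    have h3 := rt_le x vs
    have o1 := one_le_wt x
    have o2 := one_le_wt vs
    have o3 := one_le_wt y
    have h4 : |Ab b (Del f) x vs - Ab b (Del f) y vs| ≤ ‖x - y‖ * (‖x - vs‖ * (wt x + wt y + 2 * wt vs) + (κ + 1) * (wt y + wt vs))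
        + ‖x - vs‖ * (‖x - y‖ * (wt x + wt y)) := by
      have e : Ab b (Del f) x vs - Ab b (Del f) y vs = (Ab b (Del f) x vs - Ab b (Del f) y vs + ‖x - vs‖ * (f x - f y)) - ‖x - vs‖ * (f x - f y) := by ring
      rw [e]
      refine (abs_sub _ _).trans (add_le_add h1 ?_)
      rw [abs_mul, abs_of_nonneg (norm_nonneg _)]; gcongr
    refine h4.trans ?_
    have h5 := wt_add_le y vs
    calc _ = ‖x - y‖ * (‖x - vs‖ * (2 * (wt x + wt y + wt vs)) + (κ + 1) * (wt y + wt vs)) := by ring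
      _ ≤ ‖x - y‖ * ((wt x * wt vs) * (2 * (wt x * wt vs + wt y * wt vs + 1 * wt vs)) + (2 * κ) * (2 * (wt y * wt vs))) := by
          gcongr
          · exact le_mul_of_one_le_right (by linarith) o2
          · exact le_mul_of_one_le_right (by linarith) o2
          · linarith
          · linarith
      _ ≤ ‖x - y‖ * ((5 * κ * (wt x ^ 2 + wt y ^ 2)) * wt vs ^ 2) := by
          gcongr
          have a1 : wt vs ≤ wt vs ^ 2 := by nlinarith
          have a2 : wt y ≤ wt y ^ 2 := by nlinarith
          have a3 : wt x ≤ wt x ^ 2 := by nlinarith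
          have a4 : 2 * (wt x * wt y) ≤ wt x ^ 2 + wt y ^ 2 := by nlinarith [sq_nonneg (wt x - wt y)]
          have a5 : wt y * wt vs ≤ wt y ^ 2 * wt vs ^ 2 := by gcongr
          have a6 : (5 + 0 * κ) * wt x ^ 2 + wt y ^ 2 + 4 * κ * wt y ^ 2 ≤ 5 * κ * (wt x ^ 2 + wt y ^ 2) := by
            nlinarith [sq_nonneg (wt x), sq_nonneg (wt y)]
          calc _ = (2 * wt x ^ 2 + 2 * (wt x * wt y) + 2 * wt x) * wt vs ^ 2 + 4 * κ * (wt y * wt vs) := by ring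
            _ ≤ (2 * wt x ^ 2 + (wt x ^ 2 + wt y ^ 2) + 2 * wt x ^ 2) * wt vs ^ 2 + 4 * κ * (wt y ^ 2 * wt vs ^ 2) := by gcongr
            _ = ((5 + 0 * κ) * wt x ^ 2 + wt y ^ 2 + 4 * κ * wt y ^ 2) * wt vs ^ 2 := by ring
            _ ≤ _ := by gcongr
      _ = _ := by ring
  · rw [integral_const_mul, Mo]; ring

lemma Lo_K2 (hG : Good B b κ δ) {f : Vd d → ℝ} (hf : f ∈ KK d) {R R' Λ : ℝ} {μ ν : Measure (Vd d)}
    (hE : Emp R μ) (hE' : Emp R' ν) (hΛ0 : 0 < Λ) (hΛ : Mo 2 μ + Mo 2 ν ≤ Λ) :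
    (fun v => (5 * κ * Λ)⁻¹ * Lo b f μ ν v) ∈ K2 d := by
  have hκ := hG.κ1
  have h0 : 0 < 5 * κ * Λ := by positivity
  have m1 := Mo_nonneg 2 μ
  have m2 := Mo_nonneg 2 ν
  refine ⟨fun v => ?_, fun x y => ?_⟩
  · rw [abs_mul, abs_of_pos (inv_pos.2 h0), inv_mul_le_iff₀ h0]
    refine (abs_add_le _ _).trans ((add_le_add (L1_sq hG hf hE v) (L1_sq hG hf hE' v)).trans ?_)
    rw [← add_mul, ← mul_add]
    gcongr
    nlinarith
  · rw [← mul_sub, abs_mul, abs_of_pos (inv_pos.2 h0), inv_mul_le_iff₀ h0]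
    have e : Lo b f μ ν x - Lo b f μ ν y = ((∫ vs, Ab b (Del f) x vs ∂μ) - ∫ vs, Ab b (Del f) y vs ∂μ)
      + ((∫ vs, Ab b (Del f) x vs ∂ν) - ∫ vs, Ab b (Del f) y vs ∂ν) := by simp only [Lo]; ring
    rw [e]
    refine (abs_add_le _ _).trans ((add_le_add (L1_lip hG hf hE x y) (L1_lip hG hf hE' x y)).trans ?_)
    rw [← add_mul, ← mul_add]
    have := wt_pos x; have := wt_pos y
    gcongr

def tr (μ ν : Measure (Vd d)) (x : Vd d) : ℝ := (∫ vs, ‖x - vs‖ ∂μ) + ∫ vs, ‖x - vs‖ ∂ν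

lemma tr_le {R R' : ℝ} {μ ν : Measure (Vd d)} (hE : Emp R μ) (hE' : Emp R' ν) (x : Vd d) :
    tr μ ν x ≤ wt x * (Mo 2 μ + Mo 2 ν) := by
  have : ∀ vs : Vd d, ‖x - vs‖ ≤ wt x * wt vs ^ 2 := fun vs => by
    refine (rt_le x vs).trans ?_
    have := wt_pos x
    have := one_le_wt vs
    gcongr
    nlinarith
  have h1 := emp_mono hE this
  have h2 := emp_mono hE' this
  rw [integral_const_mul] at h1 h2
  rw [tr, mul_add]
  exact add_le_add h1 h2

lemma L1_up (hG : Good B b κ δ) {f : Vd d → ℝ} (hf : f ∈ KK d) {R : ℝ} {μ : Measure (Vd d)} (hE : Emp R μ) (x : Vd d) :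
    |(∫ vs, Ab b (Del f) x vs ∂μ) + (∫ vs, ‖x - vs‖ ∂μ) * f x| ≤ (∫ vs, ‖x - vs‖ ∂μ) * wt x + 2 * wt x * Mo 2 μ := by
  have e : (∫ vs, Ab b (Del f) x vs ∂μ) + (∫ vs, ‖x - vs‖ ∂μ) * f x = ∫ vs, (Ab b (Del f) x vs + ‖x - vs‖ * f x) ∂μ := by
    rw [integral_add (hE.int _) (hE.int _), integral_mul_const]
  rw [e]
  refine (emp_le hE (k := fun vs => ‖x - vs‖ * wt x + 2 * wt x * wt vs ^ 2) fun vs => (A_up hG hf x vs).trans ?_).trans (le_of_eq ?_)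
  · have h3 := rt_le x vs
    have := wt_pos vs
    calc _ = ‖x - vs‖ * wt x + ‖x - vs‖ * (2 * wt vs) := by ring
      _ ≤ ‖x - vs‖ * wt x + (wt x * wt vs) * (2 * wt vs) := by gcongr
      _ = _ := by ring
  · rw [integral_add (hE.int _) (hE.int _), integral_mul_const, integral_const_mul, Mo]

lemma L1_key (hG : Good B b κ δ) {f : Vd d → ℝ} (hf : f ∈ KK d) {R : ℝ} {μ : Measure (Vd d)} (hE : Emp R μ) (x y : Vd d) :
    |(∫ vs, Ab b (Del f) x vs ∂μ) - (∫ vs, Ab b (Del f) y vs ∂μ) + (∫ vs, ‖x - vs‖ ∂μ) * (f x - f y)| ≤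
      ‖x - y‖ * ((∫ vs, ‖x - vs‖ ∂μ) * (wt x + wt y) + 6 * κ * Mo 2 μ * (wt x + wt y)) := by
  have hκ := hG.κ1
  have e : (∫ vs, Ab b (Del f) x vs ∂μ) - (∫ vs, Ab b (Del f) y vs ∂μ) + (∫ vs, ‖x - vs‖ ∂μ) * (f x - f y)
      = ∫ vs, (Ab b (Del f) x vs - Ab b (Del f) y vs + ‖x - vs‖ * (f x - f y)) ∂μ := by
    rw [integral_add (hE.int _) (hE.int _), integral_sub (hE.int _) (hE.int _), integral_mul_const]
  rw [e]
  refine (emp_le hE (k := fun vs => ‖x - y‖ * (‖x - vs‖ * (wt x + wt y) + 6 * κ * wt vs ^ 2 * (wt x + wt y)))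
    fun vs => (A_key hG hf x y vs).trans ?_).trans (le_of_eq ?_)
  · have h3 := rt_le x vs
    have o1 := one_le_wt x
    have o2 := one_le_wt vs
    have o3 := one_le_wt y
    have h5 := wt_add_le y vs
    have a1 : wt vs ≤ wt vs ^ 2 := by nlinarith
    refine mul_le_mul_of_nonneg_left ?_ (norm_nonneg _)
    calc _ = ‖x - vs‖ * (wt x + wt y) + (‖x - vs‖ * (2 * wt vs) + (κ + 1) * (wt y + wt vs)) := by ring
      _ ≤ ‖x - vs‖ * (wt x + wt y) + ((wt x * wt vs) * (2 * wt vs) + (2 * κ) * (2 * (wt y * wt vs ^ 2))) := by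
          gcongr
          · linarith
          · refine h5.trans ?_
            gcongr
      _ ≤ _ := by
          have q1 : 0 ≤ wt x * wt vs ^ 2 := by positivity
          have q2 : 0 ≤ κ * (wt y * wt vs ^ 2) := by positivity
          have q3 : wt x * wt vs ^ 2 ≤ κ * (wt x * wt vs ^ 2) := le_mul_of_one_le_left q1 hκ
          linarith
  · rw [integral_const_mul, integral_add (hE.int _) (hE.int _), integral_mul_const]
    have : ∫ vs, 6 * κ * wt vs ^ 2 * (wt x + wt y) ∂μ = 6 * κ * Mo 2 μ * (wt x + wt y) := by
      rw [integral_mul_const, integral_const_mul, Mo]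
    rw [this]

lemma clp_wt {R : ℝ} (hR : 0 ≤ R) (x : Vd d) : wt (clp R x) ≤ wt x := by
  unfold wt
  have : ‖clp R x‖ ≤ ‖x‖ := by
    have := clp_lip R x 0
    rw [sub_zero, clp_eq (x := (0 : Vd d)) (by simpa using hR), sub_zero] at this
    exact this
  gcongr

lemma step_KK (hG : Good B b κ δ) {f : Vd d → ℝ} (hf : f ∈ KK d) {R R' Λ h Rc : ℝ} {μ ν : Measure (Vd d)}
    (hE : Emp R μ) (hE' : Emp R' ν) (hΛ0 : 0 < Λ) (hΛ : Mo 2 μ + Mo 2 ν ≤ Λ) (hh : 0 ≤ h) (hR : 0 ≤ Rc)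
    (hsm : h * ((1 + (d * Rc) ^ 2) * Λ) ≤ 1) :
    (fun v => (1 + h * (6 * κ * Λ))⁻¹ * (f (clp Rc v) + h * Lo b f μ ν (clp Rc v))) ∈ KK d := by
  have hκ := hG.κ1
  have h0 : 0 < 1 + h * (6 * κ * Λ) := by positivity
  have m1 := Mo_nonneg 2 μ
  have m2 := Mo_nonneg 2 ν
  have hsmall : ∀ v : Vd d, 0 ≤ 1 - h * tr μ ν (clp Rc v) := fun v => by
    have h1 := tr_le hE hE' (clp Rc v)
    have h2 : wt (clp Rc v) ≤ 1 + (d * Rc) ^ 2 := by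
      have := clp_norm hR v; unfold wt; gcongr
    have : h * tr μ ν (clp Rc v) ≤ h * ((1 + (d * Rc) ^ 2) * Λ) := by
      refine mul_le_mul_of_nonneg_left (h1.trans ?_) hh
      gcongr
    linarith
  have up : ∀ x : Vd d, |Lo b f μ ν x + tr μ ν x * f x| ≤ tr μ ν x * wt x + 2 * wt x * Λ := fun x => by
    have a1 := L1_up hG hf hE x
    have a2 := L1_up hG hf hE' x
    have e : Lo b f μ ν x + tr μ ν x * f x = ((∫ vs, Ab b (Del f) x vs ∂μ) + (∫ vs, ‖x - vs‖ ∂μ) * f x)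
      + ((∫ vs, Ab b (Del f) x vs ∂ν) + (∫ vs, ‖x - vs‖ ∂ν) * f x) := by simp only [Lo, tr]; ring
    rw [e]
    refine (abs_add_le _ _).trans ((add_le_add a1 a2).trans ?_)
    have p := wt_pos x
    have : 2 * wt x * (Mo 2 μ + Mo 2 ν) ≤ 2 * wt x * Λ := by gcongr
    simp only [tr]; linarith
  have key : ∀ x y : Vd d, |Lo b f μ ν x - Lo b f μ ν y + tr μ ν x * (f x - f y)| ≤
      ‖x - y‖ * (tr μ ν x * (wt x + wt y) + 6 * κ * Λ * (wt x + wt y)) := fun x y => by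
    have a1 := L1_key hG hf hE x y
    have a2 := L1_key hG hf hE' x y
    have e : Lo b f μ ν x - Lo b f μ ν y + tr μ ν x * (f x - f y) =
      ((∫ vs, Ab b (Del f) x vs ∂μ) - (∫ vs, Ab b (Del f) y vs ∂μ) + (∫ vs, ‖x - vs‖ ∂μ) * (f x - f y))
      + ((∫ vs, Ab b (Del f) x vs ∂ν) - (∫ vs, Ab b (Del f) y vs ∂ν) + (∫ vs, ‖x - vs‖ ∂ν) * (f x - f y)) := by
      simp only [Lo, tr]; ring
    rw [e]
    refine (abs_add_le _ _).trans ((add_le_add a1 a2).trans ?_)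
    have p := wt_pos x
    have p' := wt_pos y
    rw [← mul_add]
    refine mul_le_mul_of_nonneg_left ?_ (norm_nonneg _)
    have : 6 * κ * (Mo 2 μ + Mo 2 ν) * (wt x + wt y) ≤ 6 * κ * Λ * (wt x + wt y) := by gcongr
    simp only [tr]; linarith
  refine ⟨fun v => ?_, fun v w => ?_⟩
  · rw [abs_mul, abs_of_pos (inv_pos.2 h0), inv_mul_le_iff₀ h0]
    refine le_trans ?_ (mul_le_mul_of_nonneg_left (clp_wt hR v) h0.le)
    have hs := hsmall v
    set x := clp Rc v
    have e : f x + h * Lo b f μ ν x = (1 - h * tr μ ν x) * f x + h * (Lo b f μ ν x + tr μ ν x * f x) := by ring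
    have p := wt_pos x
    rw [e]
    calc _ ≤ _ := abs_add_le _ _
      _ ≤ (1 - h * tr μ ν x) * wt x + h * (tr μ ν x * wt x + 2 * wt x * Λ) := by
          rw [abs_mul, abs_mul, abs_of_nonneg hs, abs_of_nonneg hh]
          exact add_le_add (mul_le_mul_of_nonneg_left (hf.1 x) hs) (mul_le_mul_of_nonneg_left (up x) hh)
      _ = wt x + h * (2 * 1 * Λ) * wt x := by ring
      _ ≤ wt x + h * (6 * κ * Λ) * wt x := by gcongr; norm_num
      _ = _ := by ring
  · rw [← mul_sub, abs_mul, abs_of_pos (inv_pos.2 h0), inv_mul_le_iff₀ h0]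
    have c1 := clp_wt hR v
    have c2 := clp_wt hR w
    have c3 := clp_lip Rc v w
    have hs := hsmall v
    set x := clp Rc v
    set y := clp Rc w
    have e : f x + h * Lo b f μ ν x - (f y + h * Lo b f μ ν y) = (1 - h * tr μ ν x) * (f x - f y)
      + h * (Lo b f μ ν x - Lo b f μ ν y + tr μ ν x * (f x - f y)) := by ring
    have p := wt_pos x
    have p' := wt_pos y
    rw [e]
    calc _ ≤ _ := abs_add_le _ _
      _ ≤ (1 - h * tr μ ν x) * (‖x - y‖ * (wt x + wt y)) + h * (‖x - y‖ * (tr μ ν x * (wt x + wt y) + 6 * κ * Λ * (wt x + wt y))) := by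
          rw [abs_mul, abs_mul, abs_of_nonneg hs, abs_of_nonneg hh]
          exact add_le_add (mul_le_mul_of_nonneg_left (hf.2 x y) hs) (mul_le_mul_of_nonneg_left (key x y) hh)
      _ = (1 + h * (6 * κ * Λ)) * (‖x - y‖ * (wt x + wt y)) := by ring
      _ ≤ _ := by gcongr

end partV


section partX

variable {d N N' : ℕ} {B : Vd d → Measure (Vd d)} {b : Kernel (Vd d × Vd d) (Vd d)} {κ δ : ℝ}
  {Ω : Type} {m0 : MeasurableSpace Ω} {P : Measure Ω} [IsProbabilityMeasure P] {𝓕 : Filtration ℝ m0} {m n : ℝ → Ω → Measure (Vd d)}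

def et (b : Kernel (Vd d × Vd d) (Vd d)) (m n : ℝ → Ω → Measure (Vd d)) (τ : ℝ) (f : Vd d → ℝ) (t : ℝ) (ω : Ω) : ℝ :=
  ((∫ v, f v ∂(m t ω)) - ∫ v, f v ∂(n t ω)) - (Mt b m τ f t ω - Mt b n τ f t ω)

lemma et_lin (hG : Good B b κ δ) (hm : IsKacProcess B N P 𝓕 m) (hn : IsKacProcess B N' P 𝓕 n) {f g : Vd d → ℝ}
    (hf : LB f) (hg : LB g) (c h τ t : ℝ) (ω : Ω) :
    et b m n τ (fun v => c * (f v + h * g v)) t ω = c * (et b m n τ f t ω + h * et b m n τ g t ω) := by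
  have Em := emp_of_mem (hm.mem t ω)
  have En := emp_of_mem (hn.mem t ω)
  simp only [et, Mt_smul, Mt_add2 hG hm hf (hg.smul h), Mt_add2 hG hn hf (hg.smul h), integral_const_mul]
  rw [integral_add (Em.int _) (Em.int _), integral_add (En.int _) (En.int _), integral_const_mul, integral_const_mul]
  ring

lemma et_congr (hG : Good B b κ δ) (hm : IsKacProcess B N P 𝓕 m) (hn : IsKacProcess B N' P 𝓕 n) {f g : Vd d → ℝ}
    {Rc : ℝ} (h1 : 2 * √N ≤ Rc) (h2 : 2 * √N' ≤ Rc) (hfg : ∀ v, ‖v‖ ≤ Rc → f v = g v) (τ t : ℝ) (ω : Ω) :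
    et b m n τ f t ω = et b m n τ g t ω := by
  have s1 := Real.sqrt_nonneg (N:ℝ)
  have s2 := Real.sqrt_nonneg (N':ℝ)
  have e1 : ∫ v, f v ∂(m t ω) = ∫ v, g v ∂(m t ω) := by
    refine integral_congr_ae ?_
    filter_upwards [(emp_of_mem (hm.mem t ω)).ball] with v hv using hfg v (by linarith)
  have e2 : ∫ v, f v ∂(n t ω) = ∫ v, g v ∂(n t ω) := by
    refine integral_congr_ae ?_
    filter_upwards [(emp_of_mem (hn.mem t ω)).ball] with v hv using hfg v (by linarith)
  rw [et, et, e1, e2, Mt_congr hG hm (fun v hv => hfg v (hv.trans h1)), Mt_congr hG hn (fun v hv => hfg v (hv.trans h2))]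

lemma et_incr (hG : Good B b κ δ) (hm : IsKacProcess B N P 𝓕 m) (hn : IsKacProcess B N' P 𝓕 n) {f : Vd d → ℝ}
    (hf : LB f) (τ s t : ℝ) (ω : Ω) :
    et b m n τ f t ω = et b m n τ f s ω + ∫ r in s..t, (Qf b (Del f) (m r ω) - Qf b (Del f) (n r ω)) := by
  have i1 := kp_Q_ii hG hm hf ω
  have i2 := kp_Q_ii hG hn hf ω
  rw [intervalIntegral.integral_sub (i1 s t) (i2 s t)]
  simp only [et, Mt]
  rw [← intervalIntegral.integral_add_adjacent_intervals (i1 τ s) (i1 s t),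
    ← intervalIntegral.integral_add_adjacent_intervals (i2 τ s) (i2 s t)]
  ring

lemma et_start (f : Vd d → ℝ) (τ : ℝ) (ω : Ω) :
    et b m n τ f τ ω = (∫ v, f v ∂(m τ ω)) - ∫ v, f v ∂(n τ ω) := by
  simp [et, Mt]

lemma et_lip (hG : Good B b κ δ) (hm : IsKacProcess B N P 𝓕 m) (hn : IsKacProcess B N' P 𝓕 n) {g : Vd d → ℝ}
    (hg : g ∈ K2 d) {Rc : ℝ} (h1 : 2 * √N ≤ Rc) (h2 : 2 * √N' ≤ Rc) (τ : ℝ) {s t : ℝ} (hst : s ≤ t) (ω : Ω) :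
    |et b m n τ g t ω - et b m n τ g s ω| ≤ (2 * Rc * (4 * (1 + Rc ^ 2) ^ 2)) * (t - s) := by
  rw [et_incr hG hm hn (LB_cont (K2_cont hg)) τ s t ω, add_sub_cancel_left]
  refine ii_abs_le hst fun r _ => ?_
  have s1 := Real.sqrt_nonneg (N:ℝ)
  have s2 := Real.sqrt_nonneg (N':ℝ)
  have gb : ∀ v, ‖v‖ ≤ Rc → |g v| ≤ (1 + Rc ^ 2) ^ 2 := fun v hv => by
    refine (hg.1 v).trans ?_
    unfold wt
    gcongr
  have q1 := Qf_bdd hG (emp_of_mem (hm.mem r ω)) (Del g) (K := 4 * (1 + Rc ^ 2) ^ 2) (by positivity)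
    (fun v vs σ hσ hv hvs => del_bdd (fun v hv => gb v (hv.trans h1)) hσ hv hvs)
  have q2 := Qf_bdd hG (emp_of_mem (hn.mem r ω)) (Del g) (K := 4 * (1 + Rc ^ 2) ^ 2) (by positivity)
    (fun v vs σ hσ hv hvs => del_bdd (fun v hv => gb v (hv.trans h2)) hσ hv hvs)
  refine (abs_sub _ _).trans ((add_le_add q1 q2).trans ?_)
  have : 0 ≤ 4 * (1 + Rc ^ 2) ^ 2 := by positivity
  rw [← add_mul]
  exact mul_le_mul_of_nonneg_right (by linarith) this

lemma et_step (hG : Good B b κ δ) (hm : IsKacProcess B N P 𝓕 m) (hn : IsKacProcess B N' P 𝓕 n)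
    {Rc : ℝ} (h1 : 2 * √N ≤ Rc) (h2 : 2 * √N' ≤ Rc) {τ T Λ ε₀ : ℝ} {ω : Ω} (hΛ0 : 0 < Λ)
    (hΛ : ∀ t, τ ≤ t → t ≤ T → Mo 2 (m t ω) + Mo 2 (n t ω) ≤ Λ)
    (hM : ∀ t, τ ≤ t → t ≤ T → ∀ g ∈ K2 d, |Mt b m τ g t ω - Mt b n τ g t ω| ≤ ε₀)
    {s h a : ℝ} (hs : τ ≤ s) (hh : 0 < h) (hT : s + h ≤ T) (hsm : h * ((1 + (d * Rc) ^ 2) * Λ) ≤ 1)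
    (ha : ∀ f ∈ KK d, et b m n τ f s ω ≤ a) {f : Vd d → ℝ} (hf : f ∈ KK d) :
    et b m n τ f (s + h) ω ≤ (1 + h * (6 * κ * Λ)) * a
      + h * (5 * κ * Λ * (ε₀ + (2 * Rc * (4 * (1 + Rc ^ 2) ^ 2)) * h)) := by
  have hκ := hG.κ1
  have s1 := Real.sqrt_nonneg (N:ℝ)
  have hR : 0 ≤ Rc := by linarith
  have hfL := LB_cont (KK_cont hf)
  have h0 : 0 < 1 + h * (6 * κ * Λ) := by positivity
  have h5 : 0 < 5 * κ * Λ := by positivity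
  rw [et_incr hG hm hn hfL τ s (s + h) ω]
  set β := 5 * κ * Λ * (ε₀ + (2 * Rc * (4 * (1 + Rc ^ 2) ^ 2)) * h) with hβ
  have key : ∀ r ∈ Set.Icc s (s + h), Qf b (Del f) (m r ω) - Qf b (Del f) (n r ω) ≤
      ((1 + h * (6 * κ * Λ)) * a - et b m n τ f s ω) / h + β := by
    intro r hr
    have hr1 : τ ≤ r := hs.trans hr.1
    have hr2 : r ≤ T := hr.2.trans hT
    have Em := emp_of_mem (hm.mem r ω)
    have En := emp_of_mem (hn.mem r ω)
    have gK := Lo_K2 hG hf Em En hΛ0 (hΛ r hr1 hr2)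
    have gS := step_KK hG hf Em En hΛ0 (hΛ r hr1 hr2) hh.le hR hsm
    rw [q_eq hG (KK_cont hf).measurable (hm.mem r ω) (hn.mem r ω)]
    set L := Lo b f (m r ω) (n r ω) with hL
    set g : Vd d → ℝ := fun v => (5 * κ * Λ)⁻¹ * L v with hg
    have gL := LB_cont (K2_cont gK)
    have eL : ∀ v, L v = (5 * κ * Λ) * g v := fun v => by rw [hg]; field_simp
    have e1 : et b m n τ (fun v => (1 + h * (6 * κ * Λ))⁻¹ * (f (clp Rc v) + h * L (clp Rc v))) s ω
        = (1 + h * (6 * κ * Λ))⁻¹ * (et b m n τ f s ω + (h * (5 * κ * Λ)) * et b m n τ g s ω) := by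
      rw [← et_lin hG hm hn hfL gL]
      refine et_congr hG hm hn h1 h2 (fun v hv => ?_) _ _ _
      rw [clp_eq hv, eL, mul_assoc h]
    have e2 := ha _ gS
    rw [e1, inv_mul_le_iff₀ h0] at e2
    have e3 := (abs_le.1 (et_lip hG hm hn gK h1 h2 τ hr.1 ω)).2
    have e4 := (abs_le.1 (hM r hr1 hr2 g gK)).2
    have e5 : (∫ v, L v ∂(m r ω)) - ∫ v, L v ∂(n r ω) = (5 * κ * Λ) *
        (et b m n τ g r ω + (Mt b m τ g r ω - Mt b n τ g r ω)) := by
      simp only [eL, integral_const_mul, et]; ring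
    rw [e5]
    have e6 : (2 * Rc * (4 * (1 + Rc ^ 2) ^ 2)) * (r - s) ≤ (2 * Rc * (4 * (1 + Rc ^ 2) ^ 2)) * h := by
      gcongr
      linarith [hr.2]
    have e7 : (5 * κ * Λ) * et b m n τ g s ω ≤ ((1 + h * (6 * κ * Λ)) * a - et b m n τ f s ω) / h := by
      rw [le_div_iff₀ hh]
      linarith
    calc _ ≤ (5 * κ * Λ) * (et b m n τ g s ω + (ε₀ + (2 * Rc * (4 * (1 + Rc ^ 2) ^ 2)) * h)) := by
          refine mul_le_mul_of_nonneg_left ?_ h5.le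
          linarith
      _ = (5 * κ * Λ) * et b m n τ g s ω + β := by rw [hβ]; ring
      _ ≤ _ := by linarith
  have i := intervalIntegral.integral_mono_on (a := s) (b := s + h) (by linarith)
    ((kp_Q_ii hG hm hfL ω s (s + h)).sub (kp_Q_ii hG hn hfL ω s (s + h))) intervalIntegrable_const key
  rw [intervalIntegral.integral_const, smul_eq_mul, add_sub_cancel_left, mul_add, mul_div_cancel₀ _ hh.ne'] at i
  linarith

lemma et_iter (hG : Good B b κ δ) (hm : IsKacProcess B N P 𝓕 m) (hn : IsKacProcess B N' P 𝓕 n)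
    {Rc : ℝ} (h1 : 2 * √N ≤ Rc) (h2 : 2 * √N' ≤ Rc) {τ T Λ ε₀ : ℝ} {ω : Ω} (hΛ0 : 0 < Λ) (hε₀ : 0 ≤ ε₀)
    (hΛ : ∀ t, τ ≤ t → t ≤ T → Mo 2 (m t ω) + Mo 2 (n t ω) ≤ Λ)
    (hM : ∀ t, τ ≤ t → t ≤ T → ∀ g ∈ K2 d, |Mt b m τ g t ω - Mt b n τ g t ω| ≤ ε₀)
    {h a : ℝ} (hh : 0 < h) (hsm : h * ((1 + (d * Rc) ^ 2) * Λ) ≤ 1) (ha0 : 0 ≤ a)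
    (ha : ∀ f ∈ KK d, et b m n τ f τ ω ≤ a) (j : ℕ) (hj : τ + j * h ≤ T) :
    ∀ f ∈ KK d, et b m n τ f (τ + j * h) ω ≤ (1 + h * (6 * κ * Λ)) ^ j *
      (a + j * h * (5 * κ * Λ * (ε₀ + (2 * Rc * (4 * (1 + Rc ^ 2) ^ 2)) * h))) := by
  have hκ := hG.κ1
  have s1 := Real.sqrt_nonneg (N:ℝ)
  have hR : 0 ≤ Rc := by linarith
  have hβ : 0 ≤ 5 * κ * Λ * (ε₀ + (2 * Rc * (4 * (1 + Rc ^ 2) ^ 2)) * h) := by positivity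
  have hc : 1 ≤ 1 + h * (6 * κ * Λ) := le_add_of_nonneg_right (by positivity)
  induction j with
  | zero => simpa using ha
  | succ j ih =>
    push_cast at hj ⊢
    intro f hf
    have ih' := ih (by linarith)
    have e : τ + (j + 1) * h = τ + j * h + h := by ring
    rw [e]
    refine (et_step hG hm hn h1 h2 hΛ0 hΛ hM (le_add_of_nonneg_right (by positivity)) hh (by linarith) hsm ih' hf).trans ?_
    set β := 5 * κ * Λ * (ε₀ + (2 * Rc * (4 * (1 + Rc ^ 2) ^ 2)) * h)
    have : h * β ≤ (1 + h * (6 * κ * Λ)) ^ (j + 1) * (h * β) :=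
      le_mul_of_one_le_left (by positivity) (one_le_pow₀ hc)
    calc _ ≤ (1 + h * (6 * κ * Λ)) * ((1 + h * (6 * κ * Λ)) ^ j * (a + j * h * β)) + (1 + h * (6 * κ * Λ)) ^ (j + 1) * (h * β) := by linarith
      _ = _ := by ring

lemma stab (hG : Good B b κ δ) (hm : IsKacProcess B N P 𝓕 m) (hn : IsKacProcess B N' P 𝓕 n)
    {τ T Λ ε₀ : ℝ} {ω : Ω} (hΛ0 : 0 < Λ) (hε₀ : 0 ≤ ε₀)
    (hΛ : ∀ t, τ ≤ t → t ≤ T → Mo 2 (m t ω) + Mo 2 (n t ω) ≤ Λ)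
    (hM : ∀ t, τ ≤ t → t ≤ T → ∀ g ∈ K2 d, |Mt b m τ g t ω - Mt b n τ g t ω| ≤ ε₀)
    {a : ℝ} (ha0 : 0 ≤ a) (ha : ∀ f ∈ KK d, (∫ v, f v ∂(m τ ω)) - ∫ v, f v ∂(n τ ω) ≤ a)
    {t : ℝ} (ht : τ ≤ t) (htT : t ≤ T) {f : Vd d → ℝ} (hf : f ∈ KK d) :
    (∫ v, f v ∂(m t ω)) - ∫ v, f v ∂(n t ω) ≤
      Real.exp (6 * κ * Λ * (T - τ)) * (a + (T - τ) * (5 * κ * Λ * ε₀)) + ε₀ := by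
  have hκ := hG.κ1
  have s1 := Real.sqrt_nonneg (N:ℝ)
  have hfK2 : f ∈ K2 d := by
    refine ⟨fun v => (hf.1 v).trans ?_, fun x y => (hf.2 x y).trans ?_⟩
    · have := one_le_wt v; nlinarith
    · have o1 := one_le_wt x
      have o2 := one_le_wt y
      refine mul_le_mul_of_nonneg_left ?_ (norm_nonneg _)
      nlinarith
  have e : (∫ v, f v ∂(m t ω)) - ∫ v, f v ∂(n t ω) = et b m n τ f t ω + (Mt b m τ f t ω - Mt b n τ f t ω) := by
    rw [et]; ring
  rw [e]
  refine add_le_add ?_ (abs_le.1 (hM t ht htT f hfK2)).2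
  set Rc := max (2 * √(N:ℝ)) (2 * √N') with hRc
  have h1 : 2 * √(N:ℝ) ≤ Rc := le_max_left _ _
  have h2 : 2 * √(N':ℝ) ≤ Rc := le_max_right _ _
  have hR : 0 ≤ Rc := by linarith
  rcases eq_or_lt_of_le ht with rfl | hlt
  · rw [et_start]
    refine (ha f hf).trans ?_
    have p : 0 ≤ (T - τ) * (5 * κ * Λ * ε₀) := mul_nonneg (by linarith) (by positivity)
    have o : 1 ≤ Real.exp (6 * κ * Λ * (T - τ)) := Real.one_le_exp (mul_nonneg (by positivity) (by linarith))
    nlinarith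
  set K := 2 * Rc * (4 * (1 + Rc ^ 2) ^ 2) with hK
  have hK0 : 0 ≤ K := by positivity
  have hu : 0 < t - τ := by linarith
  have lim : Tendsto (fun k : ℕ => Real.exp (6 * κ * Λ * (T - τ)) * (a + (T - τ) * (5 * κ * Λ * (ε₀ + K * ((t - τ) / k)))))
      atTop (nhds (Real.exp (6 * κ * Λ * (T - τ)) * (a + (T - τ) * (5 * κ * Λ * (ε₀ + K * 0))))) := by
    refine Tendsto.const_mul _ (Tendsto.const_add _ (Tendsto.const_mul _ (Tendsto.const_mul _ (Tendsto.const_add _ (Tendsto.const_mul _ ?_)))))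
    exact tendsto_const_div_atTop_nhds_zero_nat _
  rw [mul_zero, add_zero] at lim
  refine ge_of_tendsto lim ?_
  obtain ⟨k0, hk0⟩ := exists_nat_ge ((t - τ) * ((1 + (d * Rc) ^ 2) * Λ))
  filter_upwards [eventually_ge_atTop (max k0 1)] with k hk
  have hk1 : 0 < (k:ℝ) := by
    have : 1 ≤ k := (le_max_right _ _).trans hk
    exact_mod_cast this
  have hk2 : (k0:ℝ) ≤ k := by exact_mod_cast (le_max_left _ _).trans hk
  have hh : 0 < (t - τ) / k := by positivity
  have ekh : (k:ℝ) * ((t - τ) / k) = t - τ := by field_simp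
  have hsm : (t - τ) / k * ((1 + (d * Rc) ^ 2) * Λ) ≤ 1 := by
    rw [div_mul_eq_mul_div, div_le_one hk1]; linarith
  have := et_iter hG hm hn h1 h2 hΛ0 hε₀ hΛ hM hh hsm ha0 (fun f hf => by rw [et_start]; exact ha f hf) k
    (by rw [ekh]; linarith) f hf
  rw [ekh, ← hK, add_sub_cancel] at this
  refine this.trans ?_
  have ex : (1 + (t - τ) / k * (6 * κ * Λ)) ^ k ≤ Real.exp (6 * κ * Λ * (T - τ)) := by
    calc _ ≤ (Real.exp ((t - τ) / k * (6 * κ * Λ))) ^ k := by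
          refine pow_le_pow_left₀ (by positivity) ?_ k
          linarith [Real.add_one_le_exp ((t - τ) / k * (6 * κ * Λ))]
      _ = Real.exp (6 * κ * Λ * (t - τ)) := by
          rw [← Real.exp_nat_mul]; congr 1; rw [← mul_assoc, ekh]; ring
      _ ≤ _ := by gcongr
  have p2 : 0 ≤ 5 * κ * Λ * (ε₀ + K * ((t - τ) / k)) := by positivity
  refine mul_le_mul ex ?_ (add_nonneg ha0 (mul_nonneg hu.le p2)) (Real.exp_pos _).le
  have : (t - τ) * (5 * κ * Λ * (ε₀ + K * ((t - τ) / k))) ≤ (T - τ) * (5 * κ * Λ * (ε₀ + K * ((t - τ) / k))) :=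
    mul_le_mul_of_nonneg_right (by linarith) p2
  linarith

end partX


section partY

variable {d N N' : ℕ} {B : Vd d → Measure (Vd d)} {b : Kernel (Vd d × Vd d) (Vd d)} {κ δ : ℝ}

lemma wt_lip (x y : Vd d) : |wt x - wt y| ≤ ‖x - y‖ * (‖x‖ + ‖y‖) := by
  have h1 : |‖x‖ - ‖y‖| ≤ ‖x - y‖ := abs_norm_sub_norm_le x y
  have e : wt x - wt y = (‖x‖ - ‖y‖) * (‖x‖ + ‖y‖) := by unfold wt; ring
  rw [e, abs_mul, abs_of_nonneg (by positivity : 0 ≤ ‖x‖ + ‖y‖)]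
  gcongr

lemma two_norm_le_wt (x : Vd d) : 2 * ‖x‖ ≤ wt x := by
  unfold wt; nlinarith [sq_nonneg (‖x‖ - 1)]

lemma testF_KK {f : Vd d → ℝ} (hf : f ∈ testF d) : (fun v => (2:ℝ)⁻¹ * f v) ∈ KK d := by
  have e : ∀ v, f v = wt v * (f v / (1 + ‖v‖ ^ 2)) := fun v => by
    have := (wt_pos v).ne'
    rw [← wt]; field_simp
  have a1 : ∀ v, |f v| ≤ wt v := fun v => by
    rw [e v, abs_mul, abs_of_pos (wt_pos v)]
    exact mul_le_of_le_one_right (wt_pos v).le (hf.1 v)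
  refine ⟨fun v => ?_, fun x y => ?_⟩
  · rw [abs_mul, abs_of_pos (by norm_num : (0:ℝ) < 2⁻¹)]
    linarith [a1 v, abs_nonneg (f v)]
  · rw [← mul_sub, abs_mul, abs_of_pos (by norm_num : (0:ℝ) < 2⁻¹)]
    have h1 := hf.2 x y
    have h2 := hf.1 y
    have w := wt_lip x y
    have n1 := two_norm_le_wt x
    have n2 := two_norm_le_wt y
    have p := wt_pos x
    have p' := wt_pos y
    have : f x - f y = wt x * (f x / (1 + ‖x‖ ^ 2) - f y / (1 + ‖y‖ ^ 2)) + (wt x - wt y) * (f y / (1 + ‖y‖ ^ 2)) := by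
      have q1 := e x
      have q2 := e y
      linear_combination q1 - q2
    have b1 : |f x - f y| ≤ wt x * ‖x - y‖ + ‖x - y‖ * (‖x‖ + ‖y‖) * 1 := by
      rw [this]
      refine (abs_add_le _ _).trans ?_
      rw [abs_mul, abs_mul, abs_of_pos p]
      gcongr
    have b2 : ‖x - y‖ * (‖x‖ + ‖y‖) ≤ ‖x - y‖ * ((wt x + wt y) / 2) :=
      mul_le_mul_of_nonneg_left (by linarith) (norm_nonneg _)
    have b3 : 0 ≤ ‖x - y‖ * wt y := by positivity
    have b4 : 0 ≤ ‖x - y‖ * wt x := by positivity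
    linarith

lemma KK_testF {f : Vd d → ℝ} (hf : f ∈ KK d) : (fun v => (3:ℝ)⁻¹ * f v) ∈ testF d := by
  have main : ∀ x y : Vd d, wt y ≤ wt x →
      |3⁻¹ * f x / (1 + ‖x‖ ^ 2) - 3⁻¹ * f y / (1 + ‖y‖ ^ 2)| ≤ ‖x - y‖ := by
    intro x y hxy
    have p := wt_pos x
    have p' := wt_pos y
    have hn : ‖y‖ ≤ ‖x‖ := by
      unfold wt at hxy
      exact le_of_sq_le_sq (by linarith) (norm_nonneg _)
    have w := wt_lip x y
    have n1 := two_norm_le_wt x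
    change |3⁻¹ * f x / wt x - 3⁻¹ * f y / wt y| ≤ ‖x - y‖
    have e : 3⁻¹ * f x / wt x - 3⁻¹ * f y / wt y = ((f x - f y) - (wt x - wt y) * (f y / wt y)) / (3 * wt x) := by
      field_simp; ring
    rw [e, abs_div, abs_of_pos (by positivity : 0 < 3 * wt x), div_le_iff₀ (by positivity)]
    have h1 : |f y / wt y| ≤ 1 := by
      rw [abs_div, abs_of_pos p', div_le_one p']; exact hf.1 y
    have b1 : |(f x - f y) - (wt x - wt y) * (f y / wt y)| ≤ ‖x - y‖ * (wt x + wt y) + ‖x - y‖ * (‖x‖ + ‖y‖) * 1 := by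
      refine (abs_sub _ _).trans (add_le_add (hf.2 x y) ?_)
      rw [abs_mul]
      gcongr
    have b2 : ‖x - y‖ * (wt x + wt y) + ‖x - y‖ * (‖x‖ + ‖y‖) * 1 = ‖x - y‖ * (wt x + wt y + (‖x‖ + ‖y‖)) := by ring
    rw [b2] at b1
    exact b1.trans (mul_le_mul_of_nonneg_left (by linarith) (norm_nonneg _))
  refine ⟨fun v => ?_, fun x y => ?_⟩
  · have p := wt_pos v
    change |3⁻¹ * f v / wt v| ≤ 1
    rw [abs_div, abs_of_pos p, div_le_one p, abs_mul, abs_of_pos (by norm_num : (0:ℝ) < 3⁻¹)]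
    linarith [hf.1 v, abs_nonneg (f v)]
  · rcases le_total (wt y) (wt x) with h | h
    · exact main x y h
    · rw [abs_sub_comm, norm_sub_rev]; exact main y x h

lemma W_bdd {μ ν : Measure (Vd d)} {R R' : ℝ} (hE : Emp R μ) (hE' : Emp R' ν) :
    BddAbove (Set.range fun f : testF d => (∫ v, (f : Vd d → ℝ) v ∂μ) - ∫ v, (f : Vd d → ℝ) v ∂ν) := by
  refine ⟨(∫ v, 2 * wt v ∂μ) + ∫ v, 2 * wt v ∂ν, ?_⟩
  rintro _ ⟨f, rfl⟩
  have hb : ∀ v, |(f : Vd d → ℝ) v| ≤ 2 * wt v := fun v => by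
    have := (testF_KK f.2).1 v
    rw [abs_mul, abs_of_pos (by norm_num : (0:ℝ) < 2⁻¹)] at this
    linarith
  have a1 := (abs_le.1 (emp_le hE hb)).2
  have a2 := (abs_le.1 (emp_le hE' hb)).1
  simp only
  linarith

lemma le_W {μ ν : Measure (Vd d)} {R R' : ℝ} (hE : Emp R μ) (hE' : Emp R' ν) {f : Vd d → ℝ} (hf : f ∈ KK d) :
    (∫ v, f v ∂μ) - ∫ v, f v ∂ν ≤ 3 * Wdist μ ν := by
  have := le_ciSup (W_bdd hE hE') ⟨_, KK_testF hf⟩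
  simp only [integral_const_mul] at this
  change _ ≤ Wdist μ ν at this
  linarith

lemma zero_KK : (fun _ => 0 : Vd d → ℝ) ∈ KK d := by
  refine ⟨fun v => by simpa using (wt_pos v).le, fun x y => ?_⟩
  have := wt_pos x
  have := wt_pos y
  rw [sub_self, abs_zero]
  positivity

lemma W_nonneg {μ ν : Measure (Vd d)} {R R' : ℝ} (hE : Emp R μ) (hE' : Emp R' ν) : 0 ≤ Wdist μ ν := by
  have := le_W hE hE' zero_KK
  simp at this
  linarith

lemma W_le {μ ν : Measure (Vd d)} {A : ℝ} (h : ∀ f ∈ KK d, (∫ v, f v ∂μ) - ∫ v, f v ∂ν ≤ A) :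
    Wdist μ ν ≤ 2 * A := by
  have : Nonempty (testF d) := ⟨⟨_, KK_testF zero_KK⟩⟩
  refine ciSup_le fun f => ?_
  have := h _ (testF_KK f.2)
  simp only [integral_const_mul] at this
  linarith

lemma rate (hd : 3 ≤ d) (hN : 0 < N) {K : ℕ} (hK : N < (2 ^ d) ^ (K + 1)) :
    ((2:ℝ) ^ K)⁻¹ ≤ 2 * (N:ℝ) ^ (-(1:ℝ) / d) := by
  have hd0 : (d:ℝ) ≠ 0 := by positivity
  have hN0 : (0:ℝ) < N := by exact_mod_cast hN
  have h1 : (N:ℝ) ≤ ((2:ℝ) ^ (K + 1)) ^ (d:ℝ) := by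
    rw [Real.rpow_natCast, ← pow_mul, mul_comm, pow_mul]
    exact_mod_cast hK.le
  have h2 : (N:ℝ) ^ (1 / (d:ℝ)) ≤ 2 ^ (K + 1) := by
    refine (Real.rpow_le_rpow hN0.le h1 (by positivity)).trans (le_of_eq ?_)
    rw [← Real.rpow_mul (by positivity), mul_one_div_cancel hd0, Real.rpow_one]
  rw [neg_div, Real.rpow_neg hN0.le]
  have h3 : ((2:ℝ) ^ (K + 1))⁻¹ ≤ ((N:ℝ) ^ (1 / (d:ℝ)))⁻¹ := inv_anti₀ (by positivity) h2
  rw [pow_succ, mul_inv] at h3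
  linarith

lemma final (hG : Good B b κ δ) (hd : 3 ≤ d) {τ T ε : ℝ} (hτ : 0 < τ) (hτT : τ ≤ T) (hε : 0 < ε) (hε1 : ε ≤ 1) :
    ∃ C : ℝ, 0 ≤ C ∧
      ∀ (Ω : Type) (m : MeasurableSpace Ω) (P : Measure Ω),
        IsProbabilityMeasure P →
      ∀ (𝓕 : MeasureTheory.Filtration ℝ m) (N N' : ℕ), N ≤ N' →
      ∀ (μN : ℝ → Ω → Measure (Vd d)) (μN' : ℝ → Ω → Measure (Vd d)),
        IsKacProcess B N P 𝓕 μN → IsKacProcess B N' P 𝓕 μN' →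
        ENNReal.ofReal (1 - ε) <
          P {ω | ∀ t ∈ Set.Icc τ T,
            Wdist (μN t ω) (μN' t ω) ≤
              C * (Wdist (μN τ ω) (μN' τ ω) + (N : ℝ) ^ (-(1:ℝ)/d))} := by
  have hκ := hG.κ1
  obtain ⟨C1, hC1, h1⟩ := one_proc hG hd hτ hτT (by positivity : 0 < ε / 3)
  have hΛ0 : 0 < 2 * C1 + 1 := by positivity
  set Λ := 2 * C1 + 1 with hΛ
  set e := Real.exp (6 * κ * Λ * (T - τ)) with he
  have he0 : 0 < e := Real.exp_pos _
  have hTτ : 0 ≤ T - τ := by linarith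
  have hc2 : 0 ≤ (2 * (e * ((T - τ) * (5 * κ * Λ)) + 1)) * (4 * C1) := by positivity
  refine ⟨6 * e + (2 * (e * ((T - τ) * (5 * κ * Λ)) + 1)) * (4 * C1), by positivity, ?_⟩
  intro Ω m0 P hP 𝓕 N N' hNN m n hm hn
  obtain ⟨ω0⟩ := nonempty_of_isProbabilityMeasure P
  have hN := (emp_data (hm.mem 0 ω0)).1
  have h2d : 1 < 2 ^ d := Nat.one_lt_two_pow (by omega)
  set K := Nat.log (2 ^ d) N with hK
  have hK1 : (2 ^ d) ^ K ≤ N := Nat.pow_log_le_self _ hN.ne'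
  have hK2 : N < (2 ^ d) ^ (K + 1) := Nat.lt_pow_succ_log_self h2d N
  have hr := rate hd hN hK2
  obtain ⟨B1, hB1, g1⟩ := h1 Ω m0 P hP 𝓕 N m hm K hK1
  obtain ⟨B2, hB2, g2⟩ := h1 Ω m0 P hP 𝓕 N' n hn K (hK1.trans hNN)
  set G := {ω | ∀ t ∈ Set.Icc τ T, Wdist (m t ω) (n t ω) ≤
      (6 * e + (2 * (e * ((T - τ) * (5 * κ * Λ)) + 1)) * (4 * C1)) * (Wdist (m τ ω) (n τ ω) + (N : ℝ) ^ (-(1:ℝ)/d))} with hGdef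
  have cover : (Set.univ : Set Ω) ⊆ G ∪ (B1 ∪ B2) := by
    intro ω _
    by_cases hω : ω ∈ B1 ∪ B2
    · exact Or.inr hω
    · refine Or.inl ?_
      have k1 := g1 ω (fun h => hω (Or.inl h))
      have k2 := g2 ω (fun h => hω (Or.inr h))
      have Em := emp_of_mem (hm.mem τ ω)
      have En := emp_of_mem (hn.mem τ ω)
      have W0 := W_nonneg Em En
      have n0 : (0:ℝ) ≤ (N : ℝ) ^ (-(1:ℝ)/d) := by positivity
      intro t ht
      have ep : (0:ℝ) ≤ 2 * (C1 * ((2:ℝ) ^ K)⁻¹) := by positivity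
      have st := W_le (μ := m t ω) (ν := n t ω) fun f hf => stab hG hm hn (τ := τ) (T := T) (ω := ω) hΛ0 ep
        (fun t a c => by have := (k1 t a c).1; have := (k2 t a c).1; linarith)
        (fun t a c g hg => (abs_sub _ _).trans (by have := (k1 t a c).2 g hg; have := (k2 t a c).2 g hg; linarith))
        (mul_nonneg (by norm_num : (0:ℝ) ≤ 3) W0) (fun f hf => le_W Em En hf) ht.1 ht.2 hf
      rw [← he] at st
      have eb : 2 * (C1 * ((2:ℝ) ^ K)⁻¹) ≤ 4 * C1 * (N : ℝ) ^ (-(1:ℝ)/d) := by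
        have := mul_le_mul_of_nonneg_left hr hC1
        linarith
      have c0 : 0 ≤ 2 * (e * ((T - τ) * (5 * κ * Λ)) + 1) := by positivity
      have q := mul_le_mul_of_nonneg_left eb c0
      set x := (N : ℝ) ^ (-(1:ℝ)/d)
      set w := Wdist (m τ ω) (n τ ω)
      have q2 := mul_nonneg hc2 W0
      have q3 : 0 ≤ 6 * e * x := by positivity
      calc _ ≤ _ := st
        _ = 6 * e * w + 2 * (e * ((T - τ) * (5 * κ * Λ)) + 1) * (2 * (C1 * ((2:ℝ) ^ K)⁻¹)) := by ring
        _ ≤ 6 * e * w + 2 * (e * ((T - τ) * (5 * κ * Λ)) + 1) * (4 * C1 * x) := by linarith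
        _ ≤ 6 * e * w + 2 * (e * ((T - τ) * (5 * κ * Λ)) + 1) * (4 * C1 * x) + 6 * e * x
            + 2 * (e * ((T - τ) * (5 * κ * Λ)) + 1) * (4 * C1) * w := by linarith
        _ = _ := by ring
  have hle : (1 : ℝ≥0∞) ≤ P G + ENNReal.ofReal (2 * ε / 3) := by
    calc (1 : ℝ≥0∞) = P Set.univ := (measure_univ).symm
      _ ≤ P (G ∪ (B1 ∪ B2)) := measure_mono cover
      _ ≤ P G + (P B1 + P B2) := (measure_union_le _ _).trans (add_le_add le_rfl (measure_union_le _ _))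
      _ ≤ P G + (ENNReal.ofReal (ε / 3) + ENNReal.ofReal (ε / 3)) := by gcongr
      _ = _ := by rw [← ENNReal.ofReal_add (by positivity) (by positivity)]; congr 2; ring
  have hfin : P G ≠ ⊤ := measure_ne_top P G
  rw [← ENNReal.ofReal_toReal hfin, ← ENNReal.ofReal_add ENNReal.toReal_nonneg (by positivity),
    ← ENNReal.ofReal_one, ENNReal.ofReal_le_ofReal_iff (by positivity)] at hle
  have hpos : 0 ≤ (P G).toReal := ENNReal.toReal_nonneg
  rw [← ENNReal.ofReal_toReal hfin]
  rw [ENNReal.ofReal_lt_ofReal_iff (by linarith)]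
  linarith

end partY

end KacPf

/-- Theorem 1.3 (consistency from a positive time, without initial moment hypotheses). -/
theorem kac_consistency_from_positive_time
    (d : ℕ) (hd : 3 ≤ d) (B : Vd d → Measure (Vd d)) (κ : ℝ)
    (hB : IsCollisionKernel B) (hBL : IsLipschitzKernel B κ)
    (ε : ℝ) (hε0 : 0 < ε) (hε1 : ε ≤ 1)
    (τ T : ℝ) (hτ : 0 < τ) (hτT : τ ≤ T) :
    ∃ C : ℝ, 0 ≤ C ∧
      ∀ (Ω : Type) (m : MeasurableSpace Ω) (P : Measure Ω),
        IsProbabilityMeasure P →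
      ∀ (𝓕 : MeasureTheory.Filtration ℝ m) (N N' : ℕ), N ≤ N' →
      ∀ (μN : ℝ → Ω → Measure (Vd d)) (μN' : ℝ → Ω → Measure (Vd d)),
        IsKacProcess B N P 𝓕 μN → IsKacProcess B N' P 𝓕 μN' →
        ENNReal.ofReal (1 - ε) <
          P {ω | ∀ t ∈ Set.Icc τ T,
            Wdist (μN t ω) (μN' t ω) ≤
              C * (Wdist (μN τ ω) (μN' τ ω) + (N : ℝ) ^ (-(1:ℝ)/d))} := by
  obtain ⟨b, δ, hG⟩ := KacPf.exists_good hd hB hBL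
  exact KacPf.final hG hd hτ hτT hε0 hε1
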